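/- Let q ≥ 2 and a be rational integers with a² < 4q, let α and ᾱ be the two complex conjugate roots of x² − a·x + q, and set n₀ = exp(exp(max{10^10, 3q})). Then for every positive integer n with n ≥ n₀, the rational integer (αⁿ − 1)(ᾱⁿ − 1) has a prime divisor p satisfying p ≥ n·exp(0.0001·log n/log log n). -/

import Mathlib

section SeriesInUnits

open Polynomial

section Extrapolation

variable {W : Type*} [CommRing W]

/-- The truncated binomial series `∑_{m < M} e m * X (X - 1) ⋯ (X - m + 1)`. -/
noncomputable def binomialSeriesPoly (e : ℕ → W) (M : ℕ) : W[X] :=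
  ∑ m ∈ Finset.range M, C (e m) * descPochhammer W m

lemma descPochhammer_comp_X_add_one (m : ℕ) :
    (descPochhammer W (m + 1)).comp (X + 1) =
      descPochhammer W (m + 1) + ((m : W[X]) + 1) * descPochhammer W m := by
  have h := congrArg (fun P : W[X] => P.comp (X + 1)) (descPochhammer_succ_comp_X_sub_one W m)
  have h1 : ((X : W[X]) - 1).comp (X + 1) = X := by simp
  simp only [comp_assoc, sub_comp, smul_eq_mul, mul_comp, h1, comp_X, add_comp, natCast_comp,
    one_comp] at h
  linear_combination -h

lemma binomialSeriesPoly_comp_X_add_one {e : ℕ → W} {M : ℕ} {x π : W}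
    (he : ∀ m : ℕ, ((m : W) + 1) * e (m + 1) = x * e m) (hπ : π * e M = 0) :
    C π * (binomialSeriesPoly e M).comp (X + 1) =
      C π * (C (1 + x) * binomialSeriesPoly e M) := by
  have key : ∀ N : ℕ, (binomialSeriesPoly e (N + 1)).comp (X + 1) =
      binomialSeriesPoly e (N + 1) + C x * binomialSeriesPoly e N := by
    intro N
    induction N with
    | zero => simp [binomialSeriesPoly]
    | succ N ih =>
      have h1 : binomialSeriesPoly e (N + 1 + 1) =
          binomialSeriesPoly e (N + 1) + C (e (N + 1)) * descPochhammer W (N + 1) := by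
        simp [binomialSeriesPoly, Finset.sum_range_succ]
      have h2 : binomialSeriesPoly e (N + 1) =
          binomialSeriesPoly e N + C (e N) * descPochhammer W N := by
        simp [binomialSeriesPoly, Finset.sum_range_succ]
      rw [h1, add_comp, ih, mul_comp, C_comp, descPochhammer_comp_X_add_one]
      have h3 : C (e (N + 1)) * ((N : W[X]) + 1) = C x * C (e N) := by
        rw [← C_mul, ← he N]; simp; ring
      linear_combination (descPochhammer W N) * h3 - C x * h2
  rcases M with _ | N
  · simp [binomialSeriesPoly]
  · rw [key N]
    have h2 : binomialSeriesPoly e (N + 1) =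
          binomialSeriesPoly e N + C (e N) * descPochhammer W N := by
        simp [binomialSeriesPoly, Finset.sum_range_succ]
    have h3 : C π * (C x * C (e N)) = 0 := by
      rw [← C_mul, ← C_mul, ← he N]
      rw [show π * (((N : W) + 1) * e (N + 1)) = (N + 1) * (π * e (N + 1)) by ring, hπ]; simp
    simp only [C_add, C_1]
    linear_combination (-C π * C x) * h2 - (descPochhammer W N) * h3

lemma binomialSeriesPoly_comp_X_add_natCast {e : ℕ → W} {M : ℕ} {x π : W}
    (he : ∀ m : ℕ, ((m : W) + 1) * e (m + 1) = x * e m) (hπ : π * e M = 0) (n : ℕ) :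
    C π * (binomialSeriesPoly e M).comp (X + (n : W[X])) =
      C π * (C ((1 + x) ^ n) * binomialSeriesPoly e M) := by
  induction n with
  | zero => simp
  | succ n ih =>
    have h := congrArg (fun P : W[X] => P.comp (X + (n : W[X])))
      (binomialSeriesPoly_comp_X_add_one he hπ)
    simp only [mul_comp, C_comp, comp_assoc, add_comp, X_comp, one_comp] at h
    rw [Nat.cast_add, Nat.cast_one, ← add_assoc, h, pow_succ, C_mul]
    linear_combination C (1 + x) * ih

lemma binomialSeriesPoly_eval_zero {e : ℕ → W} {M : ℕ} (hM : 0 < M) :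
    (binomialSeriesPoly e M).eval 0 = e 0 := by
  obtain ⟨N, rfl⟩ := Nat.exists_eq_succ_of_ne_zero hM.ne'
  simp only [binomialSeriesPoly, eval_finsetSum, eval_mul, eval_C]
  rw [Finset.sum_eq_single 0]
  · simp
  · intro m _ hm
    rw [descPochhammer_ne_zero_eval_zero _ hm, mul_zero]
  · simp

lemma natDegree_binomialSeriesPoly_lt {e : ℕ → W} {M : ℕ} (hM : 0 < M) :
    (binomialSeriesPoly e M).natDegree < M := by
  refine lt_of_le_of_lt (natDegree_sum_le_of_forall_le (n := M - 1) _ _ ?_) (by omega)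
  intro m hm
  refine (natDegree_C_mul_le _ _).trans ?_
  rw [← descPochhammer_map (Int.castRingHom W)]
  refine natDegree_map_le.trans ?_
  rw [descPochhammer_natDegree]
  have := Finset.mem_range.1 hm
  omega

theorem extrapolation {Λ : Type*} (s : Finset Λ) {e : ℕ → W} {M D : ℕ} {x π : W} (hM : 0 < M)
    (he0 : e 0 = 1) (he : ∀ m : ℕ, ((m : W) + 1) * e (m + 1) = x * e m) (hπ : π * e M = 0)
    (B : Λ → ℕ) (c : Λ → W) (S : Finset ℕ)
    (hS : ∀ a ∈ S, ∀ b ∈ S, a ≠ b → IsUnit ((a : W) - (b : W))) (hcard : M ≤ D * S.card)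
    (hvan : ∀ i < D, ∀ a ∈ S, ∑ l ∈ s, c l * (B l : W) ^ i * (1 + x) ^ (a * B l) = 0) (n : ℕ) :
    π * ∑ l ∈ s, c l * (1 + x) ^ (n * B l) = 0 := by
  nontriviality W
  set E := binomialSeriesPoly e M with hE
  set F : W[X] := ∑ l ∈ s, C (c l) * E.comp (C (B l : W) * X) with hF
  have hshift : ∀ a : ℕ, C π * F.comp (X + C (a : W)) =
      C π * ∑ l ∈ s, C (c l * (1 + x) ^ (a * B l)) * E.comp (C (B l : W) * X) := by
    intro a
    rw [hF, sum_comp, Finset.mul_sum, Finset.mul_sum]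
    refine Finset.sum_congr rfl fun l _ => ?_
    have h := congrArg (fun P : W[X] => P.comp (C (B l : W) * X))
      (binomialSeriesPoly_comp_X_add_natCast he hπ (a * B l))
    simp only [mul_comp, C_comp, comp_assoc, add_comp, X_comp, natCast_comp] at h
    have h2 : C (B l : W) * (X + C (a : W)) = C (B l : W) * X + ((a * B l : ℕ) : W[X]) := by
      push_cast; simp; ring
    simp only [mul_comp, C_comp, comp_assoc, X_comp, h2]
    rw [C_mul]
    linear_combination C (c l) * h
  have hdvd : ∀ a ∈ S, (X - C (a : W)) ^ D ∣ C π * F := by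
    intro a ha
    have h1 : (X : W[X]) ^ D ∣ C π * F.comp (X + C (a : W)) := by
      rw [hshift a]
      refine Dvd.dvd.mul_left ?_ _
      rw [X_pow_dvd_iff]
      intro i hi
      rw [finsetSum_coeff]
      have := hvan i hi a ha
      calc ∑ l ∈ s, (C (c l * (1 + x) ^ (a * B l)) * E.comp (C (B l : W) * X)).coeff i
          = ∑ l ∈ s, E.coeff i * (c l * (B l : W) ^ i * (1 + x) ^ (a * B l)) := by
            refine Finset.sum_congr rfl fun l _ => ?_
            rw [coeff_C_mul, comp_C_mul_X_coeff]; ring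
        _ = 0 := by rw [← Finset.mul_sum, this, mul_zero]
    obtain ⟨Q, hQ⟩ := h1
    refine ⟨Q.comp (X - C (a : W)), ?_⟩
    have h2 := congrArg (fun P : W[X] => P.comp (X - C (a : W))) hQ
    simpa [comp_assoc] using h2
  have hprod : ∏ a ∈ S, (X - C (a : W)) ^ D ∣ C π * F := by
    refine Finset.prod_dvd_of_coprime ?_ hdvd
    intro a ha b hb hab
    exact (isCoprime_X_sub_C_of_isUnit_sub (hS a ha b hb hab)).pow
  have hmonic : (∏ a ∈ S, (X - C (a : W)) ^ D).Monic :=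
    monic_prod_of_monic _ _ fun a _ => (monic_X_sub_C _).pow _
  have hdeg : (∏ a ∈ S, (X - C (a : W)) ^ D).natDegree = D * S.card := by
    rw [natDegree_prod_of_monic _ _ fun a _ => (monic_X_sub_C _).pow _]
    have h1 : ∀ a ∈ S, ((X - C (a : W)) ^ D).natDegree = D := fun a _ => by
      rw [(monic_X_sub_C (a : W)).natDegree_pow D, natDegree_X_sub_C, mul_one]
    rw [Finset.sum_congr rfl h1, Finset.sum_const, smul_eq_mul, mul_comm]
  have hFdeg : (C π * F).natDegree < M := by
    refine lt_of_le_of_lt ((natDegree_C_mul_le _ _).trans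
      (natDegree_sum_le_of_forall_le (n := M - 1) _ _ ?_)) (by omega)
    intro l _
    refine (natDegree_C_mul_le _ _).trans (natDegree_comp_le.trans ?_)
    have h1 := natDegree_binomialSeriesPoly_lt (e := e) hM
    have h2 : (C (B l : W) * X).natDegree ≤ 1 := (natDegree_C_mul_le _ _).trans natDegree_X_le
    calc _ ≤ E.natDegree * 1 := Nat.mul_le_mul_left _ h2
      _ ≤ M - 1 := by rw [hE]; omega
  have hzero : C π * F = 0 := by
    by_contra hne
    exact hmonic.not_dvd_of_natDegree_lt hne (by omega) hprod
  have hev := congrArg (eval 0) (hshift n)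
  have h0 : C π * F.comp (X + C (n : W)) = 0 := by
    have := congrArg (fun P : W[X] => P.comp (X + C (n : W))) hzero
    simpa using this
  rw [h0] at hev
  rw [eval_zero, eval_mul, eval_C, eval_finsetSum] at hev
  rw [hev]
  congr 1
  refine Finset.sum_congr rfl fun l _ => ?_
  rw [eval_mul, eval_C, eval_comp]
  simp [hE, binomialSeriesPoly_eval_zero hM, he0]

end Extrapolation

section DividedPowers

/-- The integer `p ^ m / p ^ e` times the inverse of the prime-to-`p` part of the factorial of `m`,
where `e` is the exponent of `p` in that factorial. -/
noncomputable def primeDividedPower (W : Type*) [CommRing W] (p m : ℕ) : W :=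
  (p : W) ^ (m - m.factorial.factorization p) *
    Ring.inverse (((m.factorial / p ^ m.factorial.factorization p : ℕ)) : W)

variable {W : Type*} [CommRing W] {p v : ℕ}

lemma isUnit_natCast_of_coprime_of_pow_eq_zero (hv : (p : W) ^ v = 0) {u : ℕ}
    (hu : p.Coprime u) : IsUnit (u : W) := by
  have h : IsCoprime ((u : ℤ)) ((p ^ v : ℕ) : ℤ) := by
    rw [Nat.isCoprime_iff_coprime]
    exact (hu.pow_left v).symm
  obtain ⟨r, t, hrt⟩ := h
  have := congrArg (Int.cast : ℤ → W) hrt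
  push_cast at this
  rw [hv, mul_zero, add_zero] at this
  exact IsUnit.of_mul_eq_one_right _ this

lemma isUnit_intCast_of_pow_eq_zero (hp : p.Prime) (hv : (p : W) ^ v = 0) {u : ℤ}
    (hu : ¬ (p : ℤ) ∣ u) : IsUnit (u : W) := by
  have h : p.Coprime u.natAbs := (hp.coprime_iff_not_dvd).2 fun h => hu (Int.natCast_dvd.2 h)
  have := isUnit_natCast_of_coprime_of_pow_eq_zero (W := W) hv h
  rcases Int.natAbs_eq u with h | h
  · rw [h]; simpa using this
  · rw [h]; simpa using this

lemma two_mul_factorization_factorial_le (hp : p.Prime) (hp3 : 3 ≤ p) (m : ℕ) :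
    2 * m.factorial.factorization p ≤ m := by
  have := Fact.mk hp
  have h := sub_one_mul_padicValNat_factorial (p := p) m
  rw [Nat.factorization_def _ hp]
  have : 2 * padicValNat p m.factorial ≤ (p - 1) * padicValNat p m.factorial :=
    Nat.mul_le_mul_right _ (by omega)
  omega

lemma primeDividedPower_zero : primeDividedPower W p 0 = 1 := by
  simp [primeDividedPower]

lemma succ_mul_primeDividedPower_succ (hp : p.Prime) (hp3 : 3 ≤ p) (hv : (p : W) ^ v = 0)
    (m : ℕ) : ((m : W) + 1) * primeDividedPower W p (m + 1) = p * primeDividedPower W p m := by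
  have ha := two_mul_factorization_factorial_le hp hp3 m
  have ha' := two_mul_factorization_factorial_le hp hp3 (m + 1)
  have h1 := Nat.ordProj_mul_ordCompl_eq_self m.factorial p
  have h2 := Nat.ordProj_mul_ordCompl_eq_self (m + 1).factorial p
  have hu := isUnit_natCast_of_coprime_of_pow_eq_zero (W := W) hv
    (Nat.coprime_ordCompl hp m.factorial_ne_zero)
  have hu' := isUnit_natCast_of_coprime_of_pow_eq_zero (W := W) hv
    (Nat.coprime_ordCompl hp (m + 1).factorial_ne_zero)
  simp only [primeDividedPower]
  set a := m.factorial.factorization p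
  set a' := (m + 1).factorial.factorization p
  set u := m.factorial / p ^ a
  set u' := (m + 1).factorial / p ^ a'
  have key : (m + 1) * p ^ (m + 1 - a') * u = p * p ^ (m - a) * u' := by
    have hpos : 0 < p ^ (a + a') := pow_pos hp.pos _
    refine Nat.eq_of_mul_eq_mul_left hpos ?_
    have e1 : p ^ (m + 1) = p ^ a' * p ^ (m + 1 - a') := by
      rw [← pow_add]; congr 1; omega
    have e2 : p ^ m = p ^ a * p ^ (m - a) := by
      rw [← pow_add]; congr 1; omega
    calc p ^ (a + a') * ((m + 1) * p ^ (m + 1 - a') * u)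
        = (p ^ a' * p ^ (m + 1 - a')) * ((m + 1) * (p ^ a * u)) := by rw [pow_add]; ring
      _ = p ^ (m + 1) * (p ^ a' * u') := by rw [← e1, h1, h2, Nat.factorial_succ]
      _ = p * (p ^ a * p ^ (m - a)) * (p ^ a' * u') := by rw [← e2]; ring
      _ = _ := by rw [pow_add]; ring
  have keyW := congrArg (Nat.cast : ℕ → W) key
  push_cast at keyW
  have i1 := Ring.inverse_mul_cancel _ hu
  have i2 := Ring.inverse_mul_cancel _ hu'
  linear_combination (Ring.inverse (u : W) * Ring.inverse (u' : W)) * keyW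
    - ((m : W) + 1) * p ^ (m + 1 - a') * Ring.inverse (u' : W) * i1
    + p * p ^ (m - a) * Ring.inverse (u : W) * i2

lemma pow_mul_primeDividedPower_eq_zero (hp : p.Prime) (hp3 : 3 ≤ p) (hv : (p : W) ^ v = 0)
    {h : ℕ} (hh : h ≤ v) : (p : W) ^ (v - h) * primeDividedPower W p (2 * h) = 0 := by
  have ha := two_mul_factorization_factorial_le hp hp3 (2 * h)
  rw [primeDividedPower, ← mul_assoc, ← pow_add,
    pow_eq_zero_of_le (by omega) hv, zero_mul]

/-- Extrapolation with precision `p ^ h` out of `p ^ v`. -/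
theorem extrapolation_prime (hp : p.Prime) (hp3 : 3 ≤ p) (hv : (p : W) ^ v = 0) {h : ℕ}
    (hpos : 0 < h) (hh : h ≤ v) {Λ : Type*} (s : Finset Λ) (B : Λ → ℕ) (c : Λ → W)
    (S : Finset ℕ) (hS : ∀ a ∈ S, a < p) {D : ℕ} (hcard : 2 * h ≤ D * S.card)
    (hvan : ∀ i < D, ∀ a ∈ S, ∑ l ∈ s, c l * (B l : W) ^ i * (1 + (p : W)) ^ (a * B l) = 0)
    (n : ℕ) : (p : W) ^ (v - h) * ∑ l ∈ s, c l * (1 + (p : W)) ^ (n * B l) = 0 := by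
  refine extrapolation s (M := 2 * h) (by omega) primeDividedPower_zero
    (succ_mul_primeDividedPower_succ hp hp3 hv)
    (pow_mul_primeDividedPower_eq_zero hp hp3 hv hh) B c S ?_ hcard hvan n
  intro a ha b hb hab
  have ha' := hS a ha
  have hb' := hS b hb
  have : ¬ (p : ℤ) ∣ (a : ℤ) - b := by
    intro hd
    have := Int.eq_zero_of_abs_lt_dvd hd (by rw [abs_lt]; constructor <;> omega)
    omega
  have := isUnit_intCast_of_pow_eq_zero hp hv this
  simpa using this

end DividedPowers

end SeriesInUnits

section Elimination

universe u

namespace QuadraticAlgebra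

/-- The ring homomorphism out of `R[ω]` determined by its restriction to `R` and the image
of `ω`. -/
def liftRingHom {R W : Type*} [CommRing R] [CommRing W] {a b : R} (φ : R →+* W) (w : W)
    (hw : w * w = φ a + φ b * w) : QuadraticAlgebra R a b →+* W where
  toFun z := φ z.re + φ z.im * w
  map_zero' := by simp
  map_one' := by simp [re_one, im_one]
  map_add' y z := by simp; ring
  map_mul' y z := by
    simp only [re_mul, im_mul, map_add, map_mul]
    linear_combination (-φ y.im * φ z.im) * hw

lemma liftRingHom_apply {R W : Type*} [CommRing R] [CommRing W] {a b : R} (φ : R →+* W) (w : W)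
    (hw : w * w = φ a + φ b * w) (z : QuadraticAlgebra R a b) :
    liftRingHom φ w hw z = φ z.re + φ z.im * w := rfl

lemma isDomain_of_norm {R : Type*} [CommRing R] [IsDomain R] {a b : R}
    (h : ∀ z : QuadraticAlgebra R a b, norm z = 0 → z = 0) : IsDomain (QuadraticAlgebra R a b) := by
  have : NoZeroDivisors (QuadraticAlgebra R a b) := ⟨fun {x y} hxy => by
    have := congrArg norm hxy
    rw [map_mul, norm_zero] at this
    rcases mul_eq_zero.1 this with h1 | h1
    · exact Or.inl (h _ h1)
    · exact Or.inr (h _ h1)⟩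
  exact NoZeroDivisors.to_isDomain _

end QuadraticAlgebra

open QuadraticAlgebra in
theorem eq_zero_of_sum_sqrt_eq_zero {J W : Type*} [DecidableEq J] [CommRing W] (w : J → W)
    (t : J → ℝ) (ht0 : ∀ j, 0 ≤ t j) (π : W) (S : Finset J) :
    ∀ {A : Type u} [CommRing A] [IsDomain A] (_ : (2 : A) ≠ 0) (ν : A → ℝ) (_ : ∀ x, 0 ≤ ν x)
      (_ : ν 0 = 0)
      (_ : ∀ x y, ν (x + y) ≤ ν x + ν y) (_ : ∀ x, ν (-x) = ν x)
      (_ : ∀ x y, ν (x * y) ≤ ν x * ν y) (φ : A →+* W) (ξ : J → A)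
      (_ : ∀ j ∈ S, w j ^ 2 = φ (ξ j)) (_ : ∀ j ∈ S, ν (ξ j) ≤ t j ^ 2)
      (_ : ∀ T ⊆ S, T.Nonempty → ∀ y z : A, y ^ 2 = (∏ j ∈ T, ξ j) * z ^ 2 → z = 0)
      (β : ℝ) (_ : ∀ y, π * φ y = 0 → ν y < β → y = 0) (Θ : Finset J → A)
      (_ : π * ∑ T ∈ S.powerset, (∏ j ∈ T, w j) * φ (Θ T) = 0)
      (_ : (∑ T ∈ S.powerset, (∏ j ∈ T, t j) * ν (Θ T)) ^ (2 ^ S.card) < β),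
      ∀ T ∈ S.powerset, Θ T = 0 := by
  induction S using Finset.induction_on with
  | empty =>
    intro A _ _ _ ν _ _ _ _ _ φ ξ _ _ _ β hLP Θ h0 hsize T hT
    simp only [Finset.powerset_empty, Finset.mem_singleton] at hT
    subst hT
    simp only [Finset.powerset_empty, Finset.sum_singleton, Finset.prod_empty, one_mul,
      Finset.card_empty, pow_zero, pow_one] at h0 hsize
    exact hLP _ h0 hsize
  | insert a S haS ih =>
    intro A _ _ h2 ν hν0 hνz hνadd hνneg hνmul φ ξ hw ht hInd β hLP Θ h0 hsize
    have hwa : w a * w a = φ (ξ a) + φ 0 * w a := by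
      rw [← pow_two, hw a (Finset.mem_insert_self _ _)]; simp
    have hνa := ht a (Finset.mem_insert_self _ _)
    have hInda : ∀ y z : A, y ^ 2 = ξ a * z ^ 2 → z = 0 := by
      intro y z h
      exact hInd {a} (by simp) (by simp) y z (by simpa using h)
    let φ' : QuadraticAlgebra A (ξ a) 0 →+* W := liftRingHom φ (w a) hwa
    have hφ' : ∀ z, φ' z = φ z.re + φ z.im * w a := fun z => rfl
    have hnorm : ∀ z : QuadraticAlgebra A (ξ a) 0, norm z = 0 → z = 0 := by
      intro z hz
      rw [norm_def] at hz
      have h1 : z.im = 0 := hInda z.re z.im (by linear_combination hz)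
      rw [h1] at hz
      have h3 : z.re = 0 := by
        have : z.re * z.re = 0 := by linear_combination hz
        exact mul_self_eq_zero.1 this
      ext <;> simp [h1, h3]
    have hdom := isDomain_of_norm hnorm
    have hφC : ∀ x : A, φ' (QuadraticAlgebra.C x) = φ x := fun x => by simp [hφ']
    let ν' : QuadraticAlgebra A (ξ a) 0 → ℝ := fun z => ν z.re + t a * ν z.im
    have hν' : ∀ z, ν' z = ν z.re + t a * ν z.im := fun z => rfl
    have hν0' : ∀ z, 0 ≤ ν' z := fun z => add_nonneg (hν0 _) (mul_nonneg (ht0 a) (hν0 _))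
    have hsplit : ∀ f : Finset J → ℝ, ∑ T ∈ (insert a S).powerset, (∏ j ∈ T, t j) * f T =
        ∑ T ∈ S.powerset, (∏ j ∈ T, t j) * (f T + t a * f (insert a T)) := by
      intro f
      rw [Finset.sum_powerset_insert haS, ← Finset.sum_add_distrib]
      refine Finset.sum_congr rfl fun T hT => ?_
      rw [Finset.prod_insert fun h => haS (Finset.mem_powerset.1 hT h)]
      ring
    have hsplitW : ∀ f : Finset J → W, ∑ T ∈ (insert a S).powerset, (∏ j ∈ T, w j) * f T =
        ∑ T ∈ S.powerset, (∏ j ∈ T, w j) * (f T + w a * f (insert a T)) := by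
      intro f
      rw [Finset.sum_powerset_insert haS, ← Finset.sum_add_distrib]
      refine Finset.sum_congr rfl fun T hT => ?_
      rw [Finset.prod_insert fun h => haS (Finset.mem_powerset.1 hT h)]
      ring
    set s := ∑ T ∈ (insert a S).powerset, (∏ j ∈ T, t j) * ν (Θ T) with hs
    have hs0 : 0 ≤ s := Finset.sum_nonneg fun T _ =>
      mul_nonneg (Finset.prod_nonneg fun j _ => ht0 j) (hν0 _)
    have hβ0 : 0 ≤ β := (pow_nonneg hs0 _).trans hsize.le
    let Θ' : Finset J → QuadraticAlgebra A (ξ a) 0 := fun T => ⟨Θ T, Θ (insert a T)⟩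
    have key := ih (A := QuadraticAlgebra A (ξ a) 0)
      (fun h => h2 (by have := congrArg QuadraticAlgebra.re h; simpa using this)) ν' hν0'
      (by simp [hν', hνz])
      (fun x y => by
        have h1 := hνadd x.re y.re
        have h3 := mul_le_mul_of_nonneg_left (hνadd x.im y.im) (ht0 a)
        simp only [hν', re_add, im_add]
        linarith)
      (fun x => by simp [hν', hνneg])
      (fun x y => by
        simp only [hν', re_mul, im_mul, zero_mul, add_zero]
        have h1 := hνadd (x.re * y.re) (ξ a * x.im * y.im)
        have h3 := hνmul x.re y.re
        have h4 : ν (ξ a * x.im * y.im) ≤ t a ^ 2 * (ν x.im * ν y.im) := by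
          refine (hνmul _ _).trans ?_
          have := (hνmul (ξ a) x.im).trans (mul_le_mul_of_nonneg_right hνa (hν0 _))
          calc _ ≤ t a ^ 2 * ν x.im * ν y.im := mul_le_mul_of_nonneg_right this (hν0 _)
            _ = _ := by ring
        have h5 := mul_le_mul_of_nonneg_left
          ((hνadd (x.re * y.im) (x.im * y.re)).trans
            (add_le_add (hνmul x.re y.im) (hνmul x.im y.re))) (ht0 a)
        nlinarith)
      φ' (fun j => QuadraticAlgebra.C (ξ j))
      (fun j hj => by rw [hφC]; exact hw j (Finset.mem_insert_of_mem hj))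
      (fun j hj => by
        simp only [hν', re_C, im_C, hνz]
        simpa using ht j (Finset.mem_insert_of_mem hj))
      (fun T hTS hT y z h => by
        refine hnorm z ?_
        have haT : a ∉ T := fun h => haS (hTS h)
        have hprod : (∏ j ∈ T, QuadraticAlgebra.C (ξ j) : QuadraticAlgebra A (ξ a) 0) =
            algebraMap A _ (∏ j ∈ T, ξ j) := by
          rw [map_prod]; rfl
        set P := ∏ j ∈ T, ξ j with hP
        have h6 : (y * star z) ^ 2 = algebraMap A _ (P * norm z ^ 2) := by
          rw [mul_pow, h, hprod, map_mul, map_pow, algebraMap_norm_eq_mul_star]; ring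
        have hre := congrArg QuadraticAlgebra.re h6
        have him := congrArg QuadraticAlgebra.im h6
        set u := y * star z with hu
        rw [pow_two, re_mul, algebraMap_re] at hre
        rw [pow_two, im_mul, algebraMap_im] at him
        have h7 : u.re = 0 ∨ u.im = 0 := by
          have : 2 * (u.re * u.im) = 0 := by linear_combination him
          rcases mul_eq_zero.1 this with h | h
          · exact absurd h h2
          · exact mul_eq_zero.1 h
        rcases h7 with h7 | h7
        · refine hInd (insert a T) (Finset.insert_subset_insert _ hTS) (by simp)
            (ξ a * u.im) _ ?_
          rw [Finset.prod_insert haT, ← hP]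
          rw [h7] at hre
          linear_combination ξ a * hre
        · refine hInd T (hTS.trans (Finset.subset_insert _ _)) hT u.re _ ?_
          rw [← hP]
          rw [h7] at hre
          linear_combination hre)
      (Real.sqrt β)
      (fun y hy hlt => by
        refine hnorm y (hLP _ ?_ ?_)
        · rw [← hφC (norm y), C_eq_algebraMap, algebraMap_norm_eq_mul_star, map_mul, ← mul_assoc,
            hy, zero_mul]
        · have h8 : ν (norm y) ≤ ν' y ^ 2 := by
            rw [norm_def]
            have e : y.re * y.re + 0 * y.re * y.im - ξ a * y.im * y.im =
              y.re * y.re + -(ξ a * y.im * y.im) := by ring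
            rw [e]
            have h1 := hνadd (y.re * y.re) (-(ξ a * y.im * y.im))
            rw [hνneg] at h1
            have h3 := hνmul y.re y.re
            have h4 : ν (ξ a * y.im * y.im) ≤ t a ^ 2 * (ν y.im * ν y.im) := by
              refine (hνmul _ _).trans ?_
              have := (hνmul (ξ a) y.im).trans (mul_le_mul_of_nonneg_right hνa (hν0 _))
              calc _ ≤ t a ^ 2 * ν y.im * ν y.im := mul_le_mul_of_nonneg_right this (hν0 _)
                _ = _ := by ring
            have h5 := mul_nonneg (ht0 a) (mul_nonneg (hν0 y.re) (hν0 y.im))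
            rw [hν']
            nlinarith
          exact h8.trans_lt ((Real.lt_sqrt (hν0' y)).1 hlt))
      Θ'
      (by
        rw [hsplitW] at h0
        rw [← h0]
        congr 1
        refine Finset.sum_congr rfl fun T _ => ?_
        simp only [hφ', Θ']
        ring)
      (by
        have : ∑ T ∈ S.powerset, (∏ j ∈ T, t j) * ν' (Θ' T) = s := by
          rw [hs, hsplit]
        rw [this]
        refine (Real.lt_sqrt (pow_nonneg hs0 _)).2 ?_
        rwa [← pow_mul, ← pow_succ, ← Finset.card_insert_of_notMem haS])
    intro T hT
    by_cases haT : a ∈ T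
    · have h9 : T.erase a ∈ S.powerset := by
        rw [Finset.mem_powerset] at hT ⊢
        intro x hx
        rcases Finset.mem_insert.1 (hT (Finset.mem_of_mem_erase hx)) with h | h
        · exact absurd h (Finset.ne_of_mem_erase hx)
        · exact h
      have := congrArg QuadraticAlgebra.im (key _ h9)
      simpa [Θ', Finset.insert_erase haT] using this
    · have h9 : T ∈ S.powerset := by
        rw [Finset.mem_powerset] at hT ⊢
        exact (Finset.subset_insert_iff_of_notMem haT).1 hT
      have := congrArg QuadraticAlgebra.re (key _ h9)
      simpa [Θ'] using this

end Elimination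

section Descent

open Finset

/-- Data for the descent: a ring `O` of complex numbers with multiplicatively independent
elements `ξ (some j)` and a root of unity `ξ none`, together with a reduction `φ : O → W` modulo
`p ^ v`, in which the logarithms to the base `1 + p` of the `ξ (some j)` are the natural
numbers `b j` (and `0` for `j = none`). -/
structure DescentData (O W : Type*) [CommRing O] [CommRing W] (k : ℕ) where
  ι : O →+* ℂ
  φ : O →+* W
  p : ℕ
  v : ℕ
  G : ℕ
  f : ℕ
  N₀ : ℕ
  hf : ℕ
  ξ : Option (Option (Fin k)) → O
  w : Option (Option (Fin k)) → W
  b : Fin k → ℕ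
  Z : ℝ
  two_ne_zero : (2 : O) ≠ 0
  prime : p.Prime
  three_le : 3 ≤ p
  pow_v : (p : W) ^ v = 0
  eq_zero_of_small : ∀ h ≤ v, ∀ y : O, (p : W) ^ (v - h) * φ y = 0 → ‖ι y‖ ^ 2 < (p : ℝ) ^ h → y = 0
  pow_N₀ : ξ none ^ N₀ = -1
  norm_none : ‖ι (ξ none)‖ = 1
  one_le_norm : ∀ j, 1 ≤ ‖ι (ξ (some j))‖
  w_sq : ∀ j, w j ^ 2 = φ (ξ j)
  sq_eq : ∀ x y : W, IsUnit y → x ^ 2 = y ^ 2 → x = y ∨ x = -y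
  pow_hf : (1 + (p : W)) ^ (2 * hf) = 1 + p
  indep : ∀ m m' : Option (Fin k) → ℕ,
    ∏ j, ‖ι (ξ (some j))‖ ^ m j = ∏ j, ‖ι (ξ (some j))‖ ^ m' j → m = m'
  kummer : ∀ T : Finset (Option (Option (Fin k))), T.Nonempty → ∀ y z : O,
    y ^ 2 = (∏ j ∈ T, ξ j) * z ^ 2 → z = 0
  one_le_G : 1 ≤ G
  le_v : 2 ^ (G + k + 1) ≤ v
  le_p : 2 ^ (G + k + 3) ≤ p
  small : (∏ j, ‖ι (ξ (some j))‖) ^ 2 ^ (f + 5) < p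
  hfk : f * (k + 1) ≤ G + 2
  Z_le : Z ≤ (∏ j, ‖ι (ξ (some j))‖) ^ 2 ^ (G + f + 2)

namespace DescentData

variable {O W : Type*} [CommRing O] [CommRing W] {k : ℕ} (C : DescentData O W k)

/-- The product of binomial coefficients attached to `l` and `τ`. -/
def binom (l : Option (Fin k) → ℕ) (τ : Fin k → ℕ) : ℕ := ∏ i, (l (some i)).choose (τ i)

/-- The logarithm of `∏ j, ξ (some j) ^ l j`. -/
def B (l : Option (Fin k) → ℕ) : ℕ := ∑ i, C.b i * l (some i)

/-- The monomial with exponents `E`. -/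
def mon (E : Option (Option (Fin k)) → ℕ) : O := ∏ j, C.ξ j ^ E j

/-- The product of the absolute values of the `ξ (some j)`. -/
noncomputable def P : ℝ := ∏ j, ‖C.ι (C.ξ (some j))‖

lemma one_le_P : 1 ≤ C.P := by
  rw [P]
  simpa using Finset.prod_le_prod (s := univ) (f := fun _ => (1 : ℝ)) (fun _ _ => zero_le_one)
    fun j _ => C.one_le_norm j

lemma norm_mon (E : Option (Option (Fin k)) → ℕ) :
    ‖C.ι (C.mon E)‖ = ∏ j, ‖C.ι (C.ξ (some j))‖ ^ E (some j) := by
  rw [mon, map_prod, norm_prod, Fintype.prod_option]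
  simp [C.norm_none]

lemma norm_mon_le {E : Option (Option (Fin k)) → ℕ} {n : ℕ} (h : ∀ j, E (some j) ≤ n) :
    ‖C.ι (C.mon E)‖ ≤ C.P ^ n := by
  rw [norm_mon, P, ← Finset.prod_pow]
  exact Finset.prod_le_prod (fun _ _ => by positivity)
    fun j _ => pow_le_pow_right₀ (C.one_le_norm j) (h j)

lemma binom_mul (l : Option (Fin k) → ℕ) (τ : Fin k → ℕ) (i : Fin k) :
    binom l τ * l (some i) =
      (τ i + 1) * binom l (Function.update τ i (τ i + 1)) + τ i * binom l τ := by
  have h1 : ∀ σ : Fin k → ℕ, binom l σ =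
      (l (some i)).choose (σ i) * ∏ j ∈ univ.erase i, (l (some j)).choose (σ j) := fun σ =>
    (Finset.mul_prod_erase _ _ (mem_univ i)).symm
  have h2 : ∏ j ∈ univ.erase i, (l (some j)).choose (Function.update τ i (τ i + 1) j) =
      ∏ j ∈ univ.erase i, (l (some j)).choose (τ j) :=
    Finset.prod_congr rfl fun j hj => by rw [Function.update_of_ne (ne_of_mem_erase hj)]
  rw [h1 τ, h1 (Function.update τ i (τ i + 1)), h2, Function.update_self]
  set R := ∏ j ∈ univ.erase i, (l (some j)).choose (τ j)
  have h3 : (l (some i)).choose (τ i) * l (some i) =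
      (τ i + 1) * (l (some i)).choose (τ i + 1) + τ i * (l (some i)).choose (τ i) := by
    rcases le_or_gt (τ i) (l (some i)) with h | h
    · have := Nat.choose_succ_right_eq (l (some i)) (τ i)
      zify [h] at this ⊢
      linear_combination -this
    · rw [Nat.choose_eq_zero_of_lt h, Nat.choose_eq_zero_of_lt (by omega)]; simp
  calc _ = ((l (some i)).choose (τ i) * l (some i)) * R := by ring
    _ = _ := by rw [h3]; ring

lemma sum_binom_mul_pow_eq_zero {L : Finset (Option (Fin k) → ℕ)}
    {u : (Option (Fin k) → ℕ) → W} {T : ℕ}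
    (h : ∀ τ : Fin k → ℕ, ∑ i, τ i < T → ∑ l ∈ L, u l * (binom l τ : W) = 0) (n : ℕ) :
    ∀ τ : Fin k → ℕ, ∑ i, τ i + n < T → ∑ l ∈ L, u l * (binom l τ : W) * (C.B l : W) ^ n = 0 := by
  induction n with
  | zero => intro τ hτ; simpa using h τ (by simpa using hτ)
  | succ n ih =>
    intro τ hτ
    have key : ∀ i : Fin k, ∑ l ∈ L, u l * (binom l τ : W) * (C.B l : W) ^ n * (l (some i) : W)
        = 0 := by
      intro i
      have h1 := ih τ (by omega)
      have h2 := ih (Function.update τ i (τ i + 1)) (by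
        rw [Finset.sum_update_of_mem (mem_univ i), ← Finset.erase_eq]
        have := Finset.add_sum_erase univ τ (mem_univ i)
        omega)
      calc _ = ∑ l ∈ L, (((τ i : W) + 1) * (u l * (binom l (Function.update τ i (τ i + 1)) : W) *
              (C.B l : W) ^ n) + (τ i : W) * (u l * (binom l τ : W) * (C.B l : W) ^ n)) := by
            refine Finset.sum_congr rfl fun l _ => ?_
            have h3 := congrArg (Nat.cast : ℕ → W) (binom_mul l τ i)
            push_cast at h3
            linear_combination u l * (C.B l : W) ^ n * h3
        _ = 0 := by
          rw [Finset.sum_add_distrib, ← Finset.mul_sum, ← Finset.mul_sum, h1, h2]; simp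
    calc _ = ∑ l ∈ L, ∑ i, (C.b i : W) *
            (u l * (binom l τ : W) * (C.B l : W) ^ n * (l (some i) : W)) := by
          refine Finset.sum_congr rfl fun l _ => ?_
          rw [pow_succ, ← mul_assoc]
          nth_rewrite 2 [B]
          push_cast
          rw [Finset.mul_sum]
          exact Finset.sum_congr rfl fun i _ => by ring
      _ = ∑ i, (C.b i : W) * ∑ l ∈ L,
            (u l * (binom l τ : W) * (C.B l : W) ^ n * (l (some i) : W)) := by
          rw [Finset.sum_comm]
          exact Finset.sum_congr rfl fun i _ => by rw [Finset.mul_sum]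
      _ = 0 := by simp [key]

/-- The state of the descent at level `I`, apart from the vanishing conditions. -/
structure Level (I : ℕ) (c : (Option (Fin k) → ℕ) → ℤ) where
  L : Finset (Option (Fin k) → ℕ)
  E : (Option (Fin k) → ℕ) → Option (Option (Fin k)) → ℕ
  r : W
  t : ℕ
  nonempty : L.Nonempty
  c_ne_zero : ∀ l ∈ L, c l ≠ 0
  lt : ∀ l ∈ L, ∀ j, l j < 2 ^ (C.G + C.f)
  E_some : ∀ l ∈ L, ∀ j, E l (some j) = l j / 2 ^ I
  isUnit : IsUnit r
  map_mon : ∀ l ∈ L, C.φ (C.mon (E l)) = r * (1 + (C.p : W)) ^ (t * C.B l)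
  inj : ∀ l ∈ L, ∀ l' ∈ L, (∀ j, l j / 2 ^ I = l' j / 2 ^ I) → l = l'
  size : ∀ τ, ∑ l ∈ L, |(c l : ℝ)| * (binom l τ : ℝ) ≤ C.Z

namespace Level

variable {C} {I : ℕ} {c : (Option (Fin k) → ℕ) → ℤ} (A : C.Level I c)

/-- The auxiliary function vanishes at `s` with order `T`. -/
def Vanish (s T : ℕ) : Prop :=
  ∀ τ : Fin k → ℕ, ∑ i, τ i < T →
    ∑ l ∈ A.L, (c l : O) * (binom l τ : O) * C.mon (A.E l) ^ s = 0

variable {A}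

lemma Vanish.mono {s T T' : ℕ} (h : A.Vanish s T) (hT : T' ≤ T) : A.Vanish s T' :=
  fun τ hτ => h τ (hτ.trans_le hT)

lemma extrapolate {h D T : ℕ} (hpos : 0 < h) (hv : h ≤ C.v) {S : Finset ℕ}
    (hS : ∀ s ∈ S, s < C.p) (hcard : 2 * h ≤ D * S.card) (hvan : ∀ s ∈ S, A.Vanish s (T + D))
    {τ : Fin k → ℕ} (hτ : ∑ i, τ i < T) (n : ℕ) :
    (C.p : W) ^ (C.v - h) *
      ∑ l ∈ A.L, (c l : W) * (binom l τ : W) * (1 + (C.p : W)) ^ (n * (A.t * C.B l)) = 0 := by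
  refine extrapolation_prime C.prime C.three_le C.pow_v hpos hv A.L (fun l => A.t * C.B l)
    (fun l => (c l : W) * (binom l τ : W)) S hS (D := D) hcard ?_ n
  intro i hi s hs
  have h1 : ∀ σ : Fin k → ℕ, ∑ i, σ i < T + D →
      ∑ l ∈ A.L, ((c l : W) * (1 + (C.p : W)) ^ (s * (A.t * C.B l))) * (binom l σ : W) = 0 := by
    intro σ hσ
    have h2 := congrArg C.φ (hvan s hs σ hσ)
    rw [map_sum, map_zero] at h2
    refine (A.isUnit.pow s).mul_left_cancel ?_
    rw [mul_zero, ← h2, Finset.mul_sum]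
    refine Finset.sum_congr rfl fun l hl => ?_
    rw [map_mul, map_mul, map_pow, A.map_mon l hl, map_intCast, map_natCast, mul_pow, ← pow_mul,
      mul_comm (A.t * C.B l) s]
    ring
  have h3 := C.sum_binom_mul_pow_eq_zero h1 i τ (by omega)
  calc _ = (A.t : W) ^ i * ∑ l ∈ A.L, (c l : W) * (1 + (C.p : W)) ^ (s * (A.t * C.B l)) *
        (binom l τ : W) * (C.B l : W) ^ i := by
        rw [Finset.mul_sum]
        refine Finset.sum_congr rfl fun l _ => ?_
        push_cast
        rw [mul_pow]; ring
    _ = 0 := by rw [h3, mul_zero]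

lemma E_le {l : Option (Fin k) → ℕ} (hl : l ∈ A.L) (hI : I ≤ C.G + C.f) (j : Option (Fin k)) :
    A.E l (some j) ≤ 2 ^ (C.G + C.f - I) := by
  rw [A.E_some l hl]
  refine Nat.div_le_of_le_mul ?_
  rw [← pow_add, Nat.add_sub_cancel' hI]
  exact (A.lt l hl j).le

lemma norm_sum_le (τ : Fin k → ℕ) (y : (Option (Fin k) → ℕ) → O) {Y : ℝ}
    (hy : ∀ l ∈ A.L, ‖C.ι (y l)‖ ≤ Y) (hY : 0 ≤ Y) :
    ∑ l ∈ A.L, ‖C.ι ((c l : O) * (binom l τ : O) * y l)‖ ≤ C.Z * Y := by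
  refine le_trans ?_ (mul_le_mul_of_nonneg_right (A.size τ) hY)
  rw [Finset.sum_mul]
  refine Finset.sum_le_sum fun l hl => ?_
  rw [map_mul, map_mul, map_intCast, map_natCast, norm_mul, norm_mul, Complex.norm_intCast,
    Complex.norm_natCast]
  exact mul_le_mul_of_nonneg_left (hy l hl) (by positivity)

lemma vanish_of_extrapolate {h D T n : ℕ} (hI : I ≤ C.G + C.f) (hpos : 0 < h) (hv : h ≤ C.v)
    {S : Finset ℕ} (hS : ∀ s ∈ S, s < C.p) (hcard : 2 * h ≤ D * S.card)
    (hvan : ∀ s ∈ S, A.Vanish s (T + D))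
    (hsmall : (C.Z * C.P ^ (2 ^ (C.G + C.f - I) * n)) ^ 2 < (C.p : ℝ) ^ h) : A.Vanish n T := by
  intro τ hτ
  refine C.eq_zero_of_small h hv _ ?_ ?_
  · have h1 := extrapolate hpos hv hS hcard hvan hτ n
    rw [map_sum]
    calc _ = A.r ^ n * ((C.p : W) ^ (C.v - h) * ∑ l ∈ A.L, (c l : W) * (binom l τ : W) *
          (1 + (C.p : W)) ^ (n * (A.t * C.B l))) := by
          rw [mul_left_comm]
          congr 1
          rw [Finset.mul_sum]
          refine Finset.sum_congr rfl fun l hl => ?_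
          rw [map_mul, map_mul, map_pow, A.map_mon l hl, map_intCast, map_natCast, mul_pow,
            ← pow_mul, mul_comm (A.t * C.B l) n]
          ring
      _ = 0 := by rw [h1, mul_zero]
  · refine lt_of_le_of_lt (pow_le_pow_left₀ (norm_nonneg _) ?_ 2) hsmall
    rw [map_sum]
    refine (_root_.norm_sum_le _ _).trans (A.norm_sum_le τ _ ?_ (by have := C.one_le_P; positivity))
    intro l hl
    rw [map_pow, norm_pow, pow_mul]
    exact pow_le_pow_left₀ (norm_nonneg _) (C.norm_mon_le fun j => E_le hl hI j) n

end Level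

end DescentData

end Descent

section DescentStep

open Finset

namespace DescentData

variable {O W : Type*} [CommRing O] [CommRing W] {k : ℕ} (C : DescentData O W k)

lemma P_pow_lt (e : ℕ) : C.P ^ 2 ^ (C.f + 5 + e) < (C.p : ℝ) ^ 2 ^ e := by
  rw [pow_add, pow_mul]
  have := C.one_le_P
  exact pow_lt_pow_left₀ C.small (by positivity) (by positivity)

lemma Z_mul_le {e n : ℕ} (he : 2 ≤ e) (hn : n ≤ 2 ^ (C.G + C.f + e)) :
    C.Z * C.P ^ n ≤ C.P ^ 2 ^ (C.G + C.f + e + 1) := by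
  have h1 := C.one_le_P
  calc C.Z * C.P ^ n ≤ C.P ^ 2 ^ (C.G + C.f + e) * C.P ^ 2 ^ (C.G + C.f + e) :=
        mul_le_mul (C.Z_le.trans (pow_le_pow_right₀ h1
          (Nat.pow_le_pow_right (by norm_num) (by omega))))
          (pow_le_pow_right₀ h1 hn) (by positivity) (by positivity)
    _ = _ := by rw [← pow_add, pow_succ 2 (C.G + C.f + e)]; ring

lemma isUnit_one_add_p : IsUnit (1 + (C.p : W)) := by
  have := isUnit_natCast_of_coprime_of_pow_eq_zero (W := W) (u := 1 + C.p) C.pow_v (by simp)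
  simpa using this

lemma mon_eq (E : Option (Option (Fin k)) → ℕ) :
    C.mon E = (∏ j with Odd (E j), C.ξ j) * C.mon (fun j => E j / 2) ^ 2 := by
  rw [mon, mon, Finset.prod_filter, ← Finset.prod_pow, ← Finset.prod_mul_distrib]
  refine Finset.prod_congr rfl fun j _ => ?_
  split_ifs with h
  · conv_lhs => rw [← Nat.two_mul_div_two_add_one_of_odd h]
    ring
  · conv_lhs => rw [← Nat.two_mul_div_two_of_even (Nat.not_odd_iff_even.1 h)]
    ring

lemma ξ_ne_zero (j : Option (Option (Fin k))) : C.ξ j ≠ 0 := by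
  intro h
  rcases j with _ | j
  · have := C.norm_none
    rw [h] at this
    simp at this
  · have := C.one_le_norm j
    rw [h, map_zero, norm_zero] at this
    norm_num at this

namespace Level

variable {C} {I : ℕ} {c : (Option (Fin k) → ℕ) → ℤ} (A : C.Level I c)

lemma Z_nonneg (A : C.Level I c) : 0 ≤ C.Z :=
  le_trans (Finset.sum_nonneg fun _ _ => by positivity) (A.size 0)

variable {A}

lemma vanish_step (hI : I ≤ C.G) {j T : ℕ} (hj : j ≤ k + 2) {S : Finset ℕ}
    (hcard : 2 ^ (I + j) ≤ S.card) (hS : ∀ s ∈ S, s < 2 ^ (I + j + 1))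
    (hvan : ∀ s ∈ S, A.Vanish s (T + 2 ^ (C.G - I))) {n : ℕ} (hn : n < 2 ^ (I + j + 2)) :
    A.Vanish n T := by
  have hG := C.one_le_G
  refine vanish_of_extrapolate (h := 2 ^ (C.G + j - 1)) (D := 2 ^ (C.G - I)) (by omega)
    (by positivity) ?_ (fun s hs => ?_) ?_ hvan ?_
  · exact (Nat.pow_le_pow_right (by norm_num) (by omega)).trans C.le_v
  · exact (hS s hs).trans_le
      ((Nat.pow_le_pow_right (by norm_num) (by omega)).trans C.le_p)
  · calc 2 * 2 ^ (C.G + j - 1) = 2 ^ (C.G - I) * 2 ^ (I + j) := by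
          rw [← pow_succ', ← pow_add]; congr 1; omega
      _ ≤ _ := Nat.mul_le_mul_left _ hcard
  · have h1 : 2 ^ (C.G + C.f - I) * n ≤ 2 ^ (C.G + C.f + (j + 2)) := by
      calc _ ≤ 2 ^ (C.G + C.f - I) * 2 ^ (I + j + 2) := Nat.mul_le_mul_left _ hn.le
        _ = _ := by rw [← pow_add]; congr 1; omega
    have h2 := C.one_le_P
    have h3 := A.Z_nonneg
    calc _ ≤ (C.P ^ 2 ^ (C.G + C.f + (j + 2) + 1)) ^ 2 :=
          pow_le_pow_left₀ (by positivity) (C.Z_mul_le (by omega) h1) 2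
      _ = C.P ^ 2 ^ (C.f + 5 + (C.G + j - 1)) := by
          rw [← pow_mul, ← pow_succ]; congr 2; omega
      _ < _ := C.P_pow_lt _

lemma vanish_chain (hI : I ≤ C.G) {S : Finset ℕ}
    (hcard : 2 ^ I ≤ S.card) (hS : ∀ s ∈ S, s < 2 ^ (I + 1)) (j : ℕ) :
    ∀ T, (∀ s ∈ S, A.Vanish s (T + (j + 1) * 2 ^ (C.G - I))) → j ≤ k + 2 →
      ∀ n < 2 ^ (I + j + 2), A.Vanish n T := by
  induction j with
  | zero =>
    intro T hvan _ n hn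
    exact vanish_step hI (j := 0) (by omega) hcard hS (by simpa using hvan) hn
  | succ j ih =>
    intro T hvan hj n hn
    have h1 := ih (T + 2 ^ (C.G - I)) (fun s hs => (hvan s hs).mono (by
      rw [add_one_mul (j + 1)]; omega)) (by omega)
    refine vanish_step hI (j := j + 1) hj (S := Finset.range (2 ^ (I + (j + 1)))) (by simp)
      (fun s hs => ?_) (fun s hs => h1 s ?_) hn
    · exact (Finset.mem_range.1 hs).trans_le (Nat.pow_le_pow_right (by norm_num) (by omega))
    · exact (Finset.mem_range.1 hs).trans_le (Nat.pow_le_pow_right (by norm_num) (by omega))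

lemma false_of_vanish [IsDomain O] (A : C.Level C.G c)
    (h : ∀ n < 2 ^ (C.G + 2), A.Vanish n 1) : False := by
  have hinj : ∀ l ∈ A.L, ∀ l' ∈ A.L, C.mon (A.E l) = C.mon (A.E l') → l = l' := by
    intro l hl l' hl' hll
    refine A.inj l hl l' hl' fun j => ?_
    have h1 := congrArg (fun x => ‖C.ι x‖) hll
    simp only [norm_mon] at h1
    have h2 := congrFun (C.indep _ _ h1) j
    rwa [A.E_some l hl, A.E_some l' hl'] at h2
  have hcard : A.L.card ≤ 2 ^ (C.G + 2) := by
    have h1 : A.L.card ≤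
        (Fintype.piFinset fun _ : Option (Fin k) => Finset.range (2 ^ C.f)).card := by
      refine Finset.card_le_card_of_injOn (fun l j => l j / 2 ^ C.G) ?_ ?_
      · intro l hl
        rw [Finset.mem_coe, Fintype.mem_piFinset]
        intro j
        rw [Finset.mem_range]
        refine Nat.div_lt_of_lt_mul ?_
        rw [← pow_add]
        exact A.lt l hl j
      · intro l hl l' hl' hll
        exact A.inj l hl l' hl' fun j => congrFun hll j
    rw [Fintype.card_piFinset] at h1
    simp only [Finset.card_range, Finset.prod_const, Finset.card_univ, Fintype.card_option,
      Fintype.card_fin] at h1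
    rw [← pow_mul] at h1
    exact h1.trans (Nat.pow_le_pow_right (by norm_num) C.hfk)
  obtain ⟨l₀, hl₀⟩ := A.nonempty
  let e := A.L.equivFin
  have h2 : (fun i => (c (e.symm i).1 : O)) = 0 := by
    refine Matrix.eq_zero_of_forall_pow_sum_mul_pow_eq_zero
      (f := fun i => C.mon (A.E (e.symm i).1)) ?_ ?_
    · intro i i' hii
      exact e.symm.injective (Subtype.ext (hinj _ (e.symm i).2 _ (e.symm i').2 hii))
    · intro i
      have h3 := h i (i.2.trans_le hcard) 0 (by simp)
      rw [← h3, ← Finset.sum_coe_sort A.L, ← e.symm.sum_comp]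
      refine Finset.sum_congr rfl fun x _ => ?_
      simp [binom]
  have h4 := congrFun h2 (e ⟨l₀, hl₀⟩)
  simp only [Equiv.symm_apply_apply, Pi.zero_apply] at h4
  have h5 := congrArg C.ι h4
  rw [map_intCast, map_zero, Int.cast_eq_zero] at h5
  exact A.c_ne_zero l₀ hl₀ h5

lemma exists_level_succ [IsDomain O] (A : C.Level I c) (hI : I < C.G) {T : ℕ}
    (h : ∀ n < 2 ^ (I + k + 3), A.Vanish n (T + 2 ^ (C.G - I))) :
    ∃ A' : C.Level (I + 1) c, ∀ s < 2 ^ (I + 2), Odd s → A'.Vanish s T := by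
  classical
  obtain ⟨l₀, hl₀⟩ := A.nonempty
  set g : W := 1 + (C.p : W) with hg
  have hgu : IsUnit g := C.isUnit_one_add_p
  let κ : (Option (Fin k) → ℕ) → Finset (Option (Option (Fin k))) :=
    fun l => Finset.univ.filter fun j => Odd (A.E l j)
  let bb : (Option (Fin k) → ℕ) → O := fun l => C.mon fun j => A.E l j / 2
  let ω : (Option (Fin k) → ℕ) → W := fun l => ∏ j ∈ κ l, C.w j
  have hmon : ∀ l, C.mon (A.E l) = (∏ j ∈ κ l, C.ξ j) * bb l ^ 2 := fun l => C.mon_eq _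
  have hsq : ∀ l ∈ A.L, (ω l * C.φ (bb l)) ^ 2 = A.r * g ^ (A.t * C.B l) := by
    intro l hl
    rw [← A.map_mon l hl, hmon, map_mul, map_prod, map_pow, mul_pow, ← Finset.prod_pow]
    congr 1
    exact Finset.prod_congr rfl fun j _ => C.w_sq j
  have hunit : ∀ l ∈ A.L, IsUnit (ω l * C.φ (bb l)) := by
    intro l hl
    have : IsUnit ((ω l * C.φ (bb l)) ^ 2) := by
      rw [hsq l hl]; exact A.isUnit.mul (hgu.pow _)
    exact (isUnit_pow_iff _root_.two_ne_zero).1 this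
  have hghf : ∀ n : ℕ, (g ^ (C.hf * n)) ^ 2 = g ^ n := by
    intro n
    rw [← pow_mul, show C.hf * n * 2 = 2 * C.hf * n by ring, pow_mul, C.pow_hf]
  obtain ⟨ρ, hρ⟩ : ∃ ρ, ρ * g ^ (C.hf * (A.t * C.B l₀)) = ω l₀ * C.φ (bb l₀) := by
    obtain ⟨x, hx⟩ := (hgu.pow (C.hf * (A.t * C.B l₀))).exists_left_inv
    exact ⟨ω l₀ * C.φ (bb l₀) * x, by rw [mul_assoc, hx, mul_one]⟩
  have hρu : IsUnit ρ := by
    have := hunit l₀ hl₀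
    rw [← hρ] at this
    exact isUnit_of_mul_isUnit_left this
  have hρ2 : ρ ^ 2 = A.r := by
    have h1 := hsq l₀ hl₀
    rw [← hρ, mul_pow, hghf] at h1
    exact (hgu.pow _).mul_right_cancel h1
  let E' : ℕ → (Option (Fin k) → ℕ) → Option (Option (Fin k)) → ℕ := fun δ l j =>
    (if j = none then C.N₀ * δ else 0) + A.E l j / 2
  have hE' : ∀ δ l, C.mon (E' δ l) = (-1) ^ δ * bb l := by
    intro δ l
    simp only [E', bb, mon, pow_add, Finset.prod_mul_distrib]
    congr 1
    rw [Finset.prod_eq_single none (fun j _ hj => by simp [hj]) (by simp)]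
    simp [pow_mul, C.pow_N₀]
  have hδ : ∀ l, ∃ δ : ℕ, l ∈ A.L →
      C.φ (C.mon (E' δ l)) * ω l = ρ * g ^ (C.hf * (A.t * C.B l)) := by
    intro l
    by_cases hl : l ∈ A.L
    · have h1 : (ρ * g ^ (C.hf * (A.t * C.B l))) ^ 2 = (ω l * C.φ (bb l)) ^ 2 := by
        rw [hsq l hl, mul_pow, hghf, hρ2]
      rcases C.sq_eq _ _ (hunit l hl) h1 with h2 | h2
      · exact ⟨0, fun _ => by rw [hE', h2]; simp [mul_comm]⟩
      · exact ⟨1, fun _ => by rw [hE', h2]; simp [mul_comm]⟩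
    · exact ⟨0, fun h => absurd h hl⟩
  choose δ hδ using hδ
  have hω0 : IsUnit (ω l₀) := isUnit_of_mul_isUnit_left (hunit l₀ hl₀)
  obtain ⟨r', hr'⟩ : ∃ r', r' * ω l₀ = ρ := by
    obtain ⟨x, hx⟩ := hω0.exists_left_inv
    exact ⟨ρ * x, by rw [mul_assoc, hx, mul_one]⟩
  let A' : C.Level (I + 1) c :=
    { L := A.L.filter fun l => κ l = κ l₀
      E := fun l => E' (δ l) l
      r := r'
      t := C.hf * A.t
      nonempty := ⟨l₀, by simp [hl₀]⟩
      c_ne_zero := fun l hl => A.c_ne_zero l (Finset.mem_filter.1 hl).1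
      lt := fun l hl => A.lt l (Finset.mem_filter.1 hl).1
      E_some := fun l hl j => by
        simp only [E']
        rw [A.E_some l (Finset.mem_filter.1 hl).1, Nat.div_div_eq_div_mul, ← pow_succ]
        simp
      isUnit := isUnit_of_mul_isUnit_left (hr' ▸ hρu)
      map_mon := fun l hl => by
        obtain ⟨hl, hκ⟩ := Finset.mem_filter.1 hl
        have h1 := hδ l hl
        have h2 : ω l = ω l₀ := by simp only [ω, hκ]
        rw [h2, ← hr'] at h1
        refine hω0.mul_right_cancel ?_
        rw [h1, mul_assoc C.hf]; ring
      inj := fun l hl l' hl' hll => by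
        obtain ⟨hl, hκ⟩ := Finset.mem_filter.1 hl
        obtain ⟨hl', hκ'⟩ := Finset.mem_filter.1 hl'
        refine A.inj l hl l' hl' fun j => ?_
        have h1 := hll j
        rw [pow_succ, ← Nat.div_div_eq_div_mul, ← Nat.div_div_eq_div_mul] at h1
        have h2 : (some j) ∈ κ l ↔ (some j) ∈ κ l' := by rw [hκ, hκ']
        simp only [κ, Finset.mem_filter, Finset.mem_univ, true_and] at h2
        rw [A.E_some l hl, A.E_some l' hl', Nat.odd_iff, Nat.odd_iff] at h2
        omega
      size := fun τ => le_trans (Finset.sum_le_sum_of_subset_of_nonneg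
        (Finset.filter_subset _ _) fun _ _ _ => by positivity) (A.size τ) }
  refine ⟨A', fun s hs hodd τ hτ => ?_⟩
  have hs' : s < 2 ^ (I + k + 3) := hs.trans_le (Nat.pow_le_pow_right (by norm_num) (by omega))
  set hh := 2 ^ (C.G + k + 1) with hhh
  have hEx := extrapolate (A := A) (h := hh) (D := 2 ^ (C.G - I)) (T := T)
    (S := Finset.range (2 ^ (I + k + 3))) (by positivity) C.le_v
    (fun s hs => (Finset.mem_range.1 hs).trans_le
      ((Nat.pow_le_pow_right (by norm_num) (by omega)).trans C.le_p))
    (by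
      rw [Finset.card_range, ← pow_add, hhh, ← pow_succ']
      exact Nat.pow_le_pow_right (by norm_num) (by omega))
    (fun s hs => h s (Finset.mem_range.1 hs)) hτ (s * C.hf)
  let Θ : Finset (Option (Option (Fin k))) → O := fun U =>
    ∑ l ∈ A.L with κ l = U, (c l : O) * (binom l τ : O) * C.mon (E' (δ l) l) ^ s
  have hP := C.one_le_P
  have hZ := A.Z_nonneg
  have hnorm : ∀ l ∈ A.L, (∏ j ∈ κ l, Real.sqrt ‖C.ι (C.ξ j)‖ ^ s) *
      ‖C.ι (C.mon (E' (δ l) l))‖ ^ s ≤ C.P ^ 2 ^ (C.G + C.f + 2) := by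
    intro l hl
    rw [Finset.prod_pow, ← mul_pow]
    set x := (∏ j ∈ κ l, Real.sqrt ‖C.ι (C.ξ j)‖) * ‖C.ι (C.mon (E' (δ l) l))‖ with hx
    have hx0 : 0 ≤ x := by positivity
    have hx2 : x ^ 2 = ‖C.ι (C.mon (A.E l))‖ := by
      rw [hx, hmon, hE', map_mul, map_mul, map_prod, map_pow, map_pow, map_neg, map_one, norm_mul,
        norm_mul, norm_pow, norm_pow, norm_neg, norm_one, one_pow, one_mul, norm_prod, mul_pow,
        ← Finset.prod_pow]
      congr 1
      exact Finset.prod_congr rfl fun j _ => Real.sq_sqrt (norm_nonneg _)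
    have h1 : x ≤ C.P ^ 2 ^ (C.G + C.f - I) := by
      have h2 : x ^ 2 ≤ C.P ^ 2 ^ (C.G + C.f - I) := by
        rw [hx2]
        exact C.norm_mon_le fun j => E_le hl (by omega) j
      have h3 : (1 : ℝ) ≤ C.P ^ 2 ^ (C.G + C.f - I) := one_le_pow₀ hP
      nlinarith
    calc x ^ s ≤ (C.P ^ 2 ^ (C.G + C.f - I)) ^ s := pow_le_pow_left₀ hx0 h1 s
      _ = C.P ^ (2 ^ (C.G + C.f - I) * s) := by rw [pow_mul]
      _ ≤ C.P ^ 2 ^ (C.G + C.f + 2) := by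
        refine pow_le_pow_right₀ hP ?_
        calc _ ≤ 2 ^ (C.G + C.f - I) * 2 ^ (I + 2) := Nat.mul_le_mul_left _ hs.le
          _ = _ := by rw [← pow_add]; congr 1; omega
  have hsum : ∑ U ∈ (Finset.univ : Finset (Option (Option (Fin k)))).powerset,
      (∏ j ∈ U, Real.sqrt ‖C.ι (C.ξ j)‖ ^ s) * ‖C.ι (Θ U)‖ ≤
        C.Z * C.P ^ 2 ^ (C.G + C.f + 2) := by
    calc _ ≤ ∑ U ∈ (Finset.univ : Finset (Option (Option (Fin k)))).powerset,
          ∑ l ∈ A.L with κ l = U, |(c l : ℝ)| * (binom l τ : ℝ) * C.P ^ 2 ^ (C.G + C.f + 2) := by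
          refine Finset.sum_le_sum fun U _ => ?_
          rw [map_sum]
          refine (mul_le_mul_of_nonneg_left (_root_.norm_sum_le _ _) (by positivity)).trans ?_
          rw [Finset.mul_sum]
          refine Finset.sum_le_sum fun l hl => ?_
          obtain ⟨hl', rfl⟩ := Finset.mem_filter.1 hl
          rw [map_mul, map_mul, map_intCast, map_natCast, norm_mul, norm_mul,
            Complex.norm_intCast, Complex.norm_natCast, map_pow, norm_pow, mul_left_comm]
          exact mul_le_mul_of_nonneg_left (hnorm l hl') (by positivity)
      _ = ∑ l ∈ A.L, |(c l : ℝ)| * (binom l τ : ℝ) * C.P ^ 2 ^ (C.G + C.f + 2) := by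
          rw [Finset.powerset_univ, Finset.sum_fiberwise]
      _ ≤ _ := by
          rw [← Finset.sum_mul]
          exact mul_le_mul_of_nonneg_right (A.size τ) (by positivity)
  have hfin := eq_zero_of_sum_sqrt_eq_zero (fun j => C.w j ^ s)
    (fun j => Real.sqrt ‖C.ι (C.ξ j)‖ ^ s) (fun j => by positivity) ((C.p : W) ^ (C.v - hh))
    Finset.univ C.two_ne_zero (fun x => ‖C.ι x‖) (fun x => norm_nonneg _) (by simp)
    (fun x y => by rw [map_add]; exact norm_add_le _ _) (fun x => by simp)
    (fun x y => by rw [map_mul, norm_mul]) C.φ (fun j => C.ξ j ^ s)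
    (fun j _ => by rw [map_pow, ← C.w_sq j, ← pow_mul, ← pow_mul, mul_comm])
    (fun j _ => by
      rw [map_pow, norm_pow, ← pow_mul, mul_comm s, pow_mul, Real.sq_sqrt (norm_nonneg _)])
    (fun U _ hU y z hyz => by
      obtain ⟨m, rfl⟩ := hodd
      have h1 := C.kummer U hU y ((∏ j ∈ U, C.ξ j) ^ m * z) (by
        rw [hyz, Finset.prod_pow]; ring)
      rcases mul_eq_zero.1 h1 with h2 | h2
      · exact absurd h2 (pow_ne_zero _ (Finset.prod_ne_zero_iff.2 fun j _ => C.ξ_ne_zero j))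
      · exact h2)
    ((C.p : ℝ) ^ 2 ^ (C.G + k))
    (fun y hy hlt => by
      refine C.eq_zero_of_small hh C.le_v y hy ?_
      rw [hhh, show C.G + k + 1 = (C.G + k) + 1 from rfl, pow_succ 2 (C.G + k), pow_mul]
      exact pow_lt_pow_left₀ hlt (norm_nonneg _) _root_.two_ne_zero)
    Θ
    (by
      calc _ = ρ ^ s * ((C.p : W) ^ (C.v - hh) * ∑ l ∈ A.L, (c l : W) * (binom l τ : W) *
          (1 + (C.p : W)) ^ (s * C.hf * (A.t * C.B l))) := by
            rw [mul_left_comm]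
            congr 1
            rw [Finset.mul_sum, Finset.powerset_univ, ← Finset.sum_fiberwise A.L κ]
            refine Finset.sum_congr rfl fun U _ => ?_
            rw [map_sum, Finset.mul_sum]
            refine Finset.sum_congr rfl fun l hl => ?_
            obtain ⟨hl', rfl⟩ := Finset.mem_filter.1 hl
            have h1 := congrArg (· ^ s) (hδ l hl')
            simp only [mul_pow, ← pow_mul] at h1
            rw [map_mul, map_mul, map_intCast, map_natCast, map_pow, Finset.prod_pow]
            rw [show s * C.hf * (A.t * C.B l) = C.hf * (A.t * C.B l) * s by ring]
            linear_combination (c l : W) * (binom l τ : W) * h1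
        _ = 0 := by rw [hEx, mul_zero])
    (by
      have h0 : 0 ≤ ∑ U ∈ (Finset.univ : Finset (Option (Option (Fin k)))).powerset,
          (∏ j ∈ U, Real.sqrt ‖C.ι (C.ξ j)‖ ^ s) * ‖C.ι (Θ U)‖ :=
        Finset.sum_nonneg fun U _ => by positivity
      calc _ ≤ (C.P ^ 2 ^ (C.G + C.f + 2 + 1)) ^ 2 ^ (k + 2) := by
            simp only [Finset.card_univ, Fintype.card_option, Fintype.card_fin]
            exact pow_le_pow_left₀ h0 (hsum.trans (C.Z_mul_le le_rfl le_rfl)) _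
        _ = C.P ^ 2 ^ (C.f + 5 + (C.G + k)) := by
            rw [← pow_mul, ← pow_add]; congr 2; omega
        _ < _ := C.P_pow_lt _)
    (κ l₀) (by simp)
  rw [← hfin]

end Level

/-- The descent: no nonzero auxiliary function exists. -/
theorem false_of_level_zero [IsDomain O] {c : (Option (Fin k) → ℕ) → ℤ} (A : C.Level 0 c)
    (h : A.Vanish 0 (2 * (k + 3) * 2 ^ C.G)) : False := by
  have key : ∀ I ≤ C.G, ∃ A : C.Level I c, ∃ S : Finset ℕ, 2 ^ I ≤ S.card ∧
      (∀ s ∈ S, s < 2 ^ (I + 1)) ∧ ∀ s ∈ S, A.Vanish s (2 * (k + 3) * 2 ^ (C.G - I)) := by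
    intro I
    induction I with
    | zero =>
      intro _
      exact ⟨A, {0}, by simp, by simp, by simpa using h⟩
    | succ I ih =>
      intro hI
      obtain ⟨A, S, hcard, hS, hvan⟩ := ih (by omega)
      have e : 2 ^ (C.G - I) = 2 * 2 ^ (C.G - (I + 1)) := by
        rw [← pow_succ']; congr 1; omega
      obtain ⟨A', hA'⟩ := A.exists_level_succ (by omega)
        (T := 2 * (k + 3) * 2 ^ (C.G - (I + 1)))
        (Level.vanish_chain (by omega) hcard hS (k + 1) _
          (fun s hs => (hvan s hs).mono (by rw [e]; apply le_of_eq; ring)) (by omega))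
      refine ⟨A', (Finset.range (2 ^ (I + 1))).image fun i => 2 * i + 1, ?_, ?_, ?_⟩
      · rw [Finset.card_image_of_injective _ fun a b h => by simpa using h, Finset.card_range]
      · intro s hs
        obtain ⟨i, hi, rfl⟩ := Finset.mem_image.1 hs
        have := Finset.mem_range.1 hi
        rw [pow_succ 2 (I + 1)]
        omega
      · intro s hs
        obtain ⟨i, hi, rfl⟩ := Finset.mem_image.1 hs
        have := Finset.mem_range.1 hi
        refine hA' _ ?_ ⟨i, rfl⟩
        rw [show I + 2 = (I + 1) + 1 from rfl, pow_succ 2 (I + 1)]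
        omega
  obtain ⟨A, S, hcard, hS, hvan⟩ := key C.G le_rfl
  refine A.false_of_vanish ?_
  refine Level.vanish_chain le_rfl hcard hS 0 1 (fun s hs => (hvan s hs).mono ?_)
    (by omega)
  simp only [tsub_self]
  omega

end DescentData

end DescentStep

section DescentBound

open Finset

section Siegel

attribute [local instance] Matrix.seminormedAddCommGroup

lemma exists_small_solution {α β : Type*} (U : Finset α) (hU : U.Nonempty) (V : Finset β)
    (a : α → β → ℕ) {Q : ℕ} (hQ : 1 ≤ Q) (ha : ∀ u ∈ U, ∀ b ∈ V, a u b ≤ Q)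
    (hUV : 2 * U.card ≤ V.card) :
    ∃ c : β → ℤ, (∃ b ∈ V, c b ≠ 0) ∧ (∀ b ∈ V, |(c b : ℝ)| ≤ V.card * Q) ∧
      ∀ u ∈ U, ∑ b ∈ V, c b * (a u b : ℤ) = 0 := by
  classical
  have hU0 := hU.card_pos
  let A : Matrix U V ℤ := fun u b => (a u b : ℤ)
  obtain ⟨t, ht0, hAt, hnorm⟩ := Int.Matrix.exists_ne_zero_int_vec_norm_le A
    (by simp only [Fintype.card_coe]; omega) (by simpa using hU0)
  have hA : ‖A‖ ≤ Q := by
    rw [Matrix.norm_le_iff (by positivity)]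
    intro u b
    simp only [A, Int.norm_eq_abs, Int.cast_natCast, Nat.abs_cast, Nat.cast_le]
    exact ha u u.2 b b.2
  have hbase : (V.card : ℝ) * max 1 ‖A‖ ≤ V.card * Q :=
    mul_le_mul_of_nonneg_left (max_le (by exact_mod_cast hQ) hA) (by positivity)
  have hV1 : (1 : ℝ) ≤ V.card := by exact_mod_cast (by omega : 1 ≤ V.card)
  have h1 : (1 : ℝ) ≤ V.card * max 1 ‖A‖ := by
    have := le_max_left 1 ‖A‖
    nlinarith
  have hexp : (U.card : ℝ) / (V.card - U.card) ≤ 1 := by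
    have h2 : (2 : ℝ) * U.card ≤ V.card := by exact_mod_cast hUV
    have h3 : (0 : ℝ) < U.card := by exact_mod_cast hU0
    rw [div_le_one (by linarith)]
    linarith
  simp only [Fintype.card_coe] at hnorm
  have hbound : ‖t‖ ≤ V.card * Q := by
    refine hnorm.trans ((Real.rpow_le_rpow_of_exponent_le h1 hexp).trans ?_)
    rw [Real.rpow_one]
    exact hbase
  refine ⟨fun b => if h : b ∈ V then t ⟨b, h⟩ else 0, ?_, ?_, ?_⟩
  · obtain ⟨b, hb⟩ := Function.ne_iff.1 ht0
    exact ⟨b, b.2, by simpa using hb⟩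
  · intro b hb
    have := (norm_le_pi_norm t ⟨b, hb⟩).trans hbound
    rw [Int.norm_eq_abs] at this
    simpa [hb] using this
  · intro u hu
    have := congrFun hAt ⟨u, hu⟩
    simp only [Matrix.mulVec, dotProduct, Pi.zero_apply, A] at this
    rw [← this, ← Finset.sum_coe_sort V]
    exact Finset.sum_congr rfl fun b _ => by simp [mul_comm]

end Siegel

/-- A bound for the number of `τ : Fin k → ℕ` with small sum. -/
lemma card_sum_lt_le (k G : ℕ) :
    ((Fintype.piFinset fun _ : Fin k => range (2 * (k + 3) * 2 ^ G)).filter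
      fun τ => ∑ i, τ i < 2 * (k + 3) * 2 ^ G).card ≤ 64 * 8 ^ k * 2 ^ (G * k) := by
  set T := 2 * (k + 3) * 2 ^ G with hT
  set F := ((Fintype.piFinset fun _ : Fin k => range T).filter fun τ => ∑ i, τ i < T) with hF
  set N : ℝ := 2 ^ (G + 1) with hN
  have hN2 : 2 ≤ N := by
    rw [hN, pow_succ]
    have : (1 : ℝ) ≤ 2 ^ G := one_le_pow₀ (by norm_num)
    linarith
  set x : ℝ := 1 - 1 / N with hx
  have hx0 : 1 / 2 ≤ x := by
    have : 1 / N ≤ 1 / 2 := one_div_le_one_div_of_le (by norm_num) hN2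
    rw [hx]; linarith
  have hx1 : x ≤ 1 := by
    have : 0 ≤ 1 / N := by positivity
    rw [hx]; linarith
  have hhalf : (1 : ℝ) / 2 ≤ x ^ 2 ^ G := by
    have h1 := one_add_mul_le_pow (a := -(1 / N)) (by
      have : 1 / N ≤ 1 / 2 := one_div_le_one_div_of_le (by norm_num) hN2
      linarith) (2 ^ G)
    have h2 : ((2 ^ G : ℕ) : ℝ) * -(1 / N) = -(1 / 2) := by
      rw [hN, pow_succ]; push_cast; field_simp
    rw [h2] at h1
    have h3 : 1 + -(1 / N) = x := by rw [hx]; ring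
    rw [h3] at h1
    linarith
  have hxT : (1 / 2 : ℝ) ^ (2 * (k + 3)) ≤ x ^ T := by
    rw [hT, mul_comm (2 * (k + 3)), pow_mul x]
    exact pow_le_pow_left₀ (by norm_num) hhalf _
  have hgeom : ∑ t ∈ range T, x ^ t ≤ N := by
    have h1 := geom_sum_mul_neg x T
    have h2 : 1 - x = 1 / N := by rw [hx]; ring
    rw [h2] at h1
    have h3 : 0 ≤ x ^ T := by positivity
    have h4 : (∑ t ∈ range T, x ^ t) = N * (1 - x ^ T) := by
      rw [← h1]; field_simp
    rw [h4]
    nlinarith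
  have hmain : (F.card : ℝ) * x ^ T ≤ N ^ k := by
    calc (F.card : ℝ) * x ^ T = ∑ _τ ∈ F, x ^ T := by simp
      _ ≤ ∑ τ ∈ F, ∏ i, x ^ τ i := by
        refine Finset.sum_le_sum fun τ hτ => ?_
        rw [Finset.prod_pow_eq_pow_sum]
        exact pow_le_pow_of_le_one (by linarith) hx1 (Finset.mem_filter.1 hτ).2.le
      _ ≤ ∑ τ ∈ Fintype.piFinset fun _ : Fin k => range T, ∏ i, x ^ τ i :=
        Finset.sum_le_sum_of_subset_of_nonneg (Finset.filter_subset _ _)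
          fun _ _ _ => Finset.prod_nonneg fun _ _ => by positivity
      _ = ∏ _i : Fin k, ∑ t ∈ range T, x ^ t := by
        rw [Finset.prod_univ_sum]
      _ ≤ N ^ k := by
        rw [Finset.prod_const, Finset.card_univ, Fintype.card_fin]
        exact pow_le_pow_left₀ (Finset.sum_nonneg fun _ _ => by positivity) hgeom _
  have h5 : (F.card : ℝ) ≤ 64 * 8 ^ k * 2 ^ (G * k) := by
    have h6 : (F.card : ℝ) * (1 / 2 : ℝ) ^ (2 * (k + 3)) ≤ N ^ k :=
      (mul_le_mul_of_nonneg_left hxT (by positivity)).trans hmain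
    have h7 : (2 : ℝ) ^ (2 * (k + 3)) * (1 / 2 : ℝ) ^ (2 * (k + 3)) = 1 := by
      rw [← mul_pow]; norm_num
    calc (F.card : ℝ) = 2 ^ (2 * (k + 3)) * (F.card * (1 / 2 : ℝ) ^ (2 * (k + 3))) := by
          linear_combination (-(F.card : ℝ)) * h7
      _ ≤ 2 ^ (2 * (k + 3)) * N ^ k := mul_le_mul_of_nonneg_left h6 (by positivity)
      _ = _ := by
        rw [hN, ← pow_mul, show 2 * (k + 3) = 2 * k + 6 by ring, pow_add, pow_mul,
          show (G + 1) * k = G * k + k by ring, pow_add,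
          show (8 : ℝ) ^ k = (2 ^ 2) ^ k * 2 ^ k by rw [← mul_pow]; norm_num]
        ring
  exact_mod_cast h5

namespace DescentData

variable {O W : Type*} [CommRing O] [CommRing W] {k : ℕ} (C : DescentData O W k)

/-- The descent data cannot exist when the number of parameters beats the number of conditions. -/
theorem false_of_card [IsDomain O] (θ : W) (hθ : θ ^ (C.p - 1) = 1)
    (e : Option (Fin k) → ℕ) (hnone : C.φ (C.ξ (some none)) = θ ^ e none)
    (hsome : ∀ i, C.φ (C.ξ (some (some i))) = θ ^ e (some i) * (1 + (C.p : W)) ^ C.b i)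
    (hcard : C.p * (2 * (64 * 8 ^ k * 2 ^ (C.G * k))) ≤ 2 ^ ((C.G + C.f) * (k + 1)))
    (hZ : ((2 : ℝ) ^ ((C.G + C.f) * (k + 1))) ^ 2 * (2 ^ (k * 2 ^ (C.G + C.f))) ^ 2 ≤ C.Z) :
    False := by
  classical
  set V := Fintype.piFinset fun _ : Option (Fin k) => range (2 ^ (C.G + C.f)) with hV
  have hVcard : V.card = 2 ^ ((C.G + C.f) * (k + 1)) := by
    rw [hV, Fintype.card_piFinset]
    simp [pow_mul]
  set T := 2 * (k + 3) * 2 ^ C.G with hT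
  set U := ((Fintype.piFinset fun _ : Fin k => range T).filter fun τ => ∑ i, τ i < T) with hU
  have hp := C.three_le
  have hUcard : U.card ≤ 64 * 8 ^ k * 2 ^ (C.G * k) := card_sum_lt_le k C.G
  have hTpos : 0 < T := by positivity
  have hUne : U.Nonempty := ⟨0, by
    rw [hU, Finset.mem_filter, Fintype.mem_piFinset]
    exact ⟨fun _ => by simpa using hTpos, by simpa using hTpos⟩⟩
  obtain ⟨y, hy, hcl⟩ := Finset.exists_le_card_fiber_of_mul_le_card_of_maps_to
    (s := V) (t := range (C.p - 1)) (f := fun l => (∑ j, e j * l j) % (C.p - 1))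
    (n := 2 * U.card) (fun l _ => Finset.mem_range.2 (Nat.mod_lt _ (by omega)))
    ⟨0, Finset.mem_range.2 (by omega)⟩ (by
      rw [hVcard, Finset.card_range]
      refine le_trans ?_ hcard
      exact Nat.mul_le_mul (Nat.sub_le _ _) (Nat.mul_le_mul_left _ hUcard))
  set K := V.filter fun l => (∑ j, e j * l j) % (C.p - 1) = y with hK
  have hKV : K.card ≤ 2 ^ ((C.G + C.f) * (k + 1)) := hVcard ▸ Finset.card_filter_le _ _
  have hlt : ∀ l ∈ K, ∀ j, l j < 2 ^ (C.G + C.f) := fun l hl j =>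
    Finset.mem_range.1 (Fintype.mem_piFinset.1 (Finset.mem_filter.1 hl).1 j)
  have hbin : ∀ (τ : Fin k → ℕ), ∀ l ∈ K, binom l τ ≤ 2 ^ (k * 2 ^ (C.G + C.f)) := by
    intro τ l hl
    calc binom l τ ≤ ∏ _i : Fin k, 2 ^ 2 ^ (C.G + C.f) :=
          Finset.prod_le_prod' fun i _ => (Nat.choose_le_two_pow _ _).trans
            (Nat.pow_le_pow_right (by norm_num) (hlt l hl _).le)
      _ = _ := by
        rw [Finset.prod_const, Finset.card_univ, Fintype.card_fin, ← pow_mul, mul_comm]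
  obtain ⟨c, ⟨l₁, hl₁, hcl₁⟩, hcb, hc⟩ := exists_small_solution U hUne K (fun τ l => binom l τ)
    (Q := 2 ^ (k * 2 ^ (C.G + C.f))) Nat.one_le_two_pow (fun τ _ l hl => hbin τ l hl) hcl
  have hθy : ∀ l ∈ K, θ ^ (∑ j, e j * l j) = θ ^ y := by
    intro l hl
    rw [← (Finset.mem_filter.1 hl).2]
    conv_lhs => rw [← Nat.mod_add_div (∑ j, e j * l j) (C.p - 1)]
    rw [pow_add, pow_mul θ (C.p - 1), hθ, one_pow, mul_one]
  let A : C.Level 0 c :=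
    { L := K.filter fun l => c l ≠ 0
      E := fun l j => j.elim 0 l
      r := θ ^ y
      t := 1
      nonempty := ⟨l₁, by simp [hl₁, hcl₁]⟩
      c_ne_zero := fun l hl => (Finset.mem_filter.1 hl).2
      lt := fun l hl => hlt l (Finset.mem_filter.1 hl).1
      E_some := fun l _ j => by simp
      isUnit := IsUnit.pow _ (IsUnit.of_pow_eq_one hθ (by omega))
      map_mon := fun l hl => by
        rw [← hθy l (Finset.mem_filter.1 hl).1, mon, map_prod, Fintype.prod_option,
          Fintype.prod_option, Fintype.sum_option]
        simp only [Option.elim, pow_zero, map_one, one_mul, map_pow, hnone, hsome, mul_pow,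
          ← pow_mul, Finset.prod_mul_distrib, Finset.prod_pow_eq_pow_sum, B, pow_add]
        ring
      inj := fun l _ l' _ h => funext fun j => by simpa using h j
      size := fun τ => by
        refine le_trans ?_ hZ
        calc _ ≤ ∑ l ∈ K, |(c l : ℝ)| * (binom l τ : ℝ) :=
              Finset.sum_le_sum_of_subset_of_nonneg (Finset.filter_subset _ _)
                fun _ _ _ => by positivity
          _ ≤ ∑ _l ∈ K, ((2 : ℝ) ^ ((C.G + C.f) * (k + 1)) * 2 ^ (k * 2 ^ (C.G + C.f))) *
                2 ^ (k * 2 ^ (C.G + C.f)) := by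
              refine Finset.sum_le_sum fun l hl => mul_le_mul ((hcb l hl).trans ?_)
                (by exact_mod_cast hbin τ l hl) (by positivity) (by positivity)
              push_cast
              exact mul_le_mul_of_nonneg_right (by exact_mod_cast hKV) (by positivity)
          _ ≤ _ := by
              rw [Finset.sum_const, nsmul_eq_mul]
              have : (K.card : ℝ) ≤ 2 ^ ((C.G + C.f) * (k + 1)) := by exact_mod_cast hKV
              calc _ ≤ (2 : ℝ) ^ ((C.G + C.f) * (k + 1)) * (((2 : ℝ) ^ ((C.G + C.f) * (k + 1)) *
                  2 ^ (k * 2 ^ (C.G + C.f))) * 2 ^ (k * 2 ^ (C.G + C.f))) :=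
                    mul_le_mul_of_nonneg_right this (by positivity)
                _ = _ := by ring }
  refine C.false_of_level_zero A ?_
  intro τ hτ
  have hτU : τ ∈ U := by
    rw [hU, Finset.mem_filter, Fintype.mem_piFinset]
    exact ⟨fun i => Finset.mem_range.2
      ((Finset.single_le_sum (fun _ _ => Nat.zero_le _) (Finset.mem_univ i)).trans_lt hτ), hτ⟩
  have h1 := congrArg (Int.cast : ℤ → O) (hc τ hτU)
  push_cast at h1
  rw [← h1]
  refine Finset.sum_subset_zero_on_sdiff (Finset.filter_subset _ _) ?_ ?_
  · intro l hl
    simp only [A, Finset.mem_sdiff, Finset.mem_filter, not_and, not_not] at hl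
    rw [hl.2 hl.1]; simp
  · intro l _
    simp

end DescentData

end DescentBound

section UnitsModPrimePow

variable {p : ℕ}

namespace ZMod

/-- The units modulo `p ^ (n + 1)` are products of Teichmüller units and powers of `1 + p`. -/
lemma exists_teichmuller_generator (hp : p.Prime) (hp2 : p ≠ 2) (n : ℕ) :
    ∃ θ : ZMod (p ^ (n + 1)), θ ^ (p - 1) = 1 ∧
      (∀ u, IsUnit u → ∃ e b : ℕ, u = θ ^ e * (1 + (p : ZMod (p ^ (n + 1)))) ^ b) ∧
      ∀ u : ZMod (p ^ (n + 1)), u ^ (p - 1) = 1 → ∃ e : ℕ, u = θ ^ e := by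
  have : Fact p.Prime := ⟨hp⟩
  have := isCyclic_units_of_prime_pow p hp hp2 (n + 1)
  obtain ⟨γ, hγ⟩ := IsCyclic.exists_generator (α := (ZMod (p ^ (n + 1)))ˣ)
  have hγ' : ∀ u : (ZMod (p ^ (n + 1)))ˣ, ∃ e : ℕ, γ ^ e = u := fun u => by
    have := hγ u
    rw [mem_zpowers_iff_mem_range_orderOf] at this
    obtain ⟨e, -, he⟩ := Finset.mem_image.1 this
    exact ⟨e, he⟩
  have htot : ∀ u : (ZMod (p ^ (n + 1)))ˣ, u ^ (p ^ n * (p - 1)) = 1 := fun u => by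
    have := pow_totient u
    rwa [Nat.totient_prime_pow_succ hp] at this
  obtain ⟨c, hc⟩ : p - 1 ∣ p ^ n - 1 := by simpa using Nat.sub_dvd_pow_sub_pow p 1 n
  have hpn : p ^ n = 1 + (p - 1) * c := by
    rw [← hc]; have := Nat.one_le_pow n p hp.pos; omega
  have hpow : ∀ u : (ZMod (p ^ (n + 1)))ˣ, u ^ p ^ n = u * (u ^ (p - 1)) ^ c := fun u => by
    rw [← pow_mul, ← pow_succ']
    exact congrArg (u ^ ·) (hpn.trans (Nat.add_comm _ _))
  have hpu : IsUnit (1 + p : ZMod (p ^ (n + 1))) := by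
    rw [← Nat.cast_one (R := ZMod _), ← Nat.cast_add, ZMod.isUnit_iff_coprime]
    exact Nat.Coprime.pow_right _ (by simp)
  obtain ⟨g, hg⟩ := hpu
  have hgo : orderOf g = p ^ n := by
    rw [← orderOf_units, hg, orderOf_one_add_prime hp hp2]
  have hone : ∀ y : (ZMod (p ^ (n + 1)))ˣ, y ^ p ^ n = 1 → ∃ b : ℕ, y = g ^ b := by
    intro y hy
    classical
    have hsub : (Finset.range (p ^ n)).image (fun b => g ^ b) ⊆
        Finset.univ.filter fun y : (ZMod (p ^ (n + 1)))ˣ => y ^ p ^ n = 1 := by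
      intro z hz
      obtain ⟨b, -, rfl⟩ := Finset.mem_image.1 hz
      rw [Finset.mem_filter, ← pow_mul, mul_comm, pow_mul, ← hgo, pow_orderOf_eq_one, one_pow]
      exact ⟨Finset.mem_univ _, rfl⟩
    have hcard : ((Finset.range (p ^ n)).image (fun b => g ^ b)).card = p ^ n := by
      rw [Finset.card_image_of_injOn, Finset.card_range]
      intro a ha b hb hab
      rw [Finset.coe_range, Set.mem_Iio, ← hgo] at ha hb
      exact pow_injOn_Iio_orderOf ha hb hab
    have heq := Finset.eq_of_subset_of_card_le hsub (by
      rw [hcard]; exact IsCyclic.card_pow_eq_one_le (pow_pos hp.pos _))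
    have : y ∈ (Finset.range (p ^ n)).image (fun b => g ^ b) := by
      rw [heq]; simp [hy]
    obtain ⟨b, -, hb⟩ := Finset.mem_image.1 this
    exact ⟨b, hb.symm⟩
  refine ⟨((γ ^ p ^ n : (ZMod (p ^ (n + 1)))ˣ) : ZMod (p ^ (n + 1))), ?_, ?_, ?_⟩
  · rw [← Units.val_pow_eq_pow_val, ← pow_mul, htot, Units.val_one]
  · rintro _ ⟨u, rfl⟩
    obtain ⟨e, rfl⟩ := hγ' u
    obtain ⟨b, hb⟩ := hone (γ ^ e * ((γ ^ e) ^ p ^ n)⁻¹) (by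
      rw [hpow (γ ^ e), mul_inv, mul_inv_cancel_left, inv_pow, ← pow_mul, ← pow_mul,
        show (p - 1) * (c * p ^ n) = p ^ n * (p - 1) * c by ring, pow_mul, htot, one_pow, inv_one])
    refine ⟨e, b, ?_⟩
    rw [← hg, ← Units.val_pow_eq_pow_val, ← Units.val_pow_eq_pow_val, ← hb, ← Units.val_mul]
    congr 1
    rw [← pow_mul, ← pow_mul, mul_comm (p ^ n) e]
    group
  · intro u hu
    obtain ⟨w, rfl⟩ := IsUnit.of_pow_eq_one hu (by have := hp.two_le; omega)
    obtain ⟨e, rfl⟩ := hγ' w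
    refine ⟨e, ?_⟩
    rw [← Units.val_pow_eq_pow_val, Units.val_eq_one] at hu
    rw [← Units.val_pow_eq_pow_val, ← pow_mul, mul_comm, pow_mul, hpow, hu, one_pow, mul_one]

/-- There is a unit modulo `p ^ (n + 1)` that is not a square modulo `p` and whose product with any
nonsquare unit is a square. -/
lemma exists_nonsquare_unit (hp : p.Prime) (hp2 : p ≠ 2) (n : ℕ) :
    ∃ d : ZMod (p ^ (n + 1)), (∀ s t : ZMod (p ^ (n + 1)),
      (p : ZMod (p ^ (n + 1))) ∣ s ^ 2 - d * t ^ 2 →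
        (p : ZMod (p ^ (n + 1))) ∣ t) ∧
      ∀ u, IsUnit u → ∃ s, u = s ^ 2 ∨ u = d * s ^ 2 := by
  have : Fact p.Prime := ⟨hp⟩
  have := isCyclic_units_of_prime_pow p hp hp2 (n + 1)
  obtain ⟨γ, hγ⟩ := IsCyclic.exists_generator (α := (ZMod (p ^ (n + 1)))ˣ)
  have hord : orderOf γ = p ^ n * (p - 1) := by
    rw [orderOf_eq_card_of_forall_mem_zpowers hγ, Nat.card_eq_fintype_card, card_units_eq_totient,
      Nat.totient_prime_pow_succ hp]
  have htot : ∀ u : (ZMod (p ^ (n + 1)))ˣ, u ^ (p ^ n * (p - 1)) = 1 := fun u => by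
    have := pow_totient u
    rwa [Nat.totient_prime_pow_succ hp] at this
  have hpv : (p : ZMod (p ^ (n + 1))) ^ (n + 1) = 0 := by
    rw [← Nat.cast_pow, natCast_self]
  refine ⟨γ, fun s t h => ?_, ?_⟩
  · by_contra ht
    have hunit : ∀ z : ZMod (p ^ (n + 1)), ¬ (p : ZMod (p ^ (n + 1))) ∣ z → IsUnit z := by
      intro z hz
      have : NeZero (p ^ (n + 1)) := ⟨(pow_pos hp.pos _).ne'⟩
      rw [← natCast_zmod_val z, isUnit_iff_coprime]
      refine Nat.Coprime.pow_right _ (Nat.Coprime.symm ((Nat.Prime.coprime_iff_not_dvd hp).2 ?_))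
      intro hd
      apply hz
      rw [← natCast_zmod_val z]
      exact_mod_cast Nat.cast_dvd_cast hd
    obtain ⟨t, rfl⟩ := hunit t ht
    have hnil : ∀ z : ZMod (p ^ (n + 1)), (p : ZMod (p ^ (n + 1))) ∣ z → IsNilpotent z := by
      rintro _ ⟨y, rfl⟩
      exact ⟨n + 1, by rw [mul_pow, hpv, zero_mul]⟩
    have hs : IsUnit s := by
      have : IsUnit (s ^ 2) := by
        have h1 := (hnil _ h).isUnit_add_left_of_commute (u :=
          ((γ * t ^ 2 : (ZMod (p ^ (n + 1)))ˣ) : ZMod (p ^ (n + 1)))) (Units.isUnit _)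
          (Commute.all _ _)
        simpa using h1
      exact (isUnit_pow_iff two_ne_zero).1 this
    obtain ⟨s, rfl⟩ := hs
    -- `γ * (t / s) ^ 2` is congruent to one, so its `p ^ n`-th power is one
    obtain ⟨y, hy⟩ := h
    have hcong : ((s ^ 2 * (γ * t ^ 2)⁻¹ : (ZMod (p ^ (n + 1)))ˣ) : ZMod (p ^ (n + 1))) ^ p ^ n =
        1 := by
      have h1 : ((s ^ 2 * (γ * t ^ 2)⁻¹ : (ZMod (p ^ (n + 1)))ˣ) : ZMod (p ^ (n + 1)))
          = 1 + p * (y * ((γ * t ^ 2)⁻¹ : (ZMod (p ^ (n + 1)))ˣ)) := by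
        have h2 : ((γ * t ^ 2 : (ZMod (p ^ (n + 1)))ˣ) : ZMod (p ^ (n + 1))) *
          ((γ * t ^ 2)⁻¹ : (ZMod (p ^ (n + 1)))ˣ) = 1 := Units.mul_inv _
        rw [Units.val_mul]
        push_cast at h2 hy ⊢
        linear_combination (((γ * t ^ 2)⁻¹ : (ZMod (p ^ (n + 1)))ˣ) : ZMod (p ^ (n + 1))) * hy + h2
      have h3 := dvd_sub_pow_of_dvd_sub (R := ZMod (p ^ (n + 1))) (p := p)
        (a := 1 + p * (y * ((γ * t ^ 2)⁻¹ : (ZMod (p ^ (n + 1)))ˣ))) (b := 1)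
        ⟨_, by rw [add_sub_cancel_left]⟩ n
      rw [hpv, zero_dvd_iff, one_pow, sub_eq_zero] at h3
      rw [h1, h3]
    have hcong' : (s ^ 2 * (γ * t ^ 2)⁻¹) ^ p ^ n = 1 := by
      rwa [← Units.val_pow_eq_pow_val, Units.val_eq_one] at hcong
    have hcong2 : (s ^ 2) ^ p ^ n = (γ * t ^ 2) ^ p ^ n := by
      rwa [mul_pow, inv_pow, mul_inv_eq_one] at hcong'
    obtain ⟨c, hc⟩ : ∃ c, p - 1 = 2 * c := by
      obtain ⟨c, hc⟩ := hp.odd_of_ne_two hp2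
      exact ⟨c, by omega⟩
    have h5 : ∀ u : (ZMod (p ^ (n + 1)))ˣ, ((u ^ 2) ^ p ^ n) ^ c = 1 := fun u => by
      rw [← pow_mul, ← pow_mul, show 2 * (p ^ n * c) = p ^ n * (p - 1) by rw [hc]; ring, htot]
    have h6 : γ ^ (p ^ n * c) = 1 := by
      have h9 := congrArg (· ^ c) hcong2
      simp only [h5, mul_pow] at h9
      rw [pow_mul, h9, mul_one]
    have h7 := orderOf_dvd_of_pow_eq_one h6
    rw [hord, hc] at h7
    have hc0 : 0 < c := by have := hp.two_le; omega
    have := Nat.le_of_dvd (by have := hp.pos; positivity) h7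
    have h8 : p ^ n * (2 * c) = 2 * (p ^ n * c) := by ring
    have : 0 < p ^ n * c := by have := hp.pos; positivity
    omega
  · rintro _ ⟨u, rfl⟩
    have := hγ u
    rw [mem_zpowers_iff_mem_range_orderOf] at this
    obtain ⟨e, -, rfl⟩ := Finset.mem_image.1 this
    rcases Nat.even_or_odd' e with ⟨c, rfl | rfl⟩
    · exact ⟨(γ ^ c : (ZMod (p ^ (n + 1)))ˣ), Or.inl (by push_cast; ring)⟩
    · exact ⟨(γ ^ c : (ZMod (p ^ (n + 1)))ˣ), Or.inr (by push_cast; ring)⟩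

end ZMod

end UnitsModPrimePow

section UnramifiedQuadratic

variable {p : ℕ}

namespace QuadraticAlgebra

/-- The unramified quadratic extension of `ZMod (p ^ (n + 1))`: units of the base are squares, and
square roots of units are unique up to sign. -/
lemma exists_unramified (hp : p.Prime) (hp2 : p ≠ 2) (n : ℕ) :
    ∃ d : ZMod (p ^ (n + 1)),
      (∀ x y : QuadraticAlgebra (ZMod (p ^ (n + 1))) d 0, IsUnit y → x ^ 2 = y ^ 2 →
        x = y ∨ x = -y) ∧
      ∀ u : ZMod (p ^ (n + 1)), IsUnit u →
        ∃ w : QuadraticAlgebra (ZMod (p ^ (n + 1))) d 0, w ^ 2 = algebraMap _ _ u := by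
  have : Fact p.Prime := ⟨hp⟩
  set R := ZMod (p ^ (n + 1))
  obtain ⟨d, hd, hsq⟩ : ∃ d : R, (∀ s t : R, (p : R) ∣ s ^ 2 - d * t ^ 2 → (p : R) ∣ t) ∧
      ∀ u : R, IsUnit u → ∃ s, u = s ^ 2 ∨ u = d * s ^ 2 := ZMod.exists_nonsquare_unit hp hp2 n
  have hp1 : 1 < p ^ (n + 1) := Nat.one_lt_pow n.succ_ne_zero hp.one_lt
  have : Fact (1 < p ^ (n + 1)) := ⟨hp1⟩
  have : NeZero (p ^ (n + 1)) := ⟨by omega⟩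
  have hpv : (p : R) ^ (n + 1) = 0 := by
    rw [← Nat.cast_pow, ZMod.natCast_self]
  have hunit : ∀ z : R, ¬ (p : R) ∣ z → IsUnit z := by
    intro z hz
    rw [← ZMod.natCast_zmod_val z, ZMod.isUnit_iff_coprime]
    refine Nat.Coprime.pow_right _ (Nat.Coprime.symm ((Nat.Prime.coprime_iff_not_dvd hp).2 ?_))
    intro hd
    apply hz
    rw [← ZMod.natCast_zmod_val z]
    exact_mod_cast Nat.cast_dvd_cast hd
  have hdvd : ∀ z : QuadraticAlgebra R d 0, ¬ IsUnit z →
      (p : R) ∣ z.re ∧ (p : R) ∣ z.im := by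
    intro z hz
    rw [isUnit_iff_norm_isUnit] at hz
    have h1 : (p : R) ∣ norm z := by
      by_contra h
      exact hz (hunit _ h)
    rw [norm_def] at h1
    have h2 : (p : R) ∣ z.re ^ 2 - d * z.im ^ 2 := by
      convert h1 using 1; ring
    have h3 := hd _ _ h2
    refine ⟨?_, h3⟩
    by_contra h4
    have h5 : (p : R) ∣ z.re ^ 2 := by
      have := dvd_add h2 (Dvd.dvd.mul_left (dvd_pow h3 two_ne_zero) d)
      simpa using this
    have h6 := ((hunit _ h4).pow 2)
    have h7 := isUnit_of_dvd_unit h5 h6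
    have h8 := h7.pow (n + 1)
    rw [hpv] at h8
    exact not_isUnit_zero h8
  refine ⟨d, fun x y hy hxy => ?_, fun u hu => ?_⟩
  · have h0 : (x - y) * (x + y) = 0 := by linear_combination hxy
    by_cases h1 : IsUnit (x - y)
    · right
      exact eq_neg_of_add_eq_zero_left ((h1.mul_right_eq_zero).1 h0)
    by_cases h2 : IsUnit (x + y)
    · left
      exact sub_eq_zero.1 ((h2.mul_left_eq_zero).1 h0)
    exfalso
    have h3 := hdvd _ h1
    have h4 := hdvd _ h2
    have h2u : IsUnit (2 : R) := by
      have : IsUnit ((2 : ℕ) : R) := by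
        rw [ZMod.isUnit_iff_coprime]
        exact Nat.Coprime.pow_right _ ((Nat.coprime_primes Nat.prime_two hp).2 (Ne.symm hp2))
      exact_mod_cast this
    have h5 : (p : R) ∣ y.re := by
      have := dvd_sub h4.1 h3.1
      simp only [re_add, re_sub] at this
      rw [show x.re + y.re - (x.re - y.re) = 2 * y.re by ring] at this
      exact (h2u.dvd_mul_left).1 this
    have h6 : (p : R) ∣ y.im := by
      have := dvd_sub h4.2 h3.2
      simp only [im_add, im_sub] at this
      rw [show x.im + y.im - (x.im - y.im) = 2 * y.im by ring] at this
      exact (h2u.dvd_mul_left).1 this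
    rw [isUnit_iff_norm_isUnit, norm_def] at hy
    have h7 : (p : R) ∣ y.re * y.re + 0 * y.re * y.im - d * y.im * y.im :=
      dvd_sub (dvd_add (h5.mul_left _) (by simp)) (h6.mul_left _)
    have h8 := (isUnit_of_dvd_unit h7 hy).pow (n + 1)
    rw [hpv] at h8
    exact not_isUnit_zero h8
  · obtain ⟨s, rfl | rfl⟩ := hsq u hu
    · exact ⟨algebraMap _ _ s, by rw [map_pow]⟩
    · refine ⟨⟨0, s⟩, ?_⟩
      ext
      · simp [pow_two]; ring
      · simp [pow_two]

end QuadraticAlgebra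

end UnramifiedQuadratic

section Wieferich

open Finset

/-- If `x` is a `(p - 1)`-th root of unity modulo `p ^ (n + 1)`, then auxiliary primes `q i` that
are multiplicatively independent of `x` in the sense of Kummer theory bound the exponent. -/
theorem false_of_wieferich {O : Type*} [CommRing O] [IsDomain O] (ι : O →+* ℂ) {p n : ℕ}
    (hp : p.Prime) (hp3 : 3 ≤ p) (ψ : O →+* ZMod (p ^ (n + 1)))
    (hsmall : ∀ h ≤ n + 1, ∀ y : O, (p : ZMod (p ^ (n + 1))) ^ (n + 1 - h) * ψ y = 0 →
      ‖ι y‖ ^ 2 < (p : ℝ) ^ h → y = 0)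
    {ζ x : O} {N₀ N : ℕ} (hζ : ζ ^ N₀ = -1) (hx : ψ x ^ (p - 1) = 1) (hxN : ‖ι x‖ ^ 2 = N)
    (hN : 2 ≤ N) {k G : ℕ} (q : Fin k → ℕ) (hq : ∀ i, (q i).Prime) (hqinj : Function.Injective q)
    (hqN : ∀ i, ¬ q i ∣ N) (hqp : ∀ i, q i < p) (hq4 : ∀ i, 4 ≤ q i)
    (hkummer : ∀ (e d : ℕ) (S : Finset (Fin k)), e ≤ 1 → d ≤ 1 → (e = 0 → d = 0 → S.Nonempty) →
      ∀ y z : O, y ^ 2 = ζ ^ e * x ^ d * (∏ i ∈ S, (q i : O)) * z ^ 2 → z = 0)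
    (hk : 1 ≤ k) (hG : 1 ≤ G) (hv : 2 ^ (G + k + 1) ≤ n + 1) (hGp : 2 ^ (G + k + 3) ≤ p)
    (hP : (√(N : ℝ) * ∏ i, (q i : ℝ)) ^ 2 ^ 11 < p) (hkG : 6 * (k + 1) ≤ G + 2)
    (hcard : 2 * p ≤ 2 ^ (G + 3 * k)) : False := by
  have h2O : (2 : O) ≠ 0 := by
    intro h
    have : ι 2 = 0 := by rw [h, map_zero]
    rw [map_ofNat] at this
    exact two_ne_zero this
  obtain ⟨d, hsq, hsqrt⟩ := QuadraticAlgebra.exists_unramified hp (by omega) n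
  obtain ⟨θ, hθ, hθu, hθx⟩ := ZMod.exists_teichmuller_generator hp (by omega) n
  have hpv : (p : ZMod (p ^ (n + 1))) ^ (n + 1) = 0 := by
    rw [← Nat.cast_pow, ZMod.natCast_self]
  set W := QuadraticAlgebra (ZMod (p ^ (n + 1))) d 0
  set A : ZMod (p ^ (n + 1)) →+* W := algebraMap _ _
  have hA : Function.Injective A := QuadraticAlgebra.algebraMap_injective
  have hN₀ : N₀ ≠ 0 := by
    rintro rfl
    rw [pow_zero, eq_neg_iff_add_eq_zero] at hζ
    exact h2O (by rw [← hζ]; norm_num)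
  have hxn : ‖ι x‖ = √(N : ℝ) := by rw [← hxN, Real.sqrt_sq (norm_nonneg _)]
  have hqu : ∀ i, IsUnit (q i : ZMod (p ^ (n + 1))) := fun i => by
    rw [ZMod.isUnit_iff_coprime]
    exact Nat.Coprime.pow_right _ ((Nat.coprime_primes (hq i) hp).2 (hqp i).ne)
  choose eq bq hqe using fun i => hθu _ (hqu i)
  obtain ⟨ex, hex⟩ := hθx _ hx
  let ξ : Option (Option (Fin k)) → O :=
    fun j => j.elim ζ fun j => j.elim x fun i => (q i : O)
  have hunit : ∀ j, IsUnit (ψ (ξ j)) := by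
    rintro (_ | _ | i)
    · refine IsUnit.of_pow_eq_one (n := N₀ * 2) ?_ (by omega)
      rw [← map_pow]
      change ψ (ζ ^ (N₀ * 2)) = 1
      rw [pow_mul, hζ]; simp
    · exact IsUnit.of_pow_eq_one hx (by omega)
    · change IsUnit (ψ (q i : O))
      rw [map_natCast]; exact hqu i
  choose w hw using fun j => hsqrt _ (hunit j)
  have hnorm_none : ‖ι (ξ (some none))‖ = √(N : ℝ) := hxn
  have hnorm_some : ∀ i, ‖ι (ξ (some (some i)))‖ = q i := fun i => by
    change ‖ι (q i : O)‖ = _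
    rw [map_natCast, Complex.norm_natCast]
  have hprod : ∏ j, ‖ι (ξ (some j))‖ = √(N : ℝ) * ∏ i, (q i : ℝ) := by
    rw [Fintype.prod_option, hnorm_none]
    simp_rw [hnorm_some]
  have hsqrt1 : 1 ≤ √(N : ℝ) := by
    rw [Real.one_le_sqrt]; exact_mod_cast (by omega : 1 ≤ N)
  let C : DescentData O W k :=
    { ι := ι, φ := A.comp ψ, p := p, v := n + 1, G := G, f := 6, N₀ := N₀, hf := (p ^ n + 1) / 2
      ξ := ξ
      w := w
      b := bq
      Z := ((2 : ℝ) ^ ((G + 6) * (k + 1))) ^ 2 * (2 ^ (k * 2 ^ (G + 6))) ^ 2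
      two_ne_zero := h2O
      prime := hp
      three_le := hp3
      pow_v := by
        have := congrArg A hpv
        simpa using this
      eq_zero_of_small := by
        intro h hh y hy hlt
        refine hsmall h hh y (hA ?_) hlt
        simpa using hy
      pow_N₀ := hζ
      norm_none := by
        have h1 := congrArg (fun z => ‖ι z‖) hζ
        simp only [map_pow, norm_pow, map_neg, map_one, norm_neg, norm_one] at h1
        exact (pow_eq_one_iff_of_nonneg (norm_nonneg _) hN₀).1 h1
      one_le_norm := by
        rintro (_ | i)
        · rw [hnorm_none]; exact hsqrt1
        · rw [hnorm_some]; exact_mod_cast (hq i).one_lt.le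
      w_sq := hw
      sq_eq := hsq
      pow_hf := by
        have hodd : 2 * ((p ^ n + 1) / 2) = p ^ n + 1 := by
          refine Nat.two_mul_div_two_of_even ?_
          exact ((hp.odd_of_ne_two (by omega)).pow).add_one
        have h1 : (1 + (p : ZMod (p ^ (n + 1)))) ^ p ^ n = 1 := by
          have := pow_orderOf_eq_one (1 + (p : ZMod (p ^ (n + 1))))
          rwa [ZMod.orderOf_one_add_prime hp (by omega)] at this
        have h2 := congrArg A h1
        simp only [map_pow, map_add, map_one, map_natCast] at h2
        rw [hodd, pow_succ, h2, one_mul]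
      indep := by
        intro m m' h
        have hm : ∀ m : Option (Fin k) → ℕ, (∏ j, ‖ι (ξ (some j))‖ ^ m j) ^ 2 =
            ((N ^ m none * ∏ i, q i ^ (2 * m (some i)) : ℕ) : ℝ) := by
          intro m
          rw [Fintype.prod_option, hnorm_none]
          simp_rw [hnorm_some]
          push_cast
          rw [mul_pow, ← pow_mul, mul_comm (m none), pow_mul, Real.sq_sqrt (by positivity),
            ← Finset.prod_pow]
          simp_rw [← pow_mul, mul_comm]
        have h1 := congrArg (· ^ 2) h
        simp only [hm] at h1
        have h2 : N ^ m none * ∏ i, q i ^ (2 * m (some i)) =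
            N ^ m' none * ∏ i, q i ^ (2 * m' (some i)) := by exact_mod_cast h1
        have hfac : ∀ (m : Option (Fin k) → ℕ) (i : Fin k),
            (N ^ m none * ∏ i, q i ^ (2 * m (some i))).factorization (q i) = 2 * m (some i) := by
          intro m i
          have hne : ∀ i ∈ (univ : Finset (Fin k)), q i ^ (2 * m (some i)) ≠ 0 :=
            fun i _ => pow_ne_zero _ (hq i).ne_zero
          rw [Nat.factorization_mul (pow_ne_zero _ (by omega)) (Finset.prod_ne_zero_iff.2 hne),
            Nat.factorization_prod hne, Nat.factorization_pow, Finsupp.add_apply,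
            Finsupp.smul_apply, Nat.factorization_eq_zero_of_not_dvd (hqN i), smul_zero, zero_add,
            Finsupp.finsetSum_apply, Finset.sum_eq_single i]
          · rw [(hq i).factorization_pow, Finsupp.single_eq_same]
          · intro j _ hj
            rw [(hq j).factorization_pow, Finsupp.single_eq_of_ne]
            exact fun h => hj (hqinj h.symm)
          · simp
        have h3 : ∀ i, m (some i) = m' (some i) := fun i => by
          have := hfac m i
          rw [h2, hfac m' i] at this
          omega
        funext j
        rcases j with _ | i
        · simp_rw [h3] at h2
          have h4 : 0 < ∏ i, q i ^ (2 * m' (some i)) :=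
            Finset.prod_pos fun i _ => pow_pos (hq i).pos _
          exact Nat.pow_right_injective hN (Nat.eq_of_mul_eq_mul_right h4 h2)
        · exact h3 i
      kummer := by
        intro T hT y z hyz
        classical
        let S : Finset (Fin k) := univ.filter fun i => some (some i) ∈ T
        refine hkummer (if none ∈ T then 1 else 0) (if some none ∈ T then 1 else 0) S
          (by split_ifs <;> omega) (by split_ifs <;> omega) ?_ y z ?_
        · intro h1 h2
          obtain ⟨j, hj⟩ := hT
          rcases j with _ | _ | i
          · simp [hj] at h1
          · simp [hj] at h2
          · exact ⟨i, by simp [S, hj]⟩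
        · rw [hyz]
          congr 1
          have : ∏ j ∈ T, ξ j = ∏ j, ξ j ^ (if j ∈ T then 1 else 0) := by
            simp only [pow_ite, pow_one, pow_zero, Finset.prod_ite_mem, Finset.univ_inter]
          rw [this, Fintype.prod_option, Fintype.prod_option, ← mul_assoc]
          congr 1
          rw [Finset.prod_filter]
          refine Finset.prod_congr rfl fun i _ => ?_
          split_ifs <;> simp [ξ]
      one_le_G := hG
      le_v := hv
      le_p := hGp
      small := by
        rw [hprod]; exact hP
      hfk := hkG
      Z_le := by
        rw [hprod]
        have h1 : (4 : ℝ) ^ k ≤ √(N : ℝ) * ∏ i, (q i : ℝ) := by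
          have : (4 : ℝ) ^ k ≤ ∏ i, (q i : ℝ) := by
            calc (4 : ℝ) ^ k = ∏ _i : Fin k, (4 : ℝ) := by simp
              _ ≤ _ := Finset.prod_le_prod (fun _ _ => by norm_num)
                fun i _ => by exact_mod_cast hq4 i
          have h0 : (0 : ℝ) < 4 ^ k := by positivity
          nlinarith
        refine le_trans ?_ (pow_le_pow_left₀ (by positivity) h1 _)
        rw [show (4 : ℝ) = 2 ^ 2 by norm_num, ← pow_mul, ← pow_mul, ← pow_mul, ← pow_mul, ← pow_add]
        refine pow_le_pow_right₀ (by norm_num) ?_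
        have h2 : G + 6 ≤ 2 ^ (G + 6) := Nat.lt_two_pow_self.le
        have h3 : 2 ^ (G + 6 + 2) = 4 * 2 ^ (G + 6) := by ring
        rw [h3]
        have h4 : (G + 6) * (k + 1) ≤ 2 ^ (G + 6) * (2 * k) := Nat.mul_le_mul h2 (by omega)
        nlinarith }
  refine C.false_of_card (A θ) ?_ (fun j => j.elim ex eq) ?_ ?_ ?_ le_rfl
  · change A θ ^ (p - 1) = 1
    rw [← map_pow, hθ, map_one]
  · change A (ψ x) = A θ ^ ex
    rw [hex, map_pow]
  · intro i
    change A (ψ (q i : O)) = A θ ^ eq i * (1 + (p : W)) ^ bq i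
    rw [map_natCast, hqe i]
    simp
  · change p * (2 * (64 * 8 ^ k * 2 ^ (G * k))) ≤ 2 ^ ((G + 6) * (k + 1))
    calc p * (2 * (64 * 8 ^ k * 2 ^ (G * k))) = 2 * p * (64 * 8 ^ k * 2 ^ (G * k)) := by ring
      _ ≤ 2 ^ (G + 3 * k) * (64 * 8 ^ k * 2 ^ (G * k)) := Nat.mul_le_mul_right _ hcard
      _ = _ := by
        rw [show 8 = 2 ^ 3 by norm_num, show 64 = 2 ^ 6 by norm_num, ← pow_mul, ← pow_add,
          ← pow_add, ← pow_add]
        congr 1; ring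

end Wieferich

section WieferichBound

open Finset

/-- Chebyshev's lower bound provides many primes in `(B, y]`. -/
lemma exists_primes_between {y ℓ : ℝ} (hℓ : 10 ^ 9 ≤ ℓ) (hy : y = Real.exp ℓ) {B k : ℕ}
    (hB : (B : ℝ) ≤ 4 * ℓ) (hk : (k : ℝ) ≤ y / (2500 * ℓ)) :
    ∃ F : Finset ℕ, F.card = k ∧ ∀ r ∈ F, r.Prime ∧ B < r ∧ (r : ℝ) ≤ y := by
  have hy4 : ℓ ^ 4 / 24 ≤ y := by
    have := Real.pow_div_factorial_le_exp ℓ (by linarith) 4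
    rw [hy]; simpa [Nat.factorial] using this
  have hℓ0 : 0 < ℓ := by linarith
  have hyℓ2 : 10 ^ 15 * ℓ ^ 2 ≤ y := by
    nlinarith [sq_nonneg ℓ, mul_le_mul hℓ hℓ (by norm_num) hℓ0.le]
  have hyℓ : 10 ^ 20 * ℓ ≤ y := by nlinarith
  have hyp : 0 < y := by nlinarith
  set M := ⌊y⌋₊ with hM
  have hMy : (M : ℝ) ≤ y := Nat.floor_le hyp.le
  have hMy1 : y - 1 ≤ (M : ℝ) := (Nat.sub_one_lt_floor y).le
  have hM2 : (2 : ℝ) ≤ M := by nlinarith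
  have hlogM : Real.log M ≤ ℓ := by
    have := Real.log_le_log (by linarith) hMy
    rwa [hy, Real.log_exp] at this
  have hlogM0 : 0 < Real.log M := Real.log_pos (by linarith)
  have hpi := Chebyshev.pi_ge M
  have hlogM1 : Real.log (M + 1) ≤ ℓ + 1 := by
    have h1 : Real.log (M + 1) ≤ Real.log (2 * M) := Real.log_le_log (by linarith) (by linarith)
    rw [Real.log_mul (by norm_num) (by linarith)] at h1
    have := Real.log_two_lt_d9
    linarith
  have h2 : y / (2 * ℓ) ≤ (Nat.primeCounting M : ℝ) := by
    refine le_trans ?_ hpi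
    have := Real.log_two_gt_d9
    have h3 : 0.69 * (y - 1) - (ℓ + 1) ≤ M * Real.log 2 - Real.log (M + 1) := by nlinarith
    have h4 : y / 2 ≤ 0.69 * (y - 1) - (ℓ + 1) := by nlinarith
    calc y / (2 * ℓ) = y / 2 / ℓ := by field_simp
      _ ≤ (M * Real.log 2 - Real.log (M + 1)) / ℓ := by gcongr; linarith
      _ ≤ _ := div_le_div_of_nonneg_left (by linarith) hlogM0 hlogM
  have h5 : (k : ℝ) + B ≤ Nat.primeCounting M := by
    have h6 : y / (2 * ℓ) = 1250 * (y / (2500 * ℓ)) := by field_simp; norm_num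
    have h7 : 4 * ℓ ≤ y / (2500 * ℓ) := by
      rw [le_div_iff₀ (by positivity)]; nlinarith
    linarith
  have h5' : k + B ≤ Nat.primeCounting M := by exact_mod_cast h5
  set F₀ := (Finset.range (M + 1)).filter fun r => r.Prime ∧ B < r
  have hcard : k ≤ F₀.card := by
    have h8 : (Finset.range (M + 1)).filter Nat.Prime ⊆ F₀ ∪ Finset.Icc 1 B := by
      intro r hr
      rw [Finset.mem_filter] at hr
      rw [Finset.mem_union, Finset.mem_filter, Finset.mem_Icc]
      by_cases h : B < r
      · exact Or.inl ⟨hr.1, hr.2, h⟩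
      · exact Or.inr ⟨hr.2.one_lt.le, not_lt.1 h⟩
    have h9 := (Finset.card_le_card h8).trans (Finset.card_union_le _ _)
    rw [Nat.card_Icc, Nat.add_sub_cancel] at h9
    have h10 : k + B ≤ ((Finset.range (M + 1)).filter Nat.Prime).card := by
      rw [Nat.primeCounting, Nat.primeCounting', Nat.count_eq_card_filter_range] at h5'
      convert h5'
    omega
  obtain ⟨F, hF, hFc⟩ := Finset.exists_subset_card_eq hcard
  refine ⟨F, hFc, fun r hr => ?_⟩
  have := Finset.mem_filter.1 (hF hr)
  refine ⟨this.2.1, this.2.2, le_trans ?_ hMy⟩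
  exact_mod_cast Nat.lt_succ_iff.1 (Finset.mem_range.1 this.1)

/-- A bound for the exponent `v` in `x ^ (p - 1) ≡ 1 mod p ^ v` that improves on the
trivial bound by a superpolynomial factor. -/
theorem wieferich_bound {O : Type*} [CommRing O] [IsDomain O] (ι : O →+* ℂ) {p n : ℕ}
    (hp : p.Prime) (ψ : O →+* ZMod (p ^ (n + 1)))
    (hsmall : ∀ h ≤ n + 1, ∀ y : O, (p : ZMod (p ^ (n + 1))) ^ (n + 1 - h) * ψ y = 0 →
      ‖ι y‖ ^ 2 < (p : ℝ) ^ h → y = 0)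
    {ζ x : O} {N₀ N B : ℕ} (hζ : ζ ^ N₀ = -1) (hx : ψ x ^ (p - 1) = 1) (hxN : ‖ι x‖ ^ 2 = N)
    (hN : 2 ≤ N) (hNB : N ≤ B ^ 2) (hNB' : ∀ r : ℕ, r.Prime → r ∣ N → r ≤ B) (hB4 : 4 ≤ B)
    (hkummer : ∀ (e d : ℕ) (S : Finset ℕ), (∀ r ∈ S, r.Prime ∧ B < r) → e ≤ 1 → d ≤ 1 →
      (e = 0 → d = 0 → S.Nonempty) →
      ∀ y z : O, y ^ 2 = ζ ^ e * x ^ d * (∏ r ∈ S, (r : O)) * z ^ 2 → z = 0)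
    (hpbig : Real.exp (Real.exp (10 ^ 9)) ≤ p) (hB : (B : ℝ) ≤ 4 * Real.log (Real.log p)) :
    (n + 1 : ℝ) ≤ p * Real.exp (-(0.0004 * Real.log p / Real.log (Real.log p))) := by
  by_contra! hlt
  set y := Real.log p with hy
  set ℓ := Real.log y with hℓ
  have hp0 : (0 : ℝ) < p := by exact_mod_cast hp.pos
  have hybig : Real.exp (10 ^ 9) ≤ y := by
    rw [hy, Real.le_log_iff_exp_le hp0]; exact hpbig
  have hy0 : 0 < y := (Real.exp_pos _).trans_le hybig
  have hℓbig : 10 ^ 9 ≤ ℓ := by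
    rw [hℓ, Real.le_log_iff_exp_le hy0]; exact hybig
  have hℓ0 : 0 < ℓ := by linarith
  have hyℓ : y = Real.exp ℓ := (Real.exp_log hy0).symm
  have hpy : (p : ℝ) = Real.exp y := (Real.exp_log hp0).symm
  have hy4 : ℓ ^ 4 / 24 ≤ y := by
    have := Real.pow_div_factorial_le_exp ℓ (by linarith) 4
    rw [hyℓ]; simpa [Nat.factorial] using this
  have hy2 : 10 ^ 15 * ℓ ^ 2 ≤ y := by
    nlinarith [sq_nonneg ℓ, mul_le_mul hℓbig hℓbig (by norm_num) hℓ0.le]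
  have hy1 : 10 ^ 20 * ℓ ≤ y := by nlinarith
  set t := y / (2500 * ℓ) with ht
  have htbig : 10 ^ 16 ≤ t := by
    rw [ht, le_div_iff₀ (by positivity)]; nlinarith
  have hty : 2500 * ℓ * t = y := by rw [ht]; field_simp
  set k := ⌊t⌋₊ with hk
  have hkt : (k : ℝ) ≤ t := Nat.floor_le (by linarith)
  have hkt1 : t - 1 ≤ k := (Nat.sub_one_lt_floor t).le
  obtain ⟨F, hFc, hF⟩ := exists_primes_between hℓbig hyℓ hB hkt
  obtain ⟨q, hqF, hqinj⟩ : ∃ q : Fin k → ℕ, (∀ i, q i ∈ F) ∧ Function.Injective q :=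
    ⟨F.orderEmbOfFin hFc, fun i => F.orderEmbOfFin_mem hFc i, (F.orderEmbOfFin hFc).injective⟩
  have hlog2 := Real.log_two_gt_d9
  have hlog2' := Real.log_two_lt_d9
  have hyp : y + 1 ≤ p := by rw [hpy]; exact Real.add_one_le_exp y
  -- the size of `4 ^ k`
  have h4k : 8 * Real.exp t ≤ (4 : ℝ) ^ k := by
    have h1 : (4 : ℝ) = Real.exp (2 * Real.log 2) := by
      rw [two_mul, Real.exp_add, Real.exp_log (by norm_num)]; norm_num
    have h2 : (8 : ℝ) = Real.exp (3 * Real.log 2) := by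
      rw [show 3 * Real.log 2 = Real.log 2 + Real.log 2 + Real.log 2 by ring, Real.exp_add,
        Real.exp_add, Real.exp_log (by norm_num)]; norm_num
    rw [h1, ← Real.exp_nat_mul, h2, ← Real.exp_add, Real.exp_le_exp]
    nlinarith
  have hk1 : 32 ≤ 4 ^ k := by
    have : (32 : ℝ) ≤ 4 ^ k := by
      have := Real.add_one_le_exp t
      linarith
    exact_mod_cast this
  have hex : ∃ G, 2 * p ≤ 2 ^ (G + 3 * k) := ⟨2 * p, Nat.lt_two_pow_self.le.trans
    (Nat.pow_le_pow_right (by norm_num) (by omega))⟩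
  classical
  set G := Nat.find hex with hG
  have hG1 : 2 * p ≤ 2 ^ (G + 3 * k) := Nat.find_spec hex
  have hGk : 6 * (k + 1) ≤ G + 2 := by
    have h1 : (p : ℝ) ≤ 2 ^ (G + 3 * k) := by
      exact_mod_cast (by omega : p ≤ 2 ^ (G + 3 * k))
    have h2 : y ≤ (G + 3 * k : ℕ) * Real.log 2 := by
      rw [hy, ← Real.log_pow]
      exact Real.log_le_log hp0 h1
    push_cast at h2
    have h3 : (6 * (k + 1) : ℝ) ≤ G + 2 := by
      have : (0 : ℝ) ≤ G + 3 * k := by positivity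
      nlinarith
    exact_mod_cast h3
  have hG2 : 2 ^ (G + 3 * k) < 4 * p := by
    have h1 : ¬ 2 * p ≤ 2 ^ (G - 1 + 3 * k) := Nat.find_min hex (by omega)
    have h2 : 2 ^ (G + 3 * k) = 2 * 2 ^ (G - 1 + 3 * k) := by
      rw [← pow_succ']; congr 1; omega
    omega
  have h4k2 : 4 ^ k * 2 ^ (G + k) = 2 ^ (G + 3 * k) := by
    rw [show 4 = 2 ^ 2 by norm_num, ← pow_mul, ← pow_add]; congr 1; ring
  refine false_of_wieferich ι hp ?_ ψ hsmall hζ hx hxN hN q (fun i => (hF _ (hqF i)).1) hqinj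
    (fun i h => ?_) (fun i => ?_) (fun i => ?_) ?_ ?_ (G := G) ?_ ?_ ?_ ?_ hGk hG1
  · have : (3 : ℝ) ≤ p := by nlinarith
    exact_mod_cast this
  · have h1 := hNB' _ (hF _ (hqF i)).1 h
    have := (hF _ (hqF i)).2.1
    omega
  · have := (hF _ (hqF i)).2.2
    have : (q i : ℝ) < p := by linarith
    exact_mod_cast this
  · have := (hF _ (hqF i)).2.1
    omega
  · intro e d S he hd hS u z h
    refine hkummer e d (S.image q) ?_ he hd (fun h1 h2 => (hS h1 h2).image _) u z ?_
    · intro r hr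
      obtain ⟨i, -, rfl⟩ := Finset.mem_image.1 hr
      exact ⟨(hF _ (hqF i)).1, (hF _ (hqF i)).2.1⟩
    · rw [h, Finset.prod_image fun i _ j _ hij => hqinj hij]
  · have : (1 : ℝ) ≤ k := by linarith
    exact_mod_cast this
  · omega
  · have h1 : (2 : ℝ) ^ (G + k + 1) * 4 ^ k < 8 * p := by
      have : 2 ^ (G + k + 1) * 4 ^ k < 8 * p := by
        rw [pow_succ, mul_comm, ← mul_assoc, h4k2]; omega
      exact_mod_cast this
    have h2 : (2 : ℝ) ^ (G + k + 1) ≤ p * Real.exp (-t) := by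
      have h3 : (2 : ℝ) ^ (G + k + 1) * (8 * Real.exp t) ≤ 8 * p :=
        (mul_le_mul_of_nonneg_left h4k (by positivity)).trans h1.le
      rw [Real.exp_neg, ← div_eq_mul_inv, le_div_iff₀ (Real.exp_pos _)]
      linarith
    have h5 : t = 0.0004 * y / ℓ := by rw [ht]; field_simp; norm_num
    rw [h5] at h2
    have h6 : (2 : ℝ) ^ (G + k + 1) ≤ ((n + 1 : ℕ) : ℝ) := by push_cast; linarith
    exact_mod_cast h6
  · have h1 : 2 ^ (G + k + 3) * 32 ≤ 2 ^ (G + k + 3) * 4 ^ k := Nat.mul_le_mul_left _ hk1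
    have h2 : 2 ^ (G + k + 3) * 4 ^ k = 8 * 2 ^ (G + 3 * k) := by
      rw [← h4k2]; ring
    omega
  · have h1 : √(N : ℝ) ≤ Real.exp (4 * ℓ) := by
      have h2 : √(N : ℝ) ≤ B := Real.sqrt_le_iff.2 ⟨by positivity, by exact_mod_cast hNB⟩
      have := Real.add_one_le_exp (4 * ℓ)
      linarith
    have hq0 : 0 ≤ ∏ i, (q i : ℝ) := Finset.prod_nonneg fun i _ => Nat.cast_nonneg _
    have h2 : ∏ i, (q i : ℝ) ≤ Real.exp (k * ℓ) := by
      rw [Real.exp_nat_mul, ← hyℓ]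
      calc ∏ i, (q i : ℝ) ≤ ∏ _i : Fin k, y :=
            Finset.prod_le_prod (fun _ _ => Nat.cast_nonneg _) fun i _ => (hF _ (hqF i)).2.2
        _ = y ^ k := by simp
    have h3 : √(N : ℝ) * ∏ i, (q i : ℝ) ≤ Real.exp (4 * ℓ + k * ℓ) := by
      rw [Real.exp_add]
      exact mul_le_mul h1 h2 hq0 (Real.exp_pos _).le
    refine (pow_le_pow_left₀ (mul_nonneg (Real.sqrt_nonneg _) hq0) h3 _).trans_lt ?_
    have h4 : (k : ℝ) * ℓ ≤ t * ℓ := mul_le_mul_of_nonneg_right hkt hℓ0.le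
    have h5 : ((2 ^ 11 : ℕ) : ℝ) * (4 * ℓ + k * ℓ) < y := by
      push_cast
      linarith
    rw [← Real.exp_nat_mul, hpy]
    exact Real.exp_lt_exp.2 h5

end WieferichBound

section WieferichInt

open Finset

lemma pow_sub_one_eq_one_of_coprime {p n M : ℕ} (hp : p.Prime) (hM : M.Coprime p)
    {u : ZMod (p ^ (n + 1))} (hu : u ^ M = 1) : u ^ (p - 1) = 1 := by
  have hM0 : M ≠ 0 := by
    rintro rfl
    exact hp.one_lt.ne' (by simpa using hM)
  obtain ⟨u, rfl⟩ := IsUnit.of_pow_eq_one hu hM0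
  have h1 : u ^ M = 1 := by
    rwa [← Units.val_pow_eq_pow_val, Units.val_eq_one] at hu
  have h2 : (u ^ (p - 1)) ^ p ^ n = 1 := by
    have := ZMod.pow_totient u
    rwa [Nat.totient_prime_pow_succ hp, mul_comm, pow_mul] at this
  have h3 : (u ^ (p - 1)) ^ M = 1 := by rw [← pow_mul, mul_comm, pow_mul, h1, one_pow]
  have h4 : orderOf (u ^ (p - 1)) ∣ 1 := by
    have := Nat.dvd_gcd (orderOf_dvd_of_pow_eq_one h3) (orderOf_dvd_of_pow_eq_one h2)
    rwa [Nat.Coprime.pow_right n hM] at this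
  rw [← Units.val_pow_eq_pow_val, orderOf_eq_one_iff.1 (Nat.dvd_one.1 h4), Units.val_one]

lemma exists_eq_pow_two_pow_not_isSquare (Q : ℕ) (hQ : 2 ≤ Q) :
    ∃ x i : ℕ, Q = x ^ 2 ^ i ∧ 2 ≤ x ∧ x ≤ Q ∧ ¬ IsSquare x := by
  induction Q using Nat.strong_induction_on with
  | _ Q ih =>
    by_cases h : IsSquare Q
    · obtain ⟨r, hr⟩ := h
      have hr2 : 2 ≤ r := by
        by_contra hlt
        have : r ≤ 1 := by omega
        interval_cases r <;> omega
      have hrQ : r < Q := by nlinarith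
      obtain ⟨x, i, hx, h2, hle, hs⟩ := ih r hrQ hr2
      exact ⟨x, i + 1, by rw [hr, pow_succ, pow_mul, ← hx, sq], h2, by omega, hs⟩
    · exact ⟨Q, 0, by simp, hQ, le_rfl, h⟩

lemma not_isSquare_mul_prod_primes {x : ℕ} (hx : x ≠ 0) {S : Finset ℕ} (hS : S.Nonempty)
    (hprime : ∀ r ∈ S, r.Prime ∧ x < r) : ¬ IsSquare (x * ∏ r ∈ S, r) := by
  obtain ⟨r, hr⟩ := hS
  rintro ⟨m, hm⟩
  have hrp := (hprime r hr).1
  have hrx : ¬ r ∣ x := fun h => by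
    have := Nat.le_of_dvd (by omega) h
    have := (hprime r hr).2
    omega
  rw [← Finset.mul_prod_erase _ _ hr] at hm
  have h1 : r ∣ m := by
    have : r ∣ m * m := ⟨x * ∏ s ∈ S.erase r, s, by rw [← hm]; ring⟩
    exact (hrp.dvd_mul.1 this).elim id id
  obtain ⟨c, rfl⟩ := h1
  have h2 : x * ∏ s ∈ S.erase r, s = r * (c * c) :=
    Nat.eq_of_mul_eq_mul_left hrp.pos (by linarith)
  rcases hrp.dvd_mul.1 ⟨_, h2⟩ with h3 | h3
  · exact hrx h3
  · obtain ⟨s, hs, hrs⟩ := (hrp.prime.dvd_finsetProd_iff _).1 h3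
    have := (Nat.prime_dvd_prime_iff_eq hrp (hprime s (Finset.mem_of_mem_erase hs)).1).1 hrs
    exact (Finset.ne_of_mem_erase hs) this.symm

/-- The exponent of `p` in `Q ^ M - 1`, for `M` prime to `p`. -/
theorem wieferich_bound_int {p n M Q : ℕ} (hp : p.Prime) (hM : M.Coprime p) (hQ : 2 ≤ Q)
    (hdvd : ((Q : ZMod (p ^ (n + 1))) ^ M = 1))
    (hpbig : Real.exp (Real.exp (10 ^ 9)) ≤ p) (hB : (4 * Q : ℝ) ≤ 4 * Real.log (Real.log p)) :
    (n + 1 : ℝ) ≤ p * Real.exp (-(0.0004 * Real.log p / Real.log (Real.log p))) := by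
  have hp0 : (0 : ℝ) < p := by exact_mod_cast hp.pos
  have hp2 : 2 < p := by
    have h1 := Real.add_one_le_exp (Real.exp (10 ^ 9))
    have h2 := Real.add_one_le_exp (10 ^ 9 : ℝ)
    have : (2 : ℝ) < p := by linarith
    exact_mod_cast this
  obtain ⟨x, i, hxQ, hx2, hxle, hxs⟩ := exists_eq_pow_two_pow_not_isSquare Q hQ
  refine wieferich_bound (O := ℤ) (Int.castRingHom ℂ) hp (Int.castRingHom _) ?_ (ζ := -1)
    (N₀ := 1) (x := (x : ℤ)) (N := x ^ 2) (B := 4 * Q) (by norm_num) ?_ ?_ (by nlinarith)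
    (Nat.pow_le_pow_left (by omega) _) ?_ (by omega) ?_ hpbig (by push_cast; exact hB)
  · intro h hh y hy hlt
    have h1 : ((p ^ (n + 1) : ℕ) : ℤ) ∣ (p : ℤ) ^ (n + 1 - h) * y := by
      rw [← ZMod.intCast_zmod_eq_zero_iff_dvd]
      simpa using hy
    have h2 : (p : ℤ) ^ h ∣ y := by
      have h3 : ((p ^ (n + 1) : ℕ) : ℤ) = (p : ℤ) ^ (n + 1 - h) * (p : ℤ) ^ h := by
        rw [← pow_add, Nat.sub_add_cancel hh]; push_cast; rfl
      rw [h3] at h1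
      exact Int.dvd_of_mul_dvd_mul_left (pow_ne_zero _ (by exact_mod_cast hp.ne_zero)) h1
    by_contra hy0
    have h4 := Int.le_of_dvd (abs_pos.2 hy0) ((dvd_abs _ _).2 h2)
    have h5 : ‖(Int.castRingHom ℂ) y‖ ^ 2 = ((|y| ^ 2 : ℤ) : ℝ) := by simp
    rw [h5] at hlt
    have h6 : |y| ^ 2 < (p : ℤ) ^ h := by exact_mod_cast hlt
    have h7 : 1 ≤ |y| := Int.one_le_abs hy0
    nlinarith
  · refine pow_sub_one_eq_one_of_coprime hp (M := 2 ^ i * M) (Nat.Coprime.mul_left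
      (Nat.Coprime.pow_left _ ((Nat.coprime_primes Nat.prime_two hp).2 hp2.ne)) hM) ?_
    rw [pow_mul, ← map_pow, ← Nat.cast_pow, ← hxQ]
    simpa using hdvd
  · simp
  · intro r hr h
    have := Nat.le_of_dvd (by omega) (hr.dvd_of_dvd_pow h)
    omega
  · intro e d S hS he hd hne y z h
    by_contra hz
    have hdz : z ∣ y := by
      rw [← Int.pow_dvd_pow_iff two_ne_zero]
      exact ⟨(-1) ^ e * (x : ℤ) ^ d * ∏ r ∈ S, (r : ℤ), by rw [h]; ring⟩
    obtain ⟨m, rfl⟩ := hdz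
    have hm : m ^ 2 = (-1) ^ e * (x : ℤ) ^ d * ∏ r ∈ S, (r : ℤ) := by
      have : z ^ 2 * m ^ 2 = z ^ 2 * ((-1) ^ e * (x : ℤ) ^ d * ∏ r ∈ S, (r : ℤ)) := by
        rw [← mul_pow, h]; ring
      exact mul_left_cancel₀ (pow_ne_zero 2 hz) this
    have hpos : (0 : ℤ) < (x : ℤ) ^ d * ∏ r ∈ S, (r : ℤ) := by
      refine mul_pos (pow_pos (by omega) _) (Finset.prod_pos fun r hr => ?_)
      exact_mod_cast (hS r hr).1.pos
    have he0 : e = 0 := by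
      by_contra h0
      have : e = 1 := by omega
      subst this
      nlinarith [sq_nonneg m]
    subst he0
    have hsq : IsSquare (x ^ d * ∏ r ∈ S, r) := by
      refine ⟨m.natAbs, ?_⟩
      zify
      rw [← sq, sq_abs, hm]; ring
    rcases S.eq_empty_or_nonempty with rfl | hSne
    · have : d = 1 := by
        by_contra h1
        exact absurd (hne rfl (by omega)) (by simp)
      subst this
      exact hxs (by simpa using hsq)
    · refine not_isSquare_mul_prod_primes (pow_ne_zero _ (by omega)) hSne
        (fun r hr => ⟨(hS r hr).1, ?_⟩) hsq
      have h1 := (hS r hr).2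
      have h2 : x ^ d ≤ x ^ 1 := Nat.pow_le_pow_right (by omega) hd
      rw [pow_one] at h2
      omega

end WieferichInt

section QuadraticWieferich

/-- A ring with a conjugation whose norms and traces are rational integers. -/
structure ConjugationData (O : Type*) [CommRing O] where
  conj : O →+* O
  nm : O → ℤ
  tr : O → ℤ
  nm_eq : ∀ y, (nm y : O) = y * conj y
  tr_eq : ∀ y, (tr y : O) = y + conj y

namespace ConjugationData

variable {O : Type*} [CommRing O] (D : ConjugationData O)

lemma conj_eq (y : O) : D.conj y = D.tr y - y := by rw [D.tr_eq]; ring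

lemma conj_conj (y : O) : D.conj (D.conj y) = y := by
  rw [D.conj_eq y, map_sub, map_intCast, D.conj_eq y]; ring

lemma eq_zero_of_nm_eq_zero [IsDomain O] {y : O} (h : D.nm y = 0) : y = 0 := by
  have h1 := D.nm_eq y
  rw [h, Int.cast_zero] at h1
  rcases mul_eq_zero.1 h1.symm with h2 | h2
  · exact h2
  · rw [← D.conj_conj y, h2, map_zero]

variable [CharZero O]

lemma nm_mul (y z : O) : D.nm (y * z) = D.nm y * D.nm z := by
  have : ((D.nm (y * z) : ℤ) : O) = ((D.nm y * D.nm z : ℤ) : O) := by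
    push_cast
    rw [D.nm_eq, D.nm_eq, D.nm_eq, map_mul]; ring
  exact_mod_cast this

lemma nm_intCast (k : ℤ) : D.nm (k : O) = k ^ 2 := by
  have : ((D.nm (k : O) : ℤ) : O) = ((k ^ 2 : ℤ) : O) := by
    rw [D.nm_eq, map_intCast]; push_cast; ring
  exact_mod_cast this

lemma nm_one : D.nm (1 : O) = 1 := by
  have := D.nm_intCast 1
  simpa using this

lemma nm_pow (y : O) (k : ℕ) : D.nm (y ^ k) = D.nm y ^ k := by
  induction k with
  | zero => simp [D.nm_one]
  | succ k ih => rw [pow_succ, nm_mul, ih, pow_succ]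

lemma tr_sq (y : O) : D.tr y ^ 2 = D.tr (y ^ 2) + 2 * D.nm y := by
  have : ((D.tr y ^ 2 : ℤ) : O) = ((D.tr (y ^ 2) + 2 * D.nm y : ℤ) : O) := by
    push_cast
    rw [D.tr_eq, D.tr_eq, D.nm_eq, map_pow]; ring
  exact_mod_cast this

lemma tr_mul_intCast (y : O) (k : ℤ) : D.tr (y * k) = D.tr y * k := by
  have : ((D.tr (y * k) : ℤ) : O) = ((D.tr y * k : ℤ) : O) := by
    push_cast
    rw [D.tr_eq, D.tr_eq, map_mul, map_intCast]; ring
  exact_mod_cast this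

lemma exists_discr (y w : O) : ∃ c : ℤ,
    c ^ 2 = (D.tr y ^ 2 - 4 * D.nm y) * (D.tr w ^ 2 - 4 * D.nm w) := by
  refine ⟨D.tr (y * w) - D.tr (y * D.conj w), ?_⟩
  have : (((D.tr (y * w) - D.tr (y * D.conj w)) ^ 2 : ℤ) : O) =
      (((D.tr y ^ 2 - 4 * D.nm y) * (D.tr w ^ 2 - 4 * D.nm w) : ℤ) : O) := by
    push_cast
    simp only [D.tr_eq, D.nm_eq, map_mul, D.conj_conj]; ring
  exact_mod_cast this

/-- A rational prime which is unramified and prime to `η` cannot divide exactly the square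
class of `η` times a rational integer. -/
lemma sq_ne_mul_prime {r : ℕ} (hr : r.Prime) (hr2 : 2 < r) {ω w η : O} {k : ℤ}
    (hΔ : ¬ (r : ℤ) ∣ D.tr ω ^ 2 - 4 * D.nm ω) (hk : ¬ (r : ℤ) ∣ k) (hη : ¬ (r : ℤ) ∣ D.nm η) :
    w ^ 2 ≠ η * (((r : ℤ) * k : ℤ) : O) := by
  intro hw
  have hp : Prime (r : ℤ) := Nat.prime_iff_prime_int.1 hr
  have hnn : D.nm w ^ 2 = D.nm η * ((r : ℤ) * k) ^ 2 := by
    rw [← nm_pow, hw, nm_mul, nm_intCast]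
  have htt : D.tr w ^ 2 = D.tr η * ((r : ℤ) * k) + 2 * D.nm w := by
    rw [tr_sq, hw, tr_mul_intCast]
  obtain ⟨n', hn'⟩ : (r : ℤ) ∣ D.nm w := hp.dvd_of_dvd_pow (n := 2)
    ⟨D.nm η * (r * k * k), by rw [hnn]; ring⟩
  obtain ⟨t', ht'⟩ : (r : ℤ) ∣ D.tr w := hp.dvd_of_dvd_pow (n := 2)
    ⟨D.tr η * k + 2 * n', by rw [htt, hn']; ring⟩
  obtain ⟨c, hc⟩ := D.exists_discr w ω
  obtain ⟨c', rfl⟩ : (r : ℤ) ∣ c := hp.dvd_of_dvd_pow (n := 2)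
    ⟨(r * t' ^ 2 - 4 * n') * (D.tr ω ^ 2 - 4 * D.nm ω), by rw [hc, hn', ht']; ring⟩
  have hr0 : (r : ℤ) ≠ 0 := hp.ne_zero
  have h1 : (r * t' ^ 2 - 4 * n') * (D.tr ω ^ 2 - 4 * D.nm ω) = r * c' ^ 2 := by
    refine mul_left_cancel₀ hr0 ?_
    rw [hn', ht'] at hc
    linear_combination -hc
  have h2 : (r : ℤ) ∣ r * t' ^ 2 - 4 * n' := by
    rcases hp.dvd_mul.1 ⟨_, h1⟩ with h | h
    · exact h
    · exact absurd h hΔ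
  have h3 : (r : ℤ) ∣ 4 * n' := by
    have := (dvd_sub_right ⟨t' ^ 2, rfl⟩ : (r : ℤ) ∣ r * t' ^ 2 - 4 * n' ↔ _).1 h2
    exact this
  have h4 : (r : ℤ) ∣ n' := by
    rcases hp.dvd_mul.1 h3 with h | h
    · exfalso
      have h5 : (r : ℤ) ∣ 2 := hp.dvd_of_dvd_pow (n := 2) (by norm_num; exact h)
      have := Int.le_of_dvd (by norm_num) h5
      omega
    · exact h
  obtain ⟨n'', rfl⟩ := h4
  have h5 : D.nm η * k ^ 2 = r * (r * n'' ^ 2) := by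
    refine mul_left_cancel₀ (pow_ne_zero 2 hr0) ?_
    rw [hn'] at hnn
    linear_combination -hnn
  rcases hp.dvd_mul.1 ⟨_, h5⟩ with h | h
  · exact hη h
  · exact hk (hp.dvd_of_dvd_pow h)

lemma nm_eq_one_of_pow (hnn : ∀ y, 0 ≤ D.nm y) {ζ : O} {N : ℕ} (hN : N ≠ 0) (hζ : ζ ^ N = -1) :
    D.nm ζ = 1 := by
  have h1 : D.nm ζ ^ N = 1 := by
    rw [← nm_pow, hζ]
    have := D.nm_intCast (-1)
    simpa using this
  exact (pow_eq_one_iff_of_nonneg (hnn _) hN).1 h1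

lemma exists_root_of_neg_one (hnn : ∀ y, 0 ≤ D.nm y) :
    ∃ (ζ : O) (N : ℕ), (N = 1 ∨ N = 2) ∧ ζ ^ N = -1 ∧ ¬ IsSquare ζ := by
  by_cases h : ∃ i : O, i ^ 2 = -1
  · obtain ⟨i, hi⟩ := h
    refine ⟨i, 2, Or.inr rfl, hi, ?_⟩
    rintro ⟨w, hw⟩
    rw [← sq] at hw
    have hni := D.nm_eq_one_of_pow hnn two_ne_zero hi
    have hnw : D.nm w = 1 :=
      D.nm_eq_one_of_pow hnn (N := 4) (by norm_num) (by rw [← hi, hw]; ring)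
    have h1 : D.tr i ^ 2 = 0 := by
      rw [tr_sq, hi, hni]
      have : D.tr (-1 : O) = -2 := by
        have : ((D.tr (-1 : O) : ℤ) : O) = ((-2 : ℤ) : O) := by
          rw [D.tr_eq]; simp; ring
        exact_mod_cast this
      rw [this]; norm_num
    have h2 : D.tr i = 0 := by simpa using h1
    have h3 : D.tr w ^ 2 = 2 := by rw [tr_sq, ← hw, h2, hnw]; norm_num
    have h4 : D.tr w ≤ 1 := by nlinarith
    have h5 : -1 ≤ D.tr w := by nlinarith
    interval_cases D.tr w <;> omega
  · refine ⟨-1, 1, Or.inl rfl, by simp, ?_⟩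
    rintro ⟨w, hw⟩
    exact h ⟨w, by rw [sq, hw]⟩

lemma exists_eq_mul_pow_two_pow (hnn : ∀ y, 0 ≤ D.nm y) {ζ : O} {N : ℕ} (hN : N ≠ 0)
    (hζ : ζ ^ N = -1) (s : ℕ) :
    ∀ x : O, D.nm x = s → 2 ≤ s → ∃ (y : O) (i j : ℕ), x = ζ ^ j * y ^ 2 ^ i ∧
      2 ≤ D.nm y ∧ D.nm y ≤ s ∧ ∀ e ≤ 1, ¬ IsSquare (ζ ^ e * y) := by
  have hζ1 := D.nm_eq_one_of_pow hnn hN hζ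
  have hζ2 : ζ ^ (2 * N) = 1 := by rw [mul_comm, pow_mul, hζ]; norm_num
  induction s using Nat.strong_induction_on with
  | _ s ih =>
    intro x hx hs
    by_cases h : ∀ e ≤ 1, ¬ IsSquare (ζ ^ e * x)
    · exact ⟨x, 0, 0, by simp, by omega, by omega, h⟩
    · push Not at h
      obtain ⟨e, he, w, hw⟩ := h
      have h1 : D.nm w * D.nm w = s := by
        rw [← nm_mul, ← hw, nm_mul, nm_pow, hζ1, hx]; simp
      obtain ⟨m, hm⟩ := Int.eq_ofNat_of_zero_le (hnn w)
      rw [hm] at h1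
      have h1' : m * m = s := by exact_mod_cast h1
      have hm2 : 2 ≤ m := by
        by_contra hlt
        have : m ≤ 1 := by omega
        interval_cases m <;> omega
      have hms : m < s := by nlinarith
      obtain ⟨y, i, j, hy, hy2, hys, hysq⟩ := ih m hms w hm hm2
      refine ⟨y, i + 1, (2 * N - 1) * e + 2 * j, ?_, hy2, by omega, hysq⟩
      have h3 : ζ ^ ((2 * N - 1) * e) * ζ ^ e = 1 := by
        rw [← pow_add, ← Nat.succ_mul, Nat.succ_eq_add_one, Nat.sub_add_cancel (by omega),
          pow_mul, hζ2, one_pow]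
      calc x = ζ ^ ((2 * N - 1) * e) * ζ ^ e * x := by rw [h3, one_mul]
        _ = ζ ^ ((2 * N - 1) * e) * (w * w) := by rw [mul_assoc, hw]
        _ = _ := by rw [hy]; ring

/-- The exponent of a split prime in `ω ^ M - 1`, for `M` prime to `p`, as seen through a
homomorphism to `ℤ / p ^ (n + 1)`. -/
theorem wieferich_bound [IsDomain O] [IsIntegrallyClosed O] (ι : O →+* ℂ)
    (hι : ∀ y, ‖ι y‖ ^ 2 = D.nm y) {p n M : ℕ} (hp : p.Prime) (hM : M.Coprime p)
    (ψ : O →+* ZMod (p ^ (n + 1))) {ω : O} (hdisc : D.tr ω ^ 2 < 4 * D.nm ω)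
    (hω2 : 2 ≤ D.nm ω) (hdvd : ψ ω ^ M = 1)
    (hpbig : Real.exp (Real.exp (10 ^ 9)) ≤ p)
    (hB : (4 * D.nm ω : ℝ) ≤ 4 * Real.log (Real.log p)) :
    (n + 1 : ℝ) ≤ p * Real.exp (-(0.0004 * Real.log p / Real.log (Real.log p))) := by
  have hp2 : 2 < p := by
    have h1 := Real.add_one_le_exp (Real.exp (10 ^ 9))
    have h2 := Real.add_one_le_exp (10 ^ 9 : ℝ)
    have : (2 : ℝ) < p := by linarith
    exact_mod_cast this
  have hnn : ∀ y, 0 ≤ D.nm y := fun y => by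
    have : (0 : ℝ) ≤ D.nm y := by rw [← hι]; positivity
    exact_mod_cast this
  obtain ⟨Q, hQ⟩ := Int.eq_ofNat_of_zero_le (hnn ω)
  rw [hQ] at hω2 hB
  obtain ⟨ζ, N₀, hN₀, hζ, hζs⟩ := D.exists_root_of_neg_one hnn
  have hN₀' : N₀ ≠ 0 := by omega
  have hζ1 := D.nm_eq_one_of_pow hnn hN₀' hζ
  obtain ⟨x, i, j, hx, hx2, hxQ, hxs⟩ := D.exists_eq_mul_pow_two_pow hnn hN₀' hζ Q ω hQ
    (by exact_mod_cast hω2)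
  obtain ⟨N, hN⟩ := Int.eq_ofNat_of_zero_le (hnn x)
  rw [hN] at hx2 hxQ
  have hx2' : 2 ≤ N := by exact_mod_cast hx2
  have hxQ' : N ≤ Q := by exact_mod_cast hxQ
  have hcop : (2 * N₀).Coprime p := by
    have h2 : Nat.Coprime 2 p := (Nat.coprime_primes Nat.prime_two hp).2 hp2.ne
    rcases hN₀ with rfl | rfl
    · exact h2
    · exact Nat.Coprime.mul_left h2 h2
  refine _root_.wieferich_bound ι hp ψ ?_ (B := 4 * Q) hζ ?_ (x := x) (N := N)
    (by rw [hι, hN]; simp) hx2' (by nlinarith) (fun r _ hr => ?_) (by omega) ?_ hpbig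
    (by push_cast; exact_mod_cast hB)
  · intro h hh y hy hlt
    rw [hι] at hlt
    have h1 : ((p ^ (n + 1) : ℕ) : ℤ) ∣ (p : ℤ) ^ (n + 1 - h) * D.nm y := by
      rw [← ZMod.intCast_zmod_eq_zero_iff_dvd]
      have : ((D.nm y : ℤ) : ZMod (p ^ (n + 1))) = ψ y * ψ (D.conj y) := by
        rw [← map_mul, ← D.nm_eq, map_intCast]
      push_cast
      rw [this, ← mul_assoc, hy, zero_mul]
    have h2 : (p : ℤ) ^ h ∣ D.nm y := by
      have h3 : ((p ^ (n + 1) : ℕ) : ℤ) = (p : ℤ) ^ (n + 1 - h) * (p : ℤ) ^ h := by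
        rw [← pow_add, Nat.sub_add_cancel hh]; push_cast; rfl
      rw [h3] at h1
      exact Int.dvd_of_mul_dvd_mul_left (pow_ne_zero _ (by exact_mod_cast hp.ne_zero)) h1
    have h3 : D.nm y < (p : ℤ) ^ h := by exact_mod_cast hlt
    exact D.eq_zero_of_nm_eq_zero (Int.eq_zero_of_dvd_of_nonneg_of_lt (hnn y) h3 h2)
  · refine pow_sub_one_eq_one_of_coprime hp (M := 2 ^ i * (2 * N₀ * M)) (Nat.Coprime.mul_left
      (Nat.Coprime.pow_left _ ((Nat.coprime_primes Nat.prime_two hp).2 hp2.ne))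
      (Nat.Coprime.mul_left hcop hM)) ?_
    have h1 : ψ ζ ^ (2 * N₀) = 1 := by
      rw [← map_pow, mul_comm, pow_mul, hζ]; simp
    have h2 : ψ ω ^ (2 * N₀ * M) = 1 := by rw [mul_comm, pow_mul, hdvd, one_pow]
    rw [hx, map_mul, map_pow, map_pow, mul_pow, ← pow_mul, ← pow_mul,
      show j * (2 * N₀ * M) = 2 * N₀ * (j * M) by ring, pow_mul, h1, one_pow, one_mul] at h2
    exact h2
  · have := Nat.le_of_dvd (by omega) hr
    omega
  · intro e d S hS he hd hne y z hyz
    by_contra hz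
    have hdz : z ∣ y := by
      rw [← IsIntegrallyClosed.pow_dvd_pow_iff two_ne_zero]
      exact ⟨ζ ^ e * x ^ d * ∏ r ∈ S, (r : O), by rw [hyz]; ring⟩
    obtain ⟨w, rfl⟩ := hdz
    have hw : w ^ 2 = ζ ^ e * x ^ d * ∏ r ∈ S, (r : O) := by
      refine mul_left_cancel₀ (pow_ne_zero 2 hz) ?_
      rw [← mul_pow, hyz]; ring
    rcases S.eq_empty_or_nonempty with rfl | ⟨r, hr⟩
    · rw [Finset.prod_empty, mul_one] at hw
      have hsq : IsSquare (ζ ^ e * x ^ d) := ⟨w, by rw [← hw, sq]⟩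
      interval_cases d
      · interval_cases e
        · exact absurd (hne rfl rfl) (by simp)
        · exact hζs (by simpa using hsq)
      · exact hxs e he (by simpa using hsq)
    · have hrB := (hS r hr).2
      have hrp := (hS r hr).1
      have hrN : ¬ (r : ℤ) ∣ N := fun h => by
        have := Nat.le_of_dvd (by omega) (Int.natCast_dvd_natCast.1 h)
        omega
      refine D.sq_ne_mul_prime hrp (by omega) (ω := ω) (w := w) (η := ζ ^ e * x ^ d)
        (k := ∏ s ∈ S.erase r, (s : ℤ)) ?_ ?_ ?_ ?_
      · rw [hQ] at hdisc ⊢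
        intro h
        rw [← dvd_neg] at h
        have := Int.le_of_dvd (by linarith) h
        have h2 : ((4 * Q : ℕ) : ℤ) < r := by exact_mod_cast hrB
        push_cast at h2
        nlinarith [sq_nonneg (D.tr ω)]
      · intro h
        obtain ⟨s, hs, hrs⟩ := ((Nat.prime_iff_prime_int.1 hrp).dvd_finsetProd_iff _).1 h
        have := (Nat.prime_dvd_prime_iff_eq hrp (hS s (Finset.mem_of_mem_erase hs)).1).1
          (Int.natCast_dvd_natCast.1 hrs)
        exact (Finset.ne_of_mem_erase hs) this.symm
      · rw [D.nm_mul, D.nm_pow, D.nm_pow, hζ1, hN, one_pow, one_mul]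
        exact fun h => hrN ((Nat.prime_iff_prime_int.1 hrp).dvd_of_dvd_pow h)
      · rw [hw, ← Finset.mul_prod_erase S _ hr]
        push_cast; ring

end ConjugationData

end QuadraticWieferich

section QuadraticInstance

open QuadraticAlgebra

lemma fact_quadratic_irreducible {q a : ℤ} (ha : a ^ 2 < 4 * q) :
    Fact (∀ r : ℚ, r ^ 2 ≠ ((-q : ℤ) : ℚ) + (a : ℚ) * r) := ⟨fun r hr => by
  have h : (a : ℚ) ^ 2 < 4 * q := by exact_mod_cast ha
  push_cast at hr
  nlinarith [sq_nonneg (2 * r - a)]⟩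

lemma omega_sq_sub_add {b c : ℚ} {q a : ℤ} (hb : b = -q) (hc : c = a) :
    (omega : QuadraticAlgebra ℚ b c) ^ 2 - (a : QuadraticAlgebra ℚ b c) * omega +
      (q : QuadraticAlgebra ℚ b c) = 0 := by
  rw [sq, omega_mul_omega_eq_mk]
  ext
  · simp [hb]
  · simp [hc]

/-- The conjugation on the integral closure of `ℤ` in a quadratic field. -/
noncomputable def quadraticConjugation {b a : ℚ} [Fact (∀ r : ℚ, r ^ 2 ≠ b + a * r)] :
    ConjugationData (integralClosure ℤ (QuadraticAlgebra ℚ b a)) := by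
  have hstar : ∀ x ∈ integralClosure ℤ (QuadraticAlgebra ℚ b a),
      starRingEnd (QuadraticAlgebra ℚ b a) x ∈ integralClosure ℤ (QuadraticAlgebra ℚ b a) :=
    fun x hx => map_isIntegral_int (starRingEnd (QuadraticAlgebra ℚ b a)) hx
  have key : ∀ c : ℚ, IsIntegral ℤ (c : QuadraticAlgebra ℚ b a) → ∃ k : ℤ, (k : ℚ) = c :=
    fun c hc => by
      rw [← eq_ratCast (algebraMap ℚ (QuadraticAlgebra ℚ b a))] at hc
      exact IsIntegrallyClosed.isIntegral_iff.1
        ((isIntegral_algebraMap_iff (algebraMap ℚ (QuadraticAlgebra ℚ b a)).injective).1 hc)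
  have hN : ∀ y : QuadraticAlgebra ℚ b a, ((norm y : ℚ) : QuadraticAlgebra ℚ b a) = y * star y :=
    fun y => algebraMap_norm_eq_mul_star y
  have hT : ∀ y : QuadraticAlgebra ℚ b a, ((trace y : ℚ) : QuadraticAlgebra ℚ b a) = y + star y :=
    fun y => algebraMap_trace_eq_add_star y
  have hnorm : ∀ y : integralClosure ℤ (QuadraticAlgebra ℚ b a), ∃ k : ℤ,
      (k : ℚ) = norm (y : QuadraticAlgebra ℚ b a) := fun y => key _ (by
    rw [hN]
    exact IsIntegral.mul y.2 (hstar _ y.2))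
  have htrace : ∀ y : integralClosure ℤ (QuadraticAlgebra ℚ b a), ∃ k : ℤ,
      (k : ℚ) = trace (y : QuadraticAlgebra ℚ b a) := fun y => key _ (by
    rw [hT]
    exact IsIntegral.add y.2 (hstar _ y.2))
  exact
    { conj := (starRingEnd (QuadraticAlgebra ℚ b a)).restrict _ _ hstar
      nm := fun y => (hnorm y).choose
      tr := fun y => (htrace y).choose
      nm_eq := fun y => by
        ext1
        have h := congrArg (fun c : ℚ => (c : QuadraticAlgebra ℚ b a)) (hnorm y).choose_spec
        simp only [hN, Rat.cast_intCast] at h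
        exact h
      tr_eq := fun y => by
        ext1
        have h := congrArg (fun c : ℚ => (c : QuadraticAlgebra ℚ b a)) (htrace y).choose_spec
        simp only [hT, Rat.cast_intCast] at h
        exact h }

lemma isIntegrallyClosed_quadratic {b a : ℚ} [Fact (∀ r : ℚ, r ^ 2 ≠ b + a * r)] :
    IsIntegrallyClosed (integralClosure ℤ (QuadraticAlgebra ℚ b a)) := by
  have : Module.Finite ℚ (QuadraticAlgebra ℚ b a) := by
    refine ⟨⟨{1, omega}, ?_⟩⟩
    rw [eq_top_iff]
    intro z _
    have : z = z.re • (1 : QuadraticAlgebra ℚ b a) + z.im • omega := by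
      rw [Rat.smul_def, Rat.smul_def]
      ext <;> simp
    rw [this]
    refine Submodule.add_mem _ (Submodule.smul_mem _ _ (Submodule.subset_span ?_))
      (Submodule.smul_mem _ _ (Submodule.subset_span ?_)) <;> simp
  exact integralClosure.isIntegrallyClosedOfFiniteExtension ℚ

lemma quadraticConjugation_nm {b a : ℚ} [Fact (∀ r : ℚ, r ^ 2 ≠ b + a * r)]
    (y : integralClosure ℤ (QuadraticAlgebra ℚ b a)) :
    (quadraticConjugation.nm y : ℚ) = norm (y : QuadraticAlgebra ℚ b a) :=
  Exists.choose_spec (p := fun k : ℤ => (k : ℚ) = norm (y : QuadraticAlgebra ℚ b a)) _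

lemma quadraticConjugation_tr {b a : ℚ} [Fact (∀ r : ℚ, r ^ 2 ≠ b + a * r)]
    (y : integralClosure ℤ (QuadraticAlgebra ℚ b a)) :
    (quadraticConjugation.tr y : ℚ) = trace (y : QuadraticAlgebra ℚ b a) :=
  Exists.choose_spec (p := fun k : ℤ => (k : ℚ) = trace (y : QuadraticAlgebra ℚ b a)) _

lemma exists_complex_embedding {q a : ℤ} (ha : a ^ 2 < 4 * q) :
    ∃ φ : QuadraticAlgebra ℚ ((-q : ℤ) : ℚ) (a : ℚ) →+* ℂ, ∀ z, ‖φ z‖ ^ 2 = ((norm z : ℚ) : ℝ) := by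
  have h0 : (0 : ℝ) ≤ 4 * q - a ^ 2 := by
    have : (a : ℝ) ^ 2 < 4 * q := by exact_mod_cast ha
    linarith
  have hs := Real.sq_sqrt h0
  set s := √(4 * (q : ℝ) - a ^ 2)
  have hα : (⟨a / 2, s / 2⟩ : ℂ) * ⟨a / 2, s / 2⟩ = algebraMap ℚ ℂ ((-q : ℤ) : ℚ) +
      algebraMap ℚ ℂ (a : ℚ) * ⟨a / 2, s / 2⟩ := by
    simp only [eq_ratCast, Rat.cast_intCast]
    apply Complex.ext
    · simp; linear_combination (-1 / 4) * hs
    · simp; ring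
  refine ⟨liftRingHom (algebraMap ℚ ℂ) _ hα, fun z => ?_⟩
  rw [liftRingHom_apply, ← Complex.normSq_eq_norm_sq, Complex.normSq_apply, norm_def]
  simp only [eq_ratCast]
  simp
  linear_combination ((z.im : ℝ) ^ 2 / 4) * hs

/-- The exponent of a split prime in `β ^ M - 1`, for a `p`-adic root `β` of
`x ^ 2 - a x + q` and `M` prime to `p`. -/
theorem wieferich_bound_padic {q a : ℤ} (hq : 2 ≤ q) (ha : a ^ 2 < 4 * q) {p : ℕ}
    [hp : Fact p.Prime] {β : ℤ_[p]} (hβ : β ^ 2 - a * β + q = 0) {n M : ℕ} (hM : M.Coprime p)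
    (hdvd : (p : ℤ_[p]) ^ (n + 1) ∣ β ^ M - 1)
    (hpbig : Real.exp (Real.exp (10 ^ 9)) ≤ p)
    (hB : (4 * q : ℝ) ≤ 4 * Real.log (Real.log p)) :
    (n + 1 : ℝ) ≤ p * Real.exp (-(0.0004 * Real.log p / Real.log (Real.log p))) := by
  have hfact := fact_quadratic_irreducible ha
  have := isIntegrallyClosed_quadratic (b := ((-q : ℤ) : ℚ)) (a := (a : ℚ))
  obtain ⟨φ, hφ⟩ := exists_complex_embedding ha
  have hβ' : (β : ℚ_[p]) * β = algebraMap ℚ ℚ_[p] ((-q : ℤ) : ℚ) +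
      algebraMap ℚ ℚ_[p] (a : ℚ) * β := by
    have h := congrArg (fun x : ℤ_[p] => (x : ℚ_[p])) hβ
    simp only [PadicInt.coe_add, PadicInt.coe_sub, PadicInt.coe_mul, PadicInt.coe_pow,
      PadicInt.coe_intCast, PadicInt.coe_zero] at h
    rw [Int.cast_neg, eq_ratCast, eq_ratCast, Rat.cast_neg, Rat.cast_intCast, Rat.cast_intCast]
    linear_combination h
  set L := liftRingHom (algebraMap ℚ ℚ_[p]) (β : ℚ_[p]) hβ' with hL
  have hintegral : ∀ x ∈ integralClosure ℤ (QuadraticAlgebra ℚ ((-q : ℤ) : ℚ) (a : ℚ)),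
      L x ∈ PadicInt.subring p := by
    intro x hx
    have h1 : IsIntegral ℤ_[p] (L x) := (map_isIntegral_int L hx).tower_top
    obtain ⟨z, hz⟩ := IsIntegrallyClosed.isIntegral_iff.1 h1
    rw [← hz]
    exact z.2
  let L' : integralClosure ℤ (QuadraticAlgebra ℚ ((-q : ℤ) : ℚ) (a : ℚ)) →+* ℤ_[p] :=
    L.restrict _ (PadicInt.subring p) hintegral
  have hω : (omega : QuadraticAlgebra ℚ ((-q : ℤ) : ℚ) (a : ℚ)) ∈
      integralClosure ℤ (QuadraticAlgebra ℚ ((-q : ℤ) : ℚ) (a : ℚ)) := by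
    refine ⟨Polynomial.X ^ 2 - Polynomial.C a * Polynomial.X + Polynomial.C q, by monicity!, ?_⟩
    rw [Polynomial.eval₂_add, Polynomial.eval₂_sub, Polynomial.eval₂_mul, Polynomial.eval₂_pow,
      Polynomial.eval₂_X, Polynomial.eval₂_C, Polynomial.eval₂_C, eq_intCast, eq_intCast]
    exact omega_sq_sub_add (by simp) rfl
  have hL' : L' ⟨omega, hω⟩ = β := by
    apply Subtype.ext
    change L omega = β
    rw [hL, liftRingHom_apply]
    simp
  have hnm : quadraticConjugation.nm ⟨_, hω⟩ = q := by
    have := quadraticConjugation_nm ⟨_, hω⟩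
    rw [norm_def] at this
    simp at this
    exact_mod_cast this
  have htr : quadraticConjugation.tr ⟨_, hω⟩ = a := by
    have := quadraticConjugation_tr ⟨_, hω⟩
    rw [trace_omega] at this
    exact_mod_cast this
  have hdisc : quadraticConjugation.tr ⟨_, hω⟩ ^ 2 < 4 * quadraticConjugation.nm ⟨_, hω⟩ := by
    rw [hnm, htr]; exact ha
  refine ConjugationData.wieferich_bound quadraticConjugation
    (φ.comp (integralClosure ℤ (QuadraticAlgebra ℚ ((-q : ℤ) : ℚ) (a : ℚ))).subtype) ?_ hp.out hM
    ((PadicInt.toZModPow (n + 1)).comp L') hdisc ?_ ?_ hpbig ?_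
  · intro y
    change ‖φ y‖ ^ 2 = _
    rw [hφ, ← quadraticConjugation_nm, Rat.cast_intCast]
  · rw [hnm]; exact hq
  · rw [RingHom.comp_apply, hL', ← map_pow, ← sub_eq_zero, ← map_one (PadicInt.toZModPow (n + 1)),
      ← map_sub, ← RingHom.mem_ker, PadicInt.ker_toZModPow]
    exact Ideal.mem_span_singleton.2 hdvd
  · rw [hnm]; exact hB

end QuadraticInstance

section CyclotomicNorm

open Polynomial

namespace QuadraticAlgebra

lemma omega_quadratic (q a : ℤ) : (omega : QuadraticAlgebra ℤ (-q) a) ^ 2 -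
    (a : QuadraticAlgebra ℤ (-q) a) * omega + (q : QuadraticAlgebra ℤ (-q) a) = 0 := by
  rw [sq, omega_mul_omega_eq_mk]
  ext <;> simp

/-- The evaluation of `ℤ[ω]`, `ω ^ 2 - a ω + q = 0`, at a root of the same polynomial. -/
def evalRoot {q a : ℤ} {W : Type*} [CommRing W] (w : W) (hw : w ^ 2 - a * w + q = 0) :
    QuadraticAlgebra ℤ (-q) a →+* W :=
  liftRingHom (Int.castRingHom W) w (by simp; linear_combination hw)

variable {q a : ℤ} {W : Type*} [CommRing W] {w : W} (hw : w ^ 2 - a * w + q = 0)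

lemma evalRoot_apply (z : QuadraticAlgebra ℤ (-q) a) : evalRoot w hw z = z.re + z.im * w := rfl

lemma evalRoot_omega : evalRoot w hw omega = w := by simp [evalRoot_apply]

lemma evalRoot_aeval (f : ℤ[X]) : evalRoot w hw (aeval omega f) = aeval w f := by
  rw [aeval_def, hom_eval₂, evalRoot_omega, aeval_def]
  congr 1
  exact RingHom.ext_int _ _

lemma root_conj (hw : w ^ 2 - a * w + q = 0) : (a - w) ^ 2 - a * (a - w) + q = 0 := by
  linear_combination hw

lemma evalRoot_norm (z : QuadraticAlgebra ℤ (-q) a) :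
    ((norm z : ℤ) : W) = evalRoot w hw z * evalRoot (a - w) (root_conj hw) z := by
  rw [evalRoot_apply, evalRoot_apply, norm_def]
  push_cast
  linear_combination (z.im : W) ^ 2 * hw

end QuadraticAlgebra

open QuadraticAlgebra

/-- The value `Φₙ(ω)`. -/
noncomputable def cyclotomicValue (q a : ℤ) (n : ℕ) : QuadraticAlgebra ℤ (-q) a :=
  aeval omega (cyclotomic n ℤ)

lemma evalRoot_cyclotomicValue {q a : ℤ} {W : Type*} [CommRing W] {w : W}
    (hw : w ^ 2 - a * w + q = 0) (n : ℕ) :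
    evalRoot w hw (cyclotomicValue q a n) = (cyclotomic n W).eval w := by
  rw [cyclotomicValue, evalRoot_aeval, ← map_cyclotomic_int n W, eval_map, aeval_def]
  congr 1

lemma cyclotomicValue_dvd (q a : ℤ) (n : ℕ) : cyclotomicValue q a n ∣ omega ^ n - 1 := by
  obtain ⟨g, hg⟩ := cyclotomic.dvd_X_pow_sub_one n ℤ
  refine ⟨aeval omega g, ?_⟩
  rw [cyclotomicValue, ← map_mul, ← hg]
  simp

/-- A prime dividing the norm of `Φₙ(ω)` yields a root of `x ^ 2 - a x + q` in characteristic
`p` that is a primitive root of unity of order the prime-to-`p` part of `n`. -/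
lemma exists_primitive_root {q a : ℤ} {p k m : ℕ} [hp : Fact p.Prime] (hm : m.Coprime p)
    (hdvd : (p : ℤ) ∣ norm (cyclotomicValue q a (p ^ k * m))) :
    ∃ r : AlgebraicClosure (ZMod p), r ^ 2 - a * r + q = 0 ∧ IsPrimitiveRoot r m := by
  obtain ⟨w, hw⟩ : ∃ w : AlgebraicClosure (ZMod p), w ^ 2 - a * w + q = 0 := by
    obtain ⟨w, hw⟩ := IsAlgClosed.exists_root
      (X ^ 2 - C (a : AlgebraicClosure (ZMod p)) * X + C (q : AlgebraicClosure (ZMod p))) (by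
        have : (X ^ 2 - C (a : AlgebraicClosure (ZMod p)) * X +
          C (q : AlgebraicClosure (ZMod p))).degree = 2 := by compute_degree!
        rw [this]; norm_num)
    exact ⟨w, by simpa using hw⟩
  have : CharP (AlgebraicClosure (ZMod p)) p := charP_of_injective_algebraMap
    (algebraMap (ZMod p) (AlgebraicClosure (ZMod p))).injective p
  have hne : NeZero (m : AlgebraicClosure (ZMod p)) := ⟨fun h => by
    rw [CharP.cast_eq_zero_iff _ p] at h
    exact hp.out.one_lt.ne' (Nat.eq_one_of_dvd_coprimes hm h dvd_rfl)⟩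
  have h0 : ((norm (cyclotomicValue q a (p ^ k * m)) : ℤ) : AlgebraicClosure (ZMod p)) = 0 :=
    (CharP.intCast_eq_zero_iff _ p _).2 hdvd
  rw [evalRoot_norm hw, evalRoot_cyclotomicValue, evalRoot_cyclotomicValue, mul_eq_zero] at h0
  rcases h0 with h0 | h0
  · exact ⟨w, hw, isRoot_cyclotomic_prime_pow_mul_iff_of_charP.1 h0⟩
  · exact ⟨a - w, root_conj hw, isRoot_cyclotomic_prime_pow_mul_iff_of_charP.1 h0⟩

lemma pow_char_root {q a : ℤ} {p : ℕ} [hp : Fact p.Prime] {F : Type*} [Field F] [CharP F p]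
    {r : F} (hr : r ^ 2 - a * r + q = 0) : r ^ p = r ∨ r ^ p = a - r := by
  have h1 : (r ^ p) ^ 2 - a * r ^ p + q = 0 := by
    have h := congrArg (frobenius F p) hr
    simpa only [map_add, map_sub, map_mul, map_pow, map_intCast, map_zero, frobenius_def] using h
  have h2 : (r ^ p - r) * (r ^ p - (a - r)) = 0 := by linear_combination h1 - hr
  rcases mul_eq_zero.1 h2 with h | h
  · exact Or.inl (sub_eq_zero.1 h)
  · exact Or.inr (sub_eq_zero.1 h)

lemma pow_char_sq_root {q a : ℤ} {p : ℕ} [hp : Fact p.Prime] {F : Type*} [Field F] [CharP F p]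
    {r : F} (hr : r ^ 2 - a * r + q = 0) : r ^ (p ^ 2) = r := by
  rw [sq, pow_mul]
  rcases pow_char_root (p := p) hr with h | h
  · rw [h, h]
  · rw [h]
    have h2 := congrArg (frobenius F p) h
    simp only [map_sub, map_intCast, frobenius_def] at h2
    rw [sub_pow_char, h, ← frobenius_def, map_intCast]; ring

lemma dvd_sq_sub_one {q a : ℤ} {p k m : ℕ} (hp : p.Prime) (hm : m.Coprime p)
    (hdvd : (p : ℤ) ∣ norm (cyclotomicValue q a (p ^ k * m))) : m ∣ p ^ 2 - 1 := by
  have := Fact.mk hp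
  obtain ⟨r, hr, hprim⟩ := exists_primitive_root hm hdvd
  have : CharP (AlgebraicClosure (ZMod p)) p := charP_of_injective_algebraMap
    (algebraMap (ZMod p) (AlgebraicClosure (ZMod p))).injective p
  have hm0 : m ≠ 0 := by
    rintro rfl
    exact hp.one_lt.ne' (by simpa using hm)
  have hr0 : r ≠ 0 := hprim.ne_zero hm0
  apply hprim.dvd_of_pow_eq_one
  apply mul_right_cancel₀ hr0
  rw [← pow_succ, Nat.sub_add_cancel (Nat.one_le_pow _ _ hp.pos), pow_char_sq_root hr, one_mul]

end CyclotomicNorm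

section SplitPrimes

open QuadraticAlgebra Polynomial

lemma Prime.pow_succ_dvd_or_of_pow_dvd_mul {R : Type*} [CommRing R] [IsDomain R] {π : R}
    (hπ : Prime π) {x y : R} {v : ℕ} (h : π ^ (2 * v + 1) ∣ x * y) :
    π ^ (v + 1) ∣ x ∨ π ^ (v + 1) ∣ y := by
  by_contra! hc
  rw [← emultiplicity_lt_iff_not_dvd, ← emultiplicity_lt_iff_not_dvd] at hc
  rw [pow_dvd_iff_le_emultiplicity, emultiplicity_mul hπ] at h
  obtain ⟨i, hi⟩ := ENat.ne_top_iff_exists.1 (ne_top_of_lt hc.1)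
  obtain ⟨j, hj⟩ := ENat.ne_top_iff_exists.1 (ne_top_of_lt hc.2)
  rw [← hi, ← hj] at h
  rw [← hi, ← hj] at hc
  norm_cast at h hc
  omega

lemma exists_padic_root {q a b : ℤ} {p : ℕ} [Fact p.Prime] (hΔ : ¬ (p : ℤ) ∣ a ^ 2 - 4 * q)
    (hb : (p : ℤ) ∣ b ^ 2 - a * b + q) : ∃ β : ℤ_[p], β ^ 2 - a * β + q = 0 := by
  have hd : ‖((2 * b - a : ℤ) : ℤ_[p])‖ = 1 := by
    refine le_antisymm (PadicInt.norm_le_one _) (not_lt.1 fun h => hΔ ?_)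
    rw [PadicInt.norm_int_lt_one_iff_dvd] at h
    have h1 := dvd_sub (h.mul_right (2 * b - a)) (hb.mul_left 4)
    have h2 : (2 * b - a) * (2 * b - a) - 4 * (b ^ 2 - a * b + q) = a ^ 2 - 4 * q := by ring
    rwa [h2] at h1
  obtain ⟨β, hβ, -⟩ := hensels_lemma (p := p) (R := ℤ) (F := X ^ 2 - C a * X + C q)
    (a := (b : ℤ_[p])) (by
      have h1 : aeval (b : ℤ_[p]) (derivative (X ^ 2 - C a * X + C q)) =
          ((2 * b - a : ℤ) : ℤ_[p]) := by
        simpa using Or.inl (map_ofNat (aeval (b : ℤ_[p])) 2)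
      have h2 : aeval (b : ℤ_[p]) (X ^ 2 - C a * X + C q) =
          ((b ^ 2 - a * b + q : ℤ) : ℤ_[p]) := by simp
      rw [h1, h2, hd, one_pow]
      exact (PadicInt.norm_int_lt_one_iff_dvd _).2 hb)
  exact ⟨β, by simpa using hβ⟩

/-- The exponent of a split prime, not dividing `n`, in the norm of `Φₙ(ω)`. -/
lemma split_bound {q a b : ℤ} (hq : 2 ≤ q) (ha : a ^ 2 < 4 * q) {p n v : ℕ} (hp : p.Prime)
    (hn : n.Coprime p) (hΔ : ¬ (p : ℤ) ∣ a ^ 2 - 4 * q) (hb : (p : ℤ) ∣ b ^ 2 - a * b + q)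
    (hv : (p : ℤ) ^ (2 * v + 1) ∣ norm (cyclotomicValue q a n))
    (hpbig : Real.exp (Real.exp (10 ^ 9)) ≤ p)
    (hB : (4 * q : ℝ) ≤ 4 * Real.log (Real.log p)) :
    (v + 1 : ℝ) ≤ p * Real.exp (-(0.0004 * Real.log p / Real.log (Real.log p))) := by
  have := Fact.mk hp
  obtain ⟨β, hβ⟩ := exists_padic_root hΔ hb
  have h1 := map_dvd (Int.castRingHom ℤ_[p]) hv
  rw [eq_intCast, eq_intCast, evalRoot_norm hβ, Int.cast_pow, Int.cast_natCast] at h1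
  have hroot : ∀ γ : ℤ_[p], ∀ hγ : γ ^ 2 - a * γ + q = 0,
      (p : ℤ_[p]) ^ (v + 1) ∣ evalRoot γ hγ (cyclotomicValue q a n) →
      (v + 1 : ℝ) ≤ p * Real.exp (-(0.0004 * Real.log p / Real.log (Real.log p))) := by
    intro γ hγ h
    refine wieferich_bound_padic hq ha hγ hn (h.trans ?_) hpbig hB
    have := map_dvd (evalRoot γ hγ) (cyclotomicValue_dvd q a n)
    rwa [map_sub, map_pow, evalRoot_omega, map_one] at this
  rcases PadicInt.prime_p.pow_succ_dvd_or_of_pow_dvd_mul h1 with h | h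
  · exact hroot _ _ h
  · exact hroot _ _ h

/-- The exponent of any prime not dividing `n` in the norm of `Φₙ(ω)`, when `ω` is the product of
a real number and a root of unity. -/
lemma degenerate_bound {q a : ℤ} (hq : 2 ≤ q)
    (hdeg : (omega : QuadraticAlgebra ℤ (-q) a) ^ 24 = (q : QuadraticAlgebra ℤ (-q) a) ^ 12)
    {p n v : ℕ} (hp : p.Prime) (hn : n.Coprime p)
    (hv : (p : ℤ) ^ (2 * v + 1) ∣ norm (cyclotomicValue q a n))
    (hpbig : Real.exp (Real.exp (10 ^ 9)) ≤ p)
    (hB : (4 * q : ℝ) ≤ 4 * Real.log (Real.log p)) :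
    (v + 1 : ℝ) ≤ p * Real.exp (-(0.0004 * Real.log p / Real.log (Real.log p))) := by
  have hp5 : 5 ≤ p := by
    have h1 := Real.add_one_le_exp (Real.exp (10 ^ 9))
    have h2 := Real.add_one_le_exp (10 ^ 9 : ℝ)
    have : (5 : ℝ) ≤ p := by linarith
    exact_mod_cast this
  have h1 : cyclotomicValue q a n ∣ ((q ^ (12 * n) - 1 : ℤ) : QuadraticAlgebra ℤ (-q) a) := by
    refine (cyclotomicValue_dvd q a n).trans ?_
    have h := sub_dvd_pow_sub_pow (omega ^ n : QuadraticAlgebra ℤ (-q) a) 1 24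
    rw [one_pow, ← pow_mul, mul_comm, pow_mul, hdeg, ← pow_mul] at h
    exact_mod_cast h
  have h2 : (p : ℤ) ^ (2 * v + 1) ∣ (q ^ (12 * n) - 1) * (q ^ (12 * n) - 1) := by
    have h := map_dvd QuadraticAlgebra.norm h1
    rw [norm_intCast, Int.cast_id] at h
    rw [← sq]
    exact hv.trans h
  have h3 : (p : ℤ) ^ (v + 1) ∣ q ^ (12 * n) - 1 := by
    rcases (Nat.prime_iff_prime_int.1 hp).pow_succ_dvd_or_of_pow_dvd_mul h2 with h | h <;> exact h
  obtain ⟨Q, rfl⟩ := Int.eq_ofNat_of_zero_le (by omega : 0 ≤ q)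
  refine wieferich_bound_int hp (M := 12 * n) (Q := Q) (Nat.Coprime.mul_left ?_ hn)
    (by omega) ?_ hpbig (by exact_mod_cast hB)
  · rw [show 12 = 2 * 2 * 3 by norm_num]
    have h2 := (Nat.coprime_primes Nat.prime_two hp).2 (by omega)
    have h3 := (Nat.coprime_primes Nat.prime_three hp).2 (by omega)
    exact Nat.Coprime.mul_left (Nat.Coprime.mul_left h2 h2) h3
  · have h4 : (((Q : ℤ) ^ (12 * n) - 1 : ℤ) : ZMod (p ^ (v + 1))) = 0 := by
      rw [ZMod.intCast_zmod_eq_zero_iff_dvd]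
      exact_mod_cast h3
    push_cast at h4
    exact sub_eq_zero.1 h4

end SplitPrimes

section RamifiedPrimes

open QuadraticAlgebra Polynomial

lemma exists_geom_sum_one_add {R : Type*} [CommRing R] {p : ℕ} (hp : p.Prime) (δ : R) :
    ∃ s : R, ∑ i ∈ Finset.range p, (1 + δ) ^ i = δ ^ (p - 1) + p * (1 + δ * s) := by
  have h1 := congrArg (eval δ) (geom_sum_X_comp_X_add_one_eq_sum (R := R) p)
  simp only [eval_comp, eval_finsetSum, eval_mul, eval_pow, eval_X, eval_natCast, eval_add,
    eval_one] at h1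
  rw [add_comm 1 δ, h1]
  obtain ⟨r, rfl⟩ : ∃ r, p = r + 2 := ⟨p - 2, by have := hp.two_le; omega⟩
  have h2 : δ * ((r + 2 : ℕ) : R) ∣
      ∑ i ∈ Finset.range r, ((r + 2).choose (i + 1 + 1) : R) * δ ^ (i + 1) := by
    refine Finset.dvd_sum fun i hi => ?_
    rw [Finset.mem_range] at hi
    obtain ⟨c, hc⟩ := hp.dvd_choose_self (k := i + 1 + 1) (by omega) (by omega)
    rw [hc]
    exact ⟨c * δ ^ i, by push_cast; ring⟩
  obtain ⟨s, hs⟩ := h2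
  refine ⟨s, ?_⟩
  rw [Finset.sum_range_succ, Finset.sum_range_succ', hs]
  simp
  ring

lemma prime_cast_eq_zero_of_geom_sum {R : Type*} [CommRing R] {p : ℕ} (hp : p.Prime)
    (hp2 : (p : R) ^ 2 = 0) {δ u : R} (hδ : δ ^ 2 = p * u)
    (h : ∑ i ∈ Finset.range p, (1 + δ) ^ i = 0) (hor : 5 ≤ p ∨ δ = 0) : (p : R) = 0 := by
  rcases hor with h5 | rfl
  · obtain ⟨s, hs⟩ := exists_geom_sum_one_add hp δ
    have h4 : δ ^ 4 = 0 := by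
      linear_combination (δ ^ 2 + p * u) * hδ + u ^ 2 * hp2
    have h3 : δ ^ (p - 1) = 0 := pow_eq_zero_of_le (by omega) h4
    rw [h, h3, zero_add] at hs
    have hun : IsUnit (1 + δ * s) :=
      IsNilpotent.isUnit_one_add ((Commute.all _ _).isNilpotent_mul_right ⟨4, h4⟩)
    exact (hun.mul_left_eq_zero).1 hs.symm
  · simpa using h

lemma one_add_pow_prime_pow_eq_one {R : Type*} [CommRing R] {p : ℕ} (hp : p.Prime)
    (hp2 : (p : R) ^ 2 = 0) {η u : R} (hη : η ^ 2 = p * u) {j : ℕ} (hj : 2 ≤ j) :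
    (1 + η) ^ p ^ j = 1 := by
  obtain ⟨i, rfl⟩ := Nat.exists_eq_add_of_le hj
  obtain ⟨r, hr⟩ := exists_add_pow_prime_eq hp 1 η
  obtain ⟨l, hl⟩ := Nat.exists_eq_add_of_le hp.two_le
  have h1 : (1 + η) ^ p = 1 + p * (u * η ^ l + η * r) := by
    rw [hr, one_pow]
    conv_lhs => rw [hl, pow_add η, hη, ← hl]
    ring
  obtain ⟨s, hs⟩ := exists_add_pow_prime_eq hp 1 (p * (u * η ^ l + η * r))
  have h2 : ((p : R) * (u * η ^ l + η * r)) ^ p = 0 := by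
    rw [mul_pow, pow_eq_zero_of_le hp.two_le hp2, zero_mul]
  rw [pow_add, pow_mul, sq, pow_mul, h1, hs, h2]
  have : (1 : R) ^ p + 0 + p * 1 * (p * (u * η ^ l + η * r)) * s = 1 := by
    rw [one_pow]
    linear_combination (u * η ^ l + η * r) * s * hp2
  rw [this, one_pow]

lemma isUnit_intCast_of_not_dvd {R : Type*} [CommRing R] {p : ℕ} (hp : p.Prime)
    (hnil : IsNilpotent (p : R)) {t : ℤ} (ht : ¬ (p : ℤ) ∣ t) : IsUnit (t : R) := by
  obtain ⟨x, y, hxy⟩ := (Nat.prime_iff_prime_int.1 hp).coprime_iff_not_dvd.2 ht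
  have h : (x : R) * p + y * t = 1 := by exact_mod_cast congrArg (Int.cast (R := R)) hxy
  have hu : IsUnit ((y : R) * t) := by
    rw [← sub_eq_iff_eq_add'.2 h.symm]
    exact IsNilpotent.isUnit_one_sub ((Commute.all _ _).isNilpotent_mul_left hnil)
  exact isUnit_of_mul_isUnit_right hu

lemma exists_sq_eq_prime_mul {R : Type*} [CommRing R] {p : ℕ} (hp : p.Prime)
    (hnil : IsNilpotent (p : R)) {η : R} (hη : IsNilpotent η) {t N : ℤ}
    (h : η ^ 2 = t * η - N) : ∃ u : R, η ^ 2 = p * u := by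
  have hchar : η * (t - η) = N := by linear_combination -h
  by_cases hN : (p : ℤ) ∣ N
  · obtain ⟨N', rfl⟩ := hN
    by_cases ht : (p : ℤ) ∣ t
    · obtain ⟨t', rfl⟩ := ht
      exact ⟨t' * η - N', by rw [h]; push_cast; ring⟩
    · obtain ⟨w, hw⟩ := hη.neg.isUnit_add_left_of_commute
        (isUnit_intCast_of_not_dvd hp hnil ht) (Commute.all _ _)
      refine ⟨N' * ↑w⁻¹ * η, ?_⟩
      have h2 : η * (w : R) = p * N' := by rw [hw, ← sub_eq_add_neg, hchar]; push_cast; ring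
      linear_combination ↑w⁻¹ * η * h2 - η ^ 2 * w.mul_inv
  · have hu : IsUnit η := by
      refine isUnit_of_mul_isUnit_left (y := (t : R) - η) ?_
      rw [hchar]
      exact isUnit_intCast_of_not_dvd hp hnil hN
    have h1 : (1 : R) = 0 := by
      obtain ⟨e, he⟩ := hη
      exact ((hu.pow e).mul_left_eq_zero).1 (by rw [he, mul_zero])
    exact ⟨0, by rw [← one_mul (η ^ 2), h1]; simp⟩

lemma prime_dvd_cyclotomic_sub_pow {p k m : ℕ} (hp : p.Prime) (hm : ¬ p ∣ m) (hk : 0 < k) :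
    C (p : ℤ) ∣ cyclotomic (p ^ k * m) ℤ - cyclotomic m ℤ ^ (p ^ k - p ^ (k - 1)) := by
  have := Fact.mk hp
  have h : map (Int.castRingHom (ZMod p))
      (cyclotomic (p ^ k * m) ℤ - cyclotomic m ℤ ^ (p ^ k - p ^ (k - 1))) = 0 := by
    rw [Polynomial.map_sub, Polynomial.map_pow, map_cyclotomic, map_cyclotomic,
      cyclotomic_mul_prime_pow_eq _ hm hk, sub_self]
  rw [C_dvd_iff_dvd_coeff]
  intro i
  rw [← ZMod.intCast_zmod_eq_zero_iff_dvd, ← eq_intCast (Int.castRingHom (ZMod p)), ← coeff_map, h,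
    coeff_zero]

lemma cyclotomic_dvd_geom_sum {p d : ℕ} (hp : 1 < p) (hd : 0 < d) :
    cyclotomic (d * p) ℤ ∣ ∑ i ∈ Finset.range p, ((X : ℤ[X]) ^ d) ^ i := by
  have h := X_pow_sub_one_mul_cyclotomic_dvd_X_pow_sub_one_of_dvd ℤ (d := d) (n := d * p)
    (Nat.mem_properDivisors.2 ⟨dvd_mul_right _ _, by nlinarith⟩)
  rw [pow_mul, ← mul_geom_sum ((X : ℤ[X]) ^ d)] at h
  refine (mul_dvd_mul_iff_left ?_).1 h
  exact (monic_X_pow_sub_C (1 : ℤ) hd.ne').ne_zero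

lemma sq_eq_trace_mul_sub_norm {q a : ℤ} (z : QuadraticAlgebra ℤ (-q) a) :
    z ^ 2 = ((2 * z.re + a * z.im : ℤ) : QuadraticAlgebra ℤ (-q) a) * z -
      ((QuadraticAlgebra.norm z : ℤ) : QuadraticAlgebra ℤ (-q) a) := by
  rw [sq, norm_def]
  ext
  · simp only [re_mul, re_sub, re_intCast, im_intCast]; simp; ring
  · simp only [im_mul, im_sub, re_intCast, im_intCast]; simp; ring

lemma not_prime_dvd_norm_one_sub {q a : ℤ} {p : ℕ} (hp : p.Prime)
    (t : QuadraticAlgebra ℤ (-q) a) :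
    ¬ (p : ℤ) ∣ QuadraticAlgebra.norm (1 - (p : QuadraticAlgebra ℤ (-q) a) * t) := by
  intro h
  rw [norm_def] at h
  simp only [re_sub, im_sub, re_mul, im_mul, re_one, im_one, re_natCast, im_natCast] at h
  refine (Nat.prime_iff_prime_int.1 hp).not_dvd_one ((Int.dvd_iff_dvd_of_dvd_sub ?_).1 h)
  exact ⟨p * t.re ^ 2 - 2 * t.re - a * t.im + a * p * t.re * t.im + q * p * t.im ^ 2, by ring⟩

/-- A prime dividing `n` divides the norm of `Φₙ(ω)` at most twice. -/
lemma not_prime_pow_three_dvd {q a : ℤ} {p k m : ℕ} (hp : p.Prime) (hm : ¬ p ∣ m) (hm0 : 0 < m)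
    (hk : 0 < k) (hor : 5 ≤ p ∨ 3 ≤ k) :
    ¬ (p : ℤ) ^ 3 ∣ norm (cyclotomicValue q a (p ^ k * m)) := by
  intro hdvd
  set y := cyclotomicValue q a (p ^ k * m) with hy
  set I : Ideal (QuadraticAlgebra ℤ (-q) a) :=
    Ideal.span {y, (p : QuadraticAlgebra ℤ (-q) a) ^ 2} with hI
  set π := Ideal.Quotient.mk I
  have hπy : π y = 0 := Ideal.Quotient.eq_zero_iff_mem.2 (Ideal.subset_span (by simp))
  have hp2 : (p : QuadraticAlgebra ℤ (-q) a ⧸ I) ^ 2 = 0 := by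
    have := Ideal.Quotient.eq_zero_iff_mem.2
      (Ideal.subset_span (by simp) : (p : QuadraticAlgebra ℤ (-q) a) ^ 2 ∈ I)
    simpa using this
  have hev : ∀ f : ℤ[X], π (aeval omega f) = aeval (π omega) f := fun f => by
    rw [aeval_def, hom_eval₂, aeval_def]
    congr 1
  have hy0 : aeval (π omega) (cyclotomic (p ^ k * m) ℤ) = 0 := by
    rw [← hev]; exact hπy
  set η := π (omega ^ m - 1) with hη
  have hηnil : IsNilpotent η := by
    obtain ⟨g, hg⟩ := prime_dvd_cyclotomic_sub_pow hp hm hk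
    have h1 := congrArg (aeval (π omega)) hg
    rw [map_sub, hy0, map_pow, map_mul, aeval_C, zero_sub] at h1
    have h2 : IsNilpotent (aeval (π omega) (cyclotomic m ℤ)) := by
      refine IsNilpotent.of_pow (m := p ^ k - p ^ (k - 1)) ?_
      rw [← neg_neg (_ ^ _), h1]
      refine (IsNilpotent.neg ((Commute.all _ _).isNilpotent_mul_right ⟨2, ?_⟩))
      simpa using hp2
    obtain ⟨g, hg⟩ := cyclotomicValue_dvd q a m
    rw [hη, hg, map_mul, cyclotomicValue, hev]
    exact (Commute.all _ _).isNilpotent_mul_right h2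
  obtain ⟨u, hu⟩ : ∃ u, η ^ 2 = p * u := by
    refine exists_sq_eq_prime_mul hp ⟨2, hp2⟩ hηnil
      (t := 2 * (omega ^ m - 1 : QuadraticAlgebra ℤ (-q) a).re +
        a * (omega ^ m - 1 : QuadraticAlgebra ℤ (-q) a).im)
      (N := QuadraticAlgebra.norm (omega ^ m - 1 : QuadraticAlgebra ℤ (-q) a)) ?_
    have h : ∀ z : QuadraticAlgebra ℤ (-q) a, π z ^ 2 =
        ((2 * z.re + a * z.im : ℤ) : QuadraticAlgebra ℤ (-q) a ⧸ I) * π z -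
          ((QuadraticAlgebra.norm z : ℤ) : QuadraticAlgebra ℤ (-q) a ⧸ I) := fun z => by
      rw [← map_pow, sq_eq_trace_mul_sub_norm, map_sub, map_mul, map_intCast, map_intCast]
    exact h _
  have hδ : ∃ s, (π omega) ^ (p ^ (k - 1) * m) - 1 = η * s := by
    have h := sub_dvd_pow_sub_pow (π omega ^ m) 1 (p ^ (k - 1))
    rw [one_pow, ← pow_mul, mul_comm m] at h
    simpa [hη, Dvd.dvd] using h
  obtain ⟨s, hs⟩ := hδ
  have hnd : p ^ k * m = p ^ (k - 1) * m * p := by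
    obtain ⟨j, rfl⟩ := Nat.exists_eq_add_of_lt hk
    simp [pow_succ]; ring
  have hp0 : (p : QuadraticAlgebra ℤ (-q) a ⧸ I) = 0 := by
    refine prime_cast_eq_zero_of_geom_sum hp hp2 (δ := η * s) (u := u * s ^ 2)
      (by rw [mul_pow, hu, mul_assoc]) ?_ ?_
    · rw [← hs, add_sub_cancel]
      obtain ⟨g, hg⟩ := cyclotomic_dvd_geom_sum (d := p ^ (k - 1) * m) hp.one_lt
        (Nat.mul_pos (pow_pos hp.pos _) hm0)
      have h := congrArg (aeval (π omega)) hg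
      rw [← hnd, map_mul, hy0, zero_mul] at h
      simpa using h
    · refine hor.imp id fun hk3 => ?_
      have h := one_add_pow_prime_pow_eq_one hp hp2 hu (j := k - 1) (by omega)
      rw [← hs, mul_comm, pow_mul]
      rw [hη] at h
      simp only [map_sub, map_pow, map_one, add_sub_cancel] at h
      rw [h, sub_self]
  have hmem : (p : QuadraticAlgebra ℤ (-q) a) ∈ I := by
    rw [← Ideal.Quotient.eq_zero_iff_mem]; simpa using hp0
  obtain ⟨z, t, hzt⟩ := Ideal.mem_span_pair.1 hmem
  have h1 : z * y = p * (1 - p * t) := by linear_combination hzt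
  have h2 := congrArg QuadraticAlgebra.norm h1
  rw [map_mul, map_mul] at h2
  have h3 : QuadraticAlgebra.norm (p : QuadraticAlgebra ℤ (-q) a) = (p : ℤ) ^ 2 := norm_natCast _
  rw [h3] at h2
  have h4 : (p : ℤ) ^ 2 * p ∣ (p : ℤ) ^ 2 *
      QuadraticAlgebra.norm (1 - (p : QuadraticAlgebra ℤ (-q) a) * t) := by
    rw [← h2, ← pow_succ]; exact hdvd.mul_left _
  exact not_prime_dvd_norm_one_sub hp t
    ((mul_dvd_mul_iff_left (pow_ne_zero 2 (by exact_mod_cast hp.ne_zero))).1 h4)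

end RamifiedPrimes

section InertPrimes

open QuadraticAlgebra Polynomial

lemma charP_algebraicClosure_zmod (p : ℕ) [Fact p.Prime] :
    CharP (AlgebraicClosure (ZMod p)) p :=
  charP_of_injective_algebraMap (algebraMap (ZMod p) (AlgebraicClosure (ZMod p))).injective p

lemma dvd_sub_one_of_pow_char_eq {F : Type*} [Field F] {p n : ℕ} {r s : F} (hp : p.Prime)
    (hs : s ^ p = s) (hs0 : s ≠ 0) {e : ℕ} (hrs : r ^ e = s) (hr : IsPrimitiveRoot r n) :
    n ∣ e * (p - 1) := by
  apply hr.dvd_of_pow_eq_one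
  apply mul_right_cancel₀ hs0
  rw [pow_mul, hrs, ← pow_succ, Nat.sub_add_cancel hp.one_lt.le, hs, one_mul]

lemma exists_int_root_of_pow_char_eq {q a : ℤ} {p : ℕ} [Fact p.Prime] {F : Type*} [Field F]
    [CharP F p] {r : F} (hr : r ^ 2 - a * r + q = 0) (hrp : r ^ p = r) :
    ∃ b : ℤ, (p : ℤ) ∣ b ^ 2 - a * b + q := by
  have hmem := (Subfield.mem_bot_iff_pow_eq_self (F := F) (p := p)).2 hrp
  obtain ⟨b, hb⟩ : ∃ b : ℤ, (b : F) = r := by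
    obtain ⟨z, hz⟩ := (bot_le : (⊥ : Subfield F) ≤ (ZMod.castHom dvd_rfl F).fieldRange) hmem
    obtain ⟨b, rfl⟩ := ZMod.intCast_surjective z
    exact ⟨b, by simpa using hz⟩
  refine ⟨b, (CharP.intCast_eq_zero_iff F p _).1 ?_⟩
  push_cast
  rw [hb, hr]

/-- A prime not dividing `n` but dividing the norm of `Φₙ(ω)` is either congruent to `1`
modulo `n` and split, or inert. -/
lemma split_or_inert {q a : ℤ} {p n : ℕ} [Fact p.Prime] (hn : n.Coprime p)
    (hdvd : (p : ℤ) ∣ QuadraticAlgebra.norm (cyclotomicValue q a n)) :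
    ((∃ b : ℤ, (p : ℤ) ∣ b ^ 2 - a * b + q) ∧ n ∣ p - 1) ∨
      ((∀ b : ℤ, ¬ (p : ℤ) ∣ b ^ 2 - a * b + q) ∧ ∃ r : AlgebraicClosure (ZMod p),
        r ^ 2 - a * r + q = 0 ∧ r ^ p = a - r) := by
  have hp : p.Prime := Fact.out
  have := charP_algebraicClosure_zmod p
  obtain ⟨r, hr, hprim⟩ := exists_primitive_root (k := 0) hn (by simpa using hdvd)
  have hn0 : n ≠ 0 := by
    rintro rfl
    exact hp.one_lt.ne' (by simpa using hn)
  by_cases hrp : r ^ p = r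
  · refine Or.inl ⟨exists_int_root_of_pow_char_eq hr hrp, ?_⟩
    simpa using dvd_sub_one_of_pow_char_eq hp hrp (hprim.ne_zero hn0) (pow_one r) hprim
  · refine Or.inr ⟨fun b hb => hrp ?_, r, hr, (pow_char_root (p := p) hr).resolve_left hrp⟩
    have hb0 : ((b ^ 2 - a * b + q : ℤ) : AlgebraicClosure (ZMod p)) = 0 :=
      (CharP.intCast_eq_zero_iff _ p _).2 hb
    push_cast at hb0
    have h : (r - b) * (r - (a - b)) = 0 := by linear_combination hr - hb0
    have hz : ∀ c : ℤ, (c : AlgebraicClosure (ZMod p)) ^ p = c := fun c => by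
      rw [← frobenius_def, map_intCast]
    rcases mul_eq_zero.1 h with h | h
    · rw [sub_eq_zero.1 h, hz]
    · have h2 := hz (a - b)
      push_cast at h2
      rw [sub_eq_zero.1 h, h2]

lemma dvd_of_degenerate {q a : ℤ} {p n : ℕ} (hp : p.Prime) (hn : n.Coprime p)
    (hdvd : (p : ℤ) ∣ QuadraticAlgebra.norm (cyclotomicValue q a n))
    (hdeg : (omega : QuadraticAlgebra ℤ (-q) a) ^ 24 = (q : QuadraticAlgebra ℤ (-q) a) ^ 12) :
    n ∣ 24 * (p - 1) := by
  have := Fact.mk hp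
  have := charP_algebraicClosure_zmod p
  obtain ⟨r, hr, hprim⟩ := exists_primitive_root (k := 0) hn (by simpa using hdvd)
  have hn0 : n ≠ 0 := by
    rintro rfl
    exact hp.one_lt.ne' (by simpa using hn)
  have h1 := congrArg (evalRoot r hr) hdeg
  rw [map_pow, map_pow, evalRoot_omega, map_intCast] at h1
  refine dvd_sub_one_of_pow_char_eq hp ?_ ?_ h1 hprim
  · rw [← frobenius_def, map_pow, map_intCast]
  · rw [← h1]
    exact pow_ne_zero _ (hprim.ne_zero hn0)

lemma prime_dvd_of_dvd_norm {q a : ℤ} {p : ℕ} (hp : p.Prime)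
    (hin : ∀ b : ℤ, ¬ (p : ℤ) ∣ b ^ 2 - a * b + q) {z : QuadraticAlgebra ℤ (-q) a}
    (h : (p : ℤ) ∣ QuadraticAlgebra.norm z) : (p : QuadraticAlgebra ℤ (-q) a) ∣ z := by
  have hp' := Nat.prime_iff_prime_int.1 hp
  rw [norm_def] at h
  have him : (p : ℤ) ∣ z.im := by
    by_contra him
    obtain ⟨x, y, hxy⟩ := hp'.coprime_iff_not_dvd.2 him
    refine hin (-(z.re * y)) ?_
    have e : (-(z.re * y)) ^ 2 - a * (-(z.re * y)) + q =
        y ^ 2 * (z.re * z.re + a * z.re * z.im - -q * z.im * z.im) +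
        p * (x * (a * z.re * y + q * (1 + y * z.im))) := by
      linear_combination (-(a * z.re * y + q * (1 + y * z.im))) * hxy
    rw [e]
    exact dvd_add (h.mul_left _) (dvd_mul_right _ _)
  obtain ⟨c, hc⟩ := him
  have hre : (p : ℤ) ∣ z.re := by
    have : (p : ℤ) ∣ z.re * z.re := by
      have h2 := dvd_sub h (dvd_mul_right (p : ℤ) (a * z.re * c + q * c * z.im))
      have e : z.re * z.re + a * z.re * z.im - -q * z.im * z.im -
          p * (a * z.re * c + q * c * z.im) = z.re * z.re := by
        rw [hc]; ring
      rwa [e] at h2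
    rcases hp'.dvd_or_dvd this with h | h <;> exact h
  obtain ⟨b, hb⟩ := hre
  refine ⟨⟨b, c⟩, ?_⟩
  ext <;> simp [hb, hc]

lemma prime_pow_dvd_of_dvd_norm {q a : ℤ} {p : ℕ} (hp : p.Prime)
    (hin : ∀ b : ℤ, ¬ (p : ℤ) ∣ b ^ 2 - a * b + q) (w : ℕ) :
    ∀ z : QuadraticAlgebra ℤ (-q) a, (p : ℤ) ^ (2 * w - 1) ∣ QuadraticAlgebra.norm z →
      (p : QuadraticAlgebra ℤ (-q) a) ^ w ∣ z := by
  induction w with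
  | zero => simp
  | succ w ih =>
    intro z hz
    obtain ⟨y, rfl⟩ := prime_dvd_of_dvd_norm hp hin ((dvd_pow_self _ (by omega)).trans hz)
    rw [pow_succ']
    refine mul_dvd_mul_left _ (ih y ?_)
    have h3 : QuadraticAlgebra.norm (p : QuadraticAlgebra ℤ (-q) a) = (p : ℤ) ^ 2 :=
      norm_natCast _
    rw [map_mul, h3] at hz
    rcases Nat.eq_zero_or_pos w with rfl | hw
    · simp
    · rw [show 2 * (w + 1) - 1 = 2 + (2 * w - 1) by omega, pow_add] at hz
      exact (mul_dvd_mul_iff_left (pow_ne_zero 2 (by exact_mod_cast hp.ne_zero))).1 hz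

/-- A common multiple of the quantities `q ^ d - 1` and `ω ^ d - ω' ^ d`. -/
noncomputable def conjDefect (q a : ℤ) (d : ℕ) : QuadraticAlgebra ℤ (-q) a :=
  ((q : QuadraticAlgebra ℤ (-q) a) ^ d - 1) *
    (omega ^ d - ((a : QuadraticAlgebra ℤ (-q) a) - omega) ^ d)

lemma pow_gcd_eq_of_pow_eq {R : Type*} [CommRing R] {u v : R} (hu : IsUnit u) (hv : IsUnit v)
    {m n : ℕ} (hm : u ^ m = v ^ m) (hn : u ^ n = v ^ n) : u ^ m.gcd n = v ^ m.gcd n := by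
  obtain ⟨u, rfl⟩ := hu
  obtain ⟨v, rfl⟩ := hv
  have key : ∀ k : ℕ, ((u : R) ^ k = (v : R) ^ k) ↔ (u / v) ^ k = 1 := fun k => by
    rw [div_pow, div_eq_one, ← Units.val_inj, Units.val_pow_eq_pow_val, Units.val_pow_eq_pow_val]
  rw [key] at *
  exact pow_gcd_eq_one.2 ⟨hm, hn⟩

lemma gcd_pow_mul_of_coprime {p n P e : ℕ} (hn : n.Coprime p) (i : ℕ) (hP : P = p ^ i) :
    n.gcd (P * e) = n.gcd e := by
  subst hP
  exact Nat.Coprime.gcd_mul_left_cancel_right _ (hn.pow_right i).symm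

/-- The identities satisfied by conjugate `n`-th roots of unity modulo a power of an inert
prime. -/
lemma pow_gcd_of_frobenius {R : Type*} [CommRing R] {p n i : ℕ} (hp : 1 ≤ p) (hn : n.Coprime p)
    (hn0 : n ≠ 0) {u v : R} (hu : u ^ n = 1) (hv : v ^ n = 1) (huv : u ^ (p * p ^ i) = v ^ p ^ i)
    (hvu : v ^ (p * p ^ i) = u ^ p ^ i) :
    (u * v) ^ n.gcd (p - 1) = 1 ∧ u ^ n.gcd (p + 1) = v ^ n.gcd (p + 1) := by
  have hu' : IsUnit u := IsUnit.of_pow_eq_one hu hn0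
  have hv' : IsUnit v := IsUnit.of_pow_eq_one hv hn0
  constructor
  · rw [← gcd_pow_mul_of_coprime hn i rfl]
    refine Eq.trans (b := 1 ^ n.gcd (p ^ i * (p - 1))) ?_ (one_pow _)
    refine pow_gcd_eq_of_pow_eq (hu'.mul hv') isUnit_one (by rw [mul_pow, hu, hv, one_pow, one_mul])
      ?_
    refine (hu'.mul hv').pow (p ^ i) |>.mul_right_cancel ?_
    rw [← pow_add, show p ^ i * (p - 1) + p ^ i = p * p ^ i by
      rw [← Nat.mul_succ, Nat.succ_eq_add_one, Nat.sub_add_cancel hp, mul_comm],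
      mul_pow, huv, hvu, one_pow, one_mul, mul_pow, mul_comm]
  · rw [← gcd_pow_mul_of_coprime hn i rfl]
    refine pow_gcd_eq_of_pow_eq hu' hv' (by rw [hu, hv]) ?_
    rw [show p ^ i * (p + 1) = p * p ^ i + p ^ i by ring, pow_add, pow_add, huv, hvu, mul_comm]

lemma gcd_mul_gcd_le {p n : ℕ} (hp : 1 ≤ p) (hn0 : n ≠ 0) :
    n.gcd (p - 1) * n.gcd (p + 1) ≤ 2 * n := by
  rw [← Nat.gcd_mul_lcm]
  refine Nat.mul_le_mul (Nat.le_of_dvd two_pos ?_) (Nat.le_of_dvd (Nat.pos_of_ne_zero hn0)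
    (Nat.lcm_dvd (Nat.gcd_dvd_left _ _) (Nat.gcd_dvd_left _ _)))
  have h1 := (Nat.gcd_dvd_left (n.gcd (p - 1)) (n.gcd (p + 1))).trans (Nat.gcd_dvd_right _ _)
  have h2 := (Nat.gcd_dvd_right (n.gcd (p - 1)) (n.gcd (p + 1))).trans (Nat.gcd_dvd_right _ _)
  have h3 := Nat.dvd_sub h2 h1
  rwa [show p + 1 - (p - 1) = 2 by omega] at h3

/-- The power of an inert prime in the norm of `Φₙ(ω)` divides the norm of `conjDefect q a d` for
a small divisor `d` of `n`. -/
lemma inert_bound {q a : ℤ} {p n v : ℕ} [Fact p.Prime] (hn : n.Coprime p)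
    (hin : ∀ b : ℤ, ¬ (p : ℤ) ∣ b ^ 2 - a * b + q) {r : AlgebraicClosure (ZMod p)}
    (hr : r ^ 2 - a * r + q = 0) (hrp : r ^ p = a - r)
    (hv : (p : ℤ) ^ v ∣ QuadraticAlgebra.norm (cyclotomicValue q a n)) :
    ∃ d : ℕ, d ∣ n ∧ d ^ 2 ≤ 2 * n ∧
      (p : ℤ) ^ v ∣ QuadraticAlgebra.norm (conjDefect q a d) := by
  have hp : p.Prime := Fact.out
  have := charP_algebraicClosure_zmod p
  have hn0 : n ≠ 0 := by
    rintro rfl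
    exact hp.one_lt.ne' (by simpa using hn)
  obtain ⟨w, hw⟩ : ∃ w, w = (v + 1) / 2 := ⟨_, rfl⟩
  suffices h : ∃ d : ℕ, d ∣ n ∧ d ^ 2 ≤ 2 * n ∧
      (p : QuadraticAlgebra ℤ (-q) a) ^ w ∣ conjDefect q a d by
    obtain ⟨d, hd, hd2, hdvd⟩ := h
    refine ⟨d, hd, hd2, ?_⟩
    have h1 := map_dvd QuadraticAlgebra.norm hdvd
    have h3 : QuadraticAlgebra.norm (p : QuadraticAlgebra ℤ (-q) a) = (p : ℤ) ^ 2 :=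
      norm_natCast _
    rw [map_pow, h3, ← pow_mul] at h1
    exact (pow_dvd_pow _ (by omega)).trans h1
  rcases Nat.eq_zero_or_pos w with h0 | hwpos
  · exact ⟨1, one_dvd _, by omega, by rw [h0, pow_zero]; exact one_dvd _⟩
  obtain ⟨i, rfl⟩ : ∃ i, w = i + 1 := ⟨w - 1, by omega⟩
  have hdvd : (p : QuadraticAlgebra ℤ (-q) a) ^ (i + 1) ∣ omega ^ n - 1 :=
    (prime_pow_dvd_of_dvd_norm hp hin _ _ ((pow_dvd_pow _ (by omega)).trans hv)).trans
      (cyclotomicValue_dvd q a n)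
  have hfrob : (p : QuadraticAlgebra ℤ (-q) a) ∣
      omega ^ p - ((a : QuadraticAlgebra ℤ (-q) a) - omega) := by
    apply prime_dvd_of_dvd_norm hp hin
    rw [← CharP.intCast_eq_zero_iff (AlgebraicClosure (ZMod p)), evalRoot_norm hr, map_sub,
      map_pow, map_sub, map_intCast, evalRoot_omega, hrp, sub_self, zero_mul]
  -- the conjugation of `A`
  set σ : QuadraticAlgebra ℤ (-q) a →+* QuadraticAlgebra ℤ (-q) a :=
    evalRoot _ (root_conj (omega_quadratic q a)) with hσ
  have hσω : σ omega = (a : QuadraticAlgebra ℤ (-q) a) - omega := evalRoot_omega _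
  have hdvd' := map_dvd σ hdvd
  have hfrob' := map_dvd σ hfrob
  rw [map_pow, map_natCast, map_sub, map_pow, map_one, hσω] at hdvd'
  rw [map_natCast, map_sub, map_pow, map_sub, map_intCast, hσω, sub_sub_cancel] at hfrob'
  have h1 := dvd_sub_pow_of_dvd_sub hfrob i
  have h2 := dvd_sub_pow_of_dvd_sub hfrob' i
  rw [← pow_mul] at h1 h2
  have key : ∀ x y : QuadraticAlgebra ℤ (-q) a, (p : QuadraticAlgebra ℤ (-q) a) ^ (i + 1) ∣ x - y ↔
      Ideal.Quotient.mk (Ideal.span {(p : QuadraticAlgebra ℤ (-q) a) ^ (i + 1)}) x =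
      Ideal.Quotient.mk (Ideal.span {(p : QuadraticAlgebra ℤ (-q) a) ^ (i + 1)}) y := fun x y => by
    rw [Ideal.Quotient.eq, Ideal.mem_span_singleton]
  have hq : omega * ((a : QuadraticAlgebra ℤ (-q) a) - omega) =
      (q : QuadraticAlgebra ℤ (-q) a) := by
    linear_combination -omega_quadratic q a
  rw [key] at hdvd hdvd' h1 h2
  simp only [map_pow, map_one] at hdvd hdvd' h1 h2
  obtain ⟨h3, h4⟩ := pow_gcd_of_frobenius hp.one_lt.le hn hn0 hdvd hdvd' h1 h2
  rw [← map_mul, hq] at h3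
  simp only [← map_pow] at h3 h4
  rw [← map_one (Ideal.Quotient.mk _), ← key] at h3
  rw [← key] at h4
  have hle := gcd_mul_gcd_le (n := n) hp.one_lt.le hn0
  rcases le_total (n.gcd (p - 1)) (n.gcd (p + 1)) with hc | hc
  · exact ⟨_, Nat.gcd_dvd_left _ _, by nlinarith, h3.mul_right _⟩
  · exact ⟨_, Nat.gcd_dvd_left _ _, by nlinarith, h4.mul_left _⟩

end InertPrimes

section ComplexEstimates

open QuadraticAlgebra Polynomial ComplexConjugate

lemma conj_root_eq {q a : ℤ} (ha : a ^ 2 < 4 * q) {α : ℂ} (hα : α ^ 2 - a * α + q = 0) :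
    conj α = a - α := by
  have h1 : conj α ^ 2 - a * conj α + q = 0 := by
    simpa using congrArg conj hα
  have h2 : (conj α - α) * (conj α - (a - α)) = 0 := by linear_combination h1 - hα
  rcases mul_eq_zero.1 h2 with h | h
  · exfalso
    obtain ⟨x, rfl⟩ := Complex.conj_eq_iff_real.1 (sub_eq_zero.1 h)
    have h3 : x ^ 2 - a * x + q = 0 := by exact_mod_cast hα
    have h4 : (a : ℝ) ^ 2 < 4 * q := by exact_mod_cast ha
    nlinarith [sq_nonneg (2 * x - a)]
  · exact sub_eq_zero.1 h

lemma norm_root_sq {q a : ℤ} (ha : a ^ 2 < 4 * q) {α : ℂ} (hα : α ^ 2 - a * α + q = 0) :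
    ‖α‖ ^ 2 = q := by
  have h : ((‖α‖ ^ 2 : ℝ) : ℂ) = ((q : ℝ) : ℂ) := by
    push_cast
    rw [← Complex.mul_conj', conj_root_eq ha hα]
    linear_combination -hα
  exact_mod_cast h

lemma norm_evalRoot_sq {q a : ℤ} (ha : a ^ 2 < 4 * q) {α : ℂ} (hα : α ^ 2 - a * α + q = 0)
    (z : QuadraticAlgebra ℤ (-q) a) :
    ((QuadraticAlgebra.norm z : ℤ) : ℝ) = ‖evalRoot α hα z‖ ^ 2 := by
  have h : conj (evalRoot α hα z) = evalRoot (a - α) (root_conj hα) z := by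
    simp [evalRoot_apply, conj_root_eq ha hα]
  have h2 := evalRoot_norm hα z
  rw [← h, Complex.mul_conj'] at h2
  exact_mod_cast h2

lemma norm_cyclotomicValue_dvd {q a : ℤ} (ha : a ^ 2 < 4 * q) {α : ℂ}
    (hα : α ^ 2 - a * α + q = 0) {n : ℕ} {m : ℤ}
    (hm : (m : ℂ) = (α ^ n - 1) * ((starRingEnd ℂ) α ^ n - 1)) :
    QuadraticAlgebra.norm (cyclotomicValue q a n) ∣ m := by
  have h : m = QuadraticAlgebra.norm ((omega : QuadraticAlgebra ℤ (-q) a) ^ n - 1) := by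
    have h3 : ∀ {w : ℂ} (hw : w ^ 2 - a * w + q = 0),
        evalRoot w hw (omega ^ n - 1) = w ^ n - 1 := fun hw => by
      rw [map_sub, map_pow, evalRoot_omega, map_one]
    have h2 := evalRoot_norm hα ((omega : QuadraticAlgebra ℤ (-q) a) ^ n - 1)
    rw [h3, h3, ← conj_root_eq ha hα, ← hm] at h2
    exact_mod_cast h2.symm
  rw [h]
  exact map_dvd QuadraticAlgebra.norm (cyclotomicValue_dvd q a n)

lemma norm_conjDefect_le {q a : ℤ} (hq : 2 ≤ q) (ha : a ^ 2 < 4 * q) {α : ℂ}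
    (hα : α ^ 2 - a * α + q = 0) (d : ℕ) :
    ((QuadraticAlgebra.norm (conjDefect q a d) : ℤ) : ℝ) ≤ 4 * (q : ℝ) ^ (3 * d) := by
  have hq' : (2 : ℝ) ≤ q := by exact_mod_cast hq
  have hq1 : (1 : ℝ) ≤ (q : ℝ) ^ d := one_le_pow₀ (by linarith)
  have h1 : ‖(q : ℂ) ^ d - 1‖ ≤ (q : ℝ) ^ d := by
    have : (q : ℂ) ^ d - 1 = (((q : ℝ) ^ d - 1 : ℝ) : ℂ) := by push_cast; rfl
    rw [this, Complex.norm_real, Real.norm_eq_abs, abs_of_nonneg (by linarith)]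
    linarith
  have h2 : ‖α ^ d - (a - α) ^ d‖ ≤ 2 * ‖α‖ ^ d := by
    rw [← conj_root_eq ha hα]
    refine (norm_sub_le _ _).trans ?_
    rw [norm_pow, norm_pow, Complex.norm_conj]; linarith
  rw [norm_evalRoot_sq ha hα, conjDefect]
  simp only [map_mul, map_sub, map_pow, map_intCast, map_one, evalRoot_omega, norm_mul]
  calc (‖(q : ℂ) ^ d - 1‖ * ‖α ^ d - (a - α) ^ d‖) ^ 2
      ≤ ((q : ℝ) ^ d * (2 * ‖α‖ ^ d)) ^ 2 := by gcongr
    _ = 4 * ((q : ℝ) ^ d) ^ 2 * (‖α‖ ^ 2) ^ d := by ring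
    _ = 4 * (q : ℝ) ^ (3 * d) := by rw [norm_root_sq ha hα]; ring

/-- If some power of `α` is real, then `ω ^ 24 = q ^ 12`. -/
lemma pow_twentyFour_of_pow_eq {q a : ℤ} (hq : 2 ≤ q) (ha : a ^ 2 < 4 * q) {α : ℂ}
    (hα : α ^ 2 - a * α + q = 0) {d : ℕ} (hd : 0 < d) (h : α ^ d = (a - α) ^ d) :
    (omega : QuadraticAlgebra ℤ (-q) a) ^ 24 = (q : QuadraticAlgebra ℤ (-q) a) ^ 12 := by
  have hq0 : (q : ℂ) ≠ 0 := by exact_mod_cast (by omega : q ≠ 0)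
  have hα0 : α ≠ 0 := by
    rintro rfl
    exact hq0 (by simpa using hα)
  have hα1 : (a : ℂ) - α ≠ 0 := by
    intro h0
    exact hq0 (by linear_combination hα + α * h0)
  have hintegral : ∀ β : ℂ, β ^ d = 1 → IsIntegral ℤ β := fun β hβ =>
    IsIntegral.of_pow hd (by rw [hβ]; exact isIntegral_one)
  have h1 : IsIntegral ℤ (α / (a - α) + (a - α) / α) := by
    refine (hintegral _ ?_).add (hintegral _ ?_)
    · rw [div_pow, h, div_self (pow_ne_zero _ hα1)]
    · rw [div_pow, h, div_self (pow_ne_zero _ hα1)]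
  have h2 : α / (a - α) + (a - α) / α = algebraMap ℚ ℂ ((a : ℚ) ^ 2 / q - 2) := by
    have h3 : α * (a - α) = q := by linear_combination -hα
    have h4 : α / (a - α) + (a - α) / α = (α ^ 2 + (a - α) ^ 2) / (α * (a - α)) := by
      field_simp
    rw [h4, h3]
    simp
    field_simp
    linear_combination 2 * hα
  rw [h2, isIntegral_algebraMap_iff (algebraMap ℚ ℂ).injective] at h1
  obtain ⟨k, hk⟩ := IsIntegrallyClosed.isIntegral_iff.1 h1
  have hq0' : (q : ℚ) ≠ 0 := by exact_mod_cast (by omega : q ≠ 0)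
  have hk2 : a ^ 2 = (k + 2) * q := by
    have : (a : ℚ) ^ 2 = (k + 2) * q := by
      have hk' : (k : ℚ) = (a : ℚ) ^ 2 / q - 2 := by simpa using hk
      rw [hk']; field_simp; ring
    exact_mod_cast this
  have hk3 : -2 ≤ k := by nlinarith [sq_nonneg a]
  have hk4 : k ≤ 1 := by nlinarith
  have hs : (omega : QuadraticAlgebra ℤ (-q) a) ^ 4 =
      (k * q : QuadraticAlgebra ℤ (-q) a) * omega ^ 2 - (q : QuadraticAlgebra ℤ (-q) a) ^ 2 := by
    have h5 : (a : QuadraticAlgebra ℤ (-q) a) ^ 2 = (k + 2) * q := by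
      exact_mod_cast congrArg (Int.cast (R := QuadraticAlgebra ℤ (-q) a)) hk2
    linear_combination (omega ^ 2 + a * omega + q) * omega_quadratic q a + omega ^ 2 * h5
  by_cases hk5 : k = -2
  · have ha0 : a = 0 := by simpa [hk5] using hk2
    have h6 := omega_quadratic q a
    have h7 : (omega : QuadraticAlgebra ℤ (-q) a) ^ 2 = -(q : QuadraticAlgebra ℤ (-q) a) := by
      have h8 : (a : QuadraticAlgebra ℤ (-q) a) = 0 :=
        (congrArg (Int.cast (R := QuadraticAlgebra ℤ (-q) a)) ha0).trans Int.cast_zero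
      linear_combination h6 + omega * h8
    rw [show 24 = 2 * 12 by norm_num, pow_mul, h7, Even.neg_pow (by decide)]
  generalize (q : QuadraticAlgebra ℤ (-q) a) = Q at hs ⊢
  generalize (omega : QuadraticAlgebra ℤ (-q) a) = o at hs ⊢
  have hk6 : k = -1 ∨ k = 0 ∨ k = 1 := by omega
  rcases hk6 with rfl | rfl | rfl
  · have h6 : o ^ 6 = Q ^ 3 := by
      push_cast at hs; linear_combination (o ^ 2 - Q) * hs
    rw [show 24 = 6 * 4 by norm_num, pow_mul, h6]; ring
  · have h6 : o ^ 4 = -Q ^ 2 := by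
      push_cast at hs; linear_combination hs
    rw [show 24 = 4 * 6 by norm_num, pow_mul, h6]; ring
  · have h6 : o ^ 6 = -Q ^ 3 := by
      push_cast at hs; linear_combination (o ^ 2 + Q) * hs
    rw [show 24 = 6 * 4 by norm_num, pow_mul, h6]; ring

lemma norm_conjDefect_ne_zero {q a : ℤ} (hq : 2 ≤ q) (ha : a ^ 2 < 4 * q) {α : ℂ}
    (hα : α ^ 2 - a * α + q = 0)
    (hdeg : (omega : QuadraticAlgebra ℤ (-q) a) ^ 24 ≠ (q : QuadraticAlgebra ℤ (-q) a) ^ 12)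
    {d : ℕ} (hd : 0 < d) : QuadraticAlgebra.norm (conjDefect q a d) ≠ 0 := by
  intro h0
  have h1 := norm_evalRoot_sq ha hα (conjDefect q a d)
  rw [h0, Int.cast_zero, eq_comm, sq_eq_zero_iff, norm_eq_zero, conjDefect] at h1
  simp only [map_mul, map_sub, map_pow, map_intCast, map_one, evalRoot_omega, mul_eq_zero] at h1
  rcases h1 with h1 | h1
  · have : q ^ d = 1 := by exact_mod_cast sub_eq_zero.1 h1
    have := one_lt_pow₀ (by omega : 1 < q) hd.ne'
    omega
  · exact hdeg (pow_twentyFour_of_pow_eq hq ha hα hd (sub_eq_zero.1 h1))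

lemma abs_log_norm_one_sub_le {w : ℂ} (hw : ‖w‖ ≤ 3 / 4) : |Real.log ‖1 - w‖| ≤ 4 * ‖w‖ := by
  have h1 : 1 - ‖w‖ ≤ ‖1 - w‖ := by simpa using norm_sub_norm_le 1 w
  have h2 : ‖1 - w‖ ≤ 1 + ‖w‖ := by simpa using norm_sub_le 1 w
  have h0 : 0 < ‖1 - w‖ := by linarith
  rw [abs_le]
  constructor
  · have h3 := Real.one_sub_inv_le_log_of_pos h0
    have h4 : ‖1 - w‖⁻¹ ≤ (1 - ‖w‖)⁻¹ := inv_anti₀ (by linarith) h1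
    have h5 : (1 - ‖w‖)⁻¹ ≤ 1 + 4 * ‖w‖ := by
      rw [inv_le_iff_one_le_mul₀ (by linarith)]
      nlinarith [norm_nonneg w]
    linarith
  · have h3 := Real.log_le_sub_one_of_pos h0
    linarith [norm_nonneg w]

lemma sum_divisors_pow_le {ρ : ℝ} (h0 : 0 ≤ ρ) (h1 : ρ ≤ 3 / 4) (n : ℕ) :
    ∑ d ∈ n.divisors, ρ ^ d ≤ 4 := by
  calc ∑ d ∈ n.divisors, ρ ^ d ≤ ∑ d ∈ Finset.range (n + 1), ρ ^ d :=
        Finset.sum_le_sum_of_subset_of_nonneg (fun d hd => by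
          have := Nat.divisor_le hd
          simp; omega) fun _ _ _ => pow_nonneg h0 _
    _ ≤ (1 - ρ)⁻¹ := by
      rw [← tsum_geometric_of_lt_one h0 (by linarith)]
      exact (summable_geometric_of_lt_one h0 (by linarith)).sum_le_tsum _
        fun _ _ => pow_nonneg h0 _
    _ ≤ 4 := by
      rw [inv_le_comm₀ (by linarith) (by norm_num)]; linarith

/-- The lower bound for `|Φₙ(α)|`. -/
lemma log_norm_eval_cyclotomic_ge {α : ℂ} (hα : 4 / 3 ≤ ‖α‖) {n : ℕ} (hn : 0 < n) :
    n.totient * Real.log ‖α‖ - 16 ≤ Real.log ‖(cyclotomic n ℂ).eval α‖ := by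
  have hα0 : α ≠ 0 := by rintro rfl; norm_num at hα
  have hne : ∀ k : ℕ, 0 < k → α ^ k - 1 ≠ 0 := fun k hk h => by
    have h2 := congrArg (fun z : ℂ => ‖z‖) (sub_eq_zero.1 h)
    rw [norm_pow, NormOneClass.norm_one] at h2
    have := one_lt_pow₀ (by linarith : 1 < ‖α‖) hk.ne'
    linarith
  have hprod : ∀ k : ℕ, 0 < k → ∏ d ∈ k.divisors, (cyclotomic d ℂ).eval α = α ^ k - 1 :=
    fun k hk => by
      have := congrArg (eval α) (prod_cyclotomic_eq_X_pow_sub_one hk ℂ)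
      simpa [eval_prod] using this
  set f : ℕ → ℝ := fun d => Real.log ‖(cyclotomic d ℂ).eval α‖ - d.totient * Real.log ‖α‖
  set g : ℕ → ℝ := fun k => Real.log ‖1 - (α⁻¹) ^ k‖
  have hsum : ∀ k > 0, ∑ d ∈ k.divisors, f d = g k := by
    intro k hk
    have h1 : ∑ d ∈ k.divisors, Real.log ‖(cyclotomic d ℂ).eval α‖ = Real.log ‖α ^ k - 1‖ := by
      rw [← hprod k hk, norm_prod, Real.log_prod]
      intro d hd
      rw [norm_ne_zero_iff]
      have := hprod k hk ▸ hne k hk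
      exact Finset.prod_ne_zero_iff.1 this d hd
    have h2 : ∑ d ∈ k.divisors, (d.totient : ℝ) = k := by exact_mod_cast Nat.sum_totient k
    have h3 : α ^ k - 1 = α ^ k * (1 - (α⁻¹) ^ k) := by
      rw [mul_sub, ← mul_pow, mul_inv_cancel₀ hα0, one_pow, mul_one]
    have h4 : ‖1 - (α⁻¹) ^ k‖ ≠ 0 := by
      rw [norm_ne_zero_iff]
      intro h
      exact hne k hk (by rw [h3, h, mul_zero])
    simp only [f, g]
    rw [Finset.sum_sub_distrib, h1, ← Finset.sum_mul, h2, h3, norm_mul, norm_pow,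
      Real.log_mul (pow_ne_zero _ (norm_ne_zero_iff.2 hα0)) h4, Real.log_pow]
    ring
  have hmob := (ArithmeticFunction.sum_eq_iff_sum_mul_moebius_eq.1 hsum) n hn
  have hρ : ‖α⁻¹‖ ≤ 3 / 4 := by
    rw [norm_inv, inv_le_comm₀ (by linarith) (by norm_num)]; linarith
  have hg : ∀ k, 0 < k → |g k| ≤ 4 * ‖α⁻¹‖ ^ k := fun k hk => by
    rw [← norm_pow]
    refine abs_log_norm_one_sub_le ?_
    rw [norm_pow]
    exact (pow_le_of_le_one (norm_nonneg _) (by linarith) hk.ne').trans hρ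
  have hf : |f n| ≤ 16 := by
    rw [← hmob]
    refine (Finset.abs_sum_le_sum_abs _ _).trans ?_
    calc ∑ x ∈ n.divisorsAntidiagonal, |((ArithmeticFunction.moebius x.1 : ℤ) : ℝ) * g x.2|
        ≤ ∑ x ∈ n.divisorsAntidiagonal, 4 * ‖α⁻¹‖ ^ x.2 := by
          refine Finset.sum_le_sum fun x hx => ?_
          have hx2 : 0 < x.2 := Nat.pos_of_ne_zero fun h => by
            rw [Nat.mem_divisorsAntidiagonal] at hx
            rw [h, mul_zero] at hx
            omega
          have hμ : |((ArithmeticFunction.moebius x.1 : ℤ) : ℝ)| ≤ 1 := by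
            exact_mod_cast ArithmeticFunction.abs_moebius_le_one
          rw [abs_mul]
          calc _ ≤ 1 * |g x.2| := by gcongr
            _ ≤ _ := by rw [one_mul]; exact hg _ hx2
      _ = 4 * ∑ d ∈ n.divisors, ‖α⁻¹‖ ^ d := by
          rw [Nat.sum_divisorsAntidiagonal' (f := fun _ d => 4 * ‖α⁻¹‖ ^ d), Finset.mul_sum]
      _ ≤ 16 := by linarith [sum_divisors_pow_le (norm_nonneg _) hρ n]
  have := (abs_le.1 hf).1
  simp only [f] at this
  linarith

lemma log_norm_cyclotomicValue_ge {q a : ℤ} (hq : 2 ≤ q) (ha : a ^ 2 < 4 * q) {α : ℂ}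
    (hα : α ^ 2 - a * α + q = 0) {n : ℕ} (hn : 0 < n) :
    n.totient * Real.log q - 32 ≤
      Real.log ((QuadraticAlgebra.norm (cyclotomicValue q a n) : ℤ) : ℝ) := by
  have hα2 := norm_root_sq ha hα
  have hq' : (2 : ℝ) ≤ q := by exact_mod_cast hq
  have h := log_norm_eval_cyclotomic_ge (α := α) (by nlinarith [norm_nonneg α]) hn
  rw [norm_evalRoot_sq ha hα, evalRoot_cyclotomicValue, Real.log_pow, ← hα2, Real.log_pow]
  push_cast
  linarith

end ComplexEstimates

section ArithmeticBounds

open Finset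

lemma prod_le_prod_sub_one_mul (S : Finset ℕ) (hS : ∀ p ∈ S, 2 ≤ p) :
    ∏ p ∈ S, p ≤ (∏ p ∈ S, (p - 1)) * (#S + 1) := by
  induction S using Finset.induction_on_max with
  | empty => simp
  | insert p S hmax ih =>
    have hp : p ∉ S := fun h => lt_irrefl _ (hmax p h)
    have hcard : #S + 2 ≤ p := by
      have hsub : S ⊆ Finset.Ico 2 p := fun x hx =>
        Finset.mem_Ico.2 ⟨hS x (mem_insert_of_mem hx), hmax x hx⟩
      have := card_le_card hsub
      rw [Nat.card_Ico] at this
      have := hS p (mem_insert_self _ _)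
      omega
    rw [prod_insert hp, prod_insert hp, card_insert_of_notMem hp]
    have ih := ih fun x hx => hS x (mem_insert_of_mem hx)
    obtain ⟨r, rfl⟩ := Nat.exists_eq_add_of_le' (by omega : 1 ≤ p)
    rw [Nat.add_sub_cancel]
    calc (r + 1) * ∏ p ∈ S, p ≤ (r + 1) * ((∏ p ∈ S, (p - 1)) * (#S + 1)) := by gcongr
      _ = (∏ p ∈ S, (p - 1)) * ((r + 1) * (#S + 1)) := by ring
      _ ≤ (∏ p ∈ S, (p - 1)) * (r * (#S + 1 + 1)) := by
        exact Nat.mul_le_mul_left _ (by nlinarith)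
      _ = _ := by ring

lemma card_primeFactors_le_log {n : ℕ} (hn : n ≠ 0) : #n.primeFactors ≤ Nat.log 2 n := by
  refine Nat.le_log_of_pow_le one_lt_two ?_
  calc 2 ^ #n.primeFactors = ∏ p ∈ n.primeFactors, 2 := by rw [prod_const]
    _ ≤ ∏ p ∈ n.primeFactors, p :=
      prod_le_prod' fun p hp => (Nat.prime_of_mem_primeFactors hp).two_le
    _ ≤ n := Nat.le_of_dvd (Nat.pos_of_ne_zero hn) n.prod_primeFactors_dvd

lemma le_totient_mul_log {n : ℕ} (hn : n ≠ 0) : n ≤ n.totient * (Nat.log 2 n + 1) := by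
  have h1 := Nat.totient_mul_prod_primeFactors n
  have h2 := prod_le_prod_sub_one_mul n.primeFactors
    fun p hp => (Nat.prime_of_mem_primeFactors hp).two_le
  have hpos : 0 < ∏ p ∈ n.primeFactors, (p - 1) := prod_pos fun p hp => by
    have := (Nat.prime_of_mem_primeFactors hp).two_le
    omega
  refine le_of_mul_le_mul_right (a := ∏ p ∈ n.primeFactors, (p - 1)) ?_ hpos
  rw [← h1]
  calc n.totient * ∏ p ∈ n.primeFactors, p
      ≤ n.totient * ((∏ p ∈ n.primeFactors, (p - 1)) * (#n.primeFactors + 1)) := by gcongr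
    _ ≤ n.totient * ((∏ p ∈ n.primeFactors, (p - 1)) * (Nat.log 2 n + 1)) := by
      have := card_primeFactors_le_log hn
      gcongr
    _ = _ := by ring

lemma succ_cube_le_two_pow (k : ℕ) : (k + 1) ^ 3 ≤ 8 * 2 ^ k := by
  rcases lt_or_ge k 3 with h | h
  · interval_cases k <;> norm_num
  · induction k, h using Nat.le_induction with
    | base => norm_num
    | succ k hk ih =>
      rw [pow_succ 2]
      nlinarith [mul_self_nonneg k, mul_le_mul hk hk (by norm_num) (by omega)]

lemma card_divisors_cube_le {n : ℕ} (hn : n ≠ 0) : #n.divisors ^ 3 ≤ 8 ^ 8 * n := by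
  rw [Nat.card_divisors hn]
  have hn' : ∏ p ∈ n.primeFactors, p ^ n.factorization p = n :=
    Nat.prod_factorization_pow_eq_self hn
  conv_rhs => rw [← hn']
  have h1 : ∏ p ∈ n.primeFactors, (if p < 8 then 8 else 1) ≤ 8 ^ 8 := by
    rw [prod_ite, prod_const, prod_const_one, mul_one]
    refine Nat.pow_le_pow_right (by norm_num) ?_
    have : n.primeFactors.filter (· < 8) ⊆ range 8 := fun x hx => by
      rw [mem_filter] at hx
      exact mem_range.2 hx.2
    simpa using card_le_card this
  calc (∏ p ∈ n.primeFactors, (n.factorization p + 1)) ^ 3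
      = ∏ p ∈ n.primeFactors, (n.factorization p + 1) ^ 3 := by rw [prod_pow]
    _ ≤ ∏ p ∈ n.primeFactors, (if p < 8 then 8 else 1) * p ^ n.factorization p := by
      refine prod_le_prod' fun p hp => ?_
      have hp2 := (Nat.prime_of_mem_primeFactors hp).two_le
      split_ifs with h
      · exact (succ_cube_le_two_pow _).trans (by gcongr)
      · rw [one_mul]
        calc (n.factorization p + 1) ^ 3 ≤ (2 ^ n.factorization p) ^ 3 := by
              gcongr; exact Nat.lt_two_pow_self
          _ = 8 ^ n.factorization p := by rw [← pow_mul, mul_comm, pow_mul]; norm_num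
          _ ≤ p ^ n.factorization p := by gcongr; omega
    _ = (∏ p ∈ n.primeFactors, (if p < 8 then 8 else 1)) *
          ∏ p ∈ n.primeFactors, p ^ n.factorization p := prod_mul_distrib
    _ ≤ _ := by gcongr

/-- Bounding `log N` by sorting the prime factors of `N` into three classes. -/
lemma log_le_of_prime_classes {N n P : ℕ} (hn : n ≠ 0) (hP : P ≠ 0) (B : Finset ℕ)
    {K : ℝ} (hK : 0 ≤ K)
    (h : ∀ p, p.Prime → p ∣ N → (p ∣ n ∧ N.factorization p ≤ 2) ∨
      (p ∈ B ∧ N.factorization p * Real.log p ≤ K) ∨ p ^ N.factorization p ∣ P) :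
    Real.log N ≤ 2 * Real.log n + #B * K + Real.log P := by
  classical
  set S₁ := n.primeFactors
  set S₃ := N.primeFactors.filter fun p => p ^ N.factorization p ∣ P
  set t : ℕ → ℝ := fun p => N.factorization p * Real.log p
  have ht : ∀ p, 0 ≤ t p := fun p => mul_nonneg (Nat.cast_nonneg _) (Real.log_natCast_nonneg _)
  have h1 : ∑ p ∈ N.primeFactors with p ∣ n ∧ N.factorization p ≤ 2, t p ≤ 2 * Real.log n := by
    calc ∑ p ∈ N.primeFactors with p ∣ n ∧ N.factorization p ≤ 2, t p
        ≤ ∑ p ∈ N.primeFactors with p ∣ n ∧ N.factorization p ≤ 2, 2 * Real.log p := by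
          refine sum_le_sum fun p hp => ?_
          have h2 : (N.factorization p : ℝ) ≤ 2 := by exact_mod_cast (mem_filter.1 hp).2.2
          exact mul_le_mul_of_nonneg_right h2 (Real.log_natCast_nonneg _)
      _ ≤ ∑ p ∈ n.primeFactors, 2 * Real.log p := by
          refine sum_le_sum_of_subset_of_nonneg (fun p hp => ?_)
            fun p _ _ => mul_nonneg two_pos.le (Real.log_natCast_nonneg _)
          rw [mem_filter] at hp
          exact Nat.mem_primeFactors.2 ⟨Nat.prime_of_mem_primeFactors hp.1, hp.2.1, hn⟩
      _ = 2 * Real.log (∏ p ∈ n.primeFactors, p : ℕ) := by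
          rw [← mul_sum, Nat.cast_prod, Real.log_prod]
          exact fun p hp => Nat.cast_ne_zero.2 (Nat.prime_of_mem_primeFactors hp).ne_zero
      _ ≤ 2 * Real.log n := by
          have h2 : ∏ p ∈ n.primeFactors, p ≤ n :=
            Nat.le_of_dvd (Nat.pos_of_ne_zero hn) n.prod_primeFactors_dvd
          have h3 : 0 < ∏ p ∈ n.primeFactors, p :=
            prod_pos fun p hp => (Nat.prime_of_mem_primeFactors hp).pos
          gcongr
  have h2 : ∑ p ∈ B with t p ≤ K, t p ≤ #B * K := by
    calc ∑ p ∈ B with t p ≤ K, t p ≤ #(B.filter fun p => t p ≤ K) • K :=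
          sum_le_card_nsmul _ _ _ fun p hp => (mem_filter.1 hp).2
      _ ≤ #B * K := by
          rw [nsmul_eq_mul]
          gcongr
          exact filter_subset _ _
  have h3 : ∑ p ∈ S₃, t p ≤ Real.log P := by
    have h4 : ∏ p ∈ S₃, p ^ N.factorization p ∣ P := by
      refine Finset.prod_dvd_of_isRelPrime (fun p hp r hr hpr => ?_) fun p hp => (mem_filter.1 hp).2
      rw [mem_coe, mem_filter] at hp hr
      exact Nat.coprime_iff_isRelPrime.1 (Nat.Coprime.pow _ _ ((Nat.coprime_primes
        (Nat.prime_of_mem_primeFactors hp.1) (Nat.prime_of_mem_primeFactors hr.1)).2 hpr))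
    have h5 : ∑ p ∈ S₃, t p = Real.log (∏ p ∈ S₃, p ^ N.factorization p : ℕ) := by
      rw [Nat.cast_prod, Real.log_prod]
      · simp [t]
      · intro p hp
        exact Nat.cast_ne_zero.2
          (pow_ne_zero _ (Nat.prime_of_mem_primeFactors (mem_filter.1 hp).1).ne_zero)
    rw [h5]
    have h6 : 0 < ∏ p ∈ S₃, p ^ N.factorization p :=
      Nat.pos_of_dvd_of_pos h4 (Nat.pos_of_ne_zero hP)
    have h7 := Nat.le_of_dvd (Nat.pos_of_ne_zero hP) h4
    gcongr
  have hcover : N.primeFactors ⊆ (N.primeFactors.filter fun p => p ∣ n ∧ N.factorization p ≤ 2) ∪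
      (B.filter fun p => t p ≤ K) ∪ S₃ := fun p hp => by
    rw [mem_union, mem_union, mem_filter, mem_filter, mem_filter]
    rcases h p (Nat.prime_of_mem_primeFactors hp) (Nat.dvd_of_mem_primeFactors hp) with h | h | h
    · exact Or.inl (Or.inl ⟨hp, h⟩)
    · exact Or.inl (Or.inr h)
    · exact Or.inr ⟨hp, h⟩
  have hunion : ∀ S T : Finset ℕ, ∑ p ∈ S ∪ T, t p ≤ ∑ p ∈ S, t p + ∑ p ∈ T, t p := fun S T => by
    rw [← sum_union_inter]
    exact le_add_of_nonneg_right (sum_nonneg fun p _ => ht p)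
  rw [Real.log_nat_eq_sum_factorization]
  calc ∑ p ∈ N.primeFactors, t p ≤ _ := sum_le_sum_of_subset_of_nonneg hcover fun p _ _ => ht p
    _ ≤ _ := (hunion _ _).trans (add_le_add (hunion _ _) le_rfl)
    _ ≤ _ := by linarith

/-- The number of integers `2 ≤ p ≤ X` such that `n ∣ 24 (p - 1)` is at most `24 X / n`. -/
lemma card_filter_dvd_le {n : ℕ} (hn : 0 < n) {X : ℝ} (hX : 0 ≤ X) :
    (#((range (⌊X⌋₊ + 1)).filter fun p => 2 ≤ p ∧ n ∣ 24 * (p - 1)) : ℝ) ≤ 24 * X / n := by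
  have h1 : #((range (⌊X⌋₊ + 1)).filter fun p => 2 ≤ p ∧ n ∣ 24 * (p - 1)) ≤
      #(Finset.Ioc 0 (24 * ⌊X⌋₊ / n)) := by
    refine card_le_card_of_injOn (fun p => 24 * (p - 1) / n) (fun p hp => ?_)
      fun p hp r hr hpr => ?_
    · simp only [coe_filter, mem_range, Set.mem_ofPred_eq] at hp
      obtain ⟨hp1, hp2, hp3⟩ := hp
      rw [mem_coe, Finset.mem_Ioc]
      exact ⟨Nat.div_pos (Nat.le_of_dvd (by omega) hp3) hn, Nat.div_le_div_right (by omega)⟩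
    · simp only [coe_filter, mem_range, Set.mem_ofPred_eq] at hp hr
      have h := (Nat.div_left_inj hp.2.2 hr.2.2).1 hpr
      omega
  rw [Nat.card_Ioc, Nat.sub_zero] at h1
  calc _ ≤ ((24 * ⌊X⌋₊ / n : ℕ) : ℝ) := by exact_mod_cast h1
    _ ≤ ((24 * ⌊X⌋₊ : ℕ) : ℝ) / n := Nat.cast_div_le
    _ ≤ 24 * X / n := by
      push_cast
      gcongr
      exact Nat.floor_le hX

end ArithmeticBounds

section AnalyticEstimates

open Real

lemma exp_le_log_of_exp_exp_le {x y : ℝ} (h : exp (exp y) ≤ x) :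
    exp y ≤ log x ∧ y ≤ log (log x) := by
  have h1 : exp y ≤ log x := (le_log_iff_exp_le ((exp_pos _).trans_le h)).2 h
  exact ⟨h1, (le_log_iff_exp_le ((exp_pos _).trans_le h1)).2 h1⟩

lemma log_log_ge_of_sq_ge {n p : ℝ} (hn : 1 < n) (hp : 0 < p) (hnp : n ≤ p ^ 2) :
    log (log n) - 1 ≤ log (log p) ∧ 1 < p := by
  have hl : 0 < log n := log_pos hn
  have h1 : log n ≤ 2 * log p := by
    have := log_le_log (by linarith) hnp
    rwa [log_pow, Nat.cast_ofNat] at this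
  have h2 : log (log n) ≤ log 2 + log (log p) := by
    rw [← log_mul two_ne_zero (by linarith)]
    exact log_le_log hl h1
  exact ⟨by linarith [log_two_lt_d9], (log_pos_iff hp.le).1 (by linarith)⟩

/-- The size conditions on a prime `p` with `n ≤ p ^ 2`. -/
lemma prime_size_of_sq_ge {n p Q : ℝ} (hn : exp (exp (max (10 ^ 10) (3 * Q))) ≤ n) (hp : 0 < p)
    (hnp : n ≤ p ^ 2) :
    exp (exp (10 ^ 9)) ≤ p ∧ 4 * Q ≤ 4 * log (log p) ∧ 4 * Q < p := by
  obtain ⟨-, h2⟩ := exp_le_log_of_exp_exp_le hn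
  have hn1 : 1 < n := (one_lt_exp_iff.2 (exp_pos _)).trans_le hn
  obtain ⟨h3, hp1⟩ := log_log_ge_of_sq_ge hn1 hp hnp
  have h4 := (le_max_left (10 ^ 10) (3 * Q)).trans h2
  have h5 := (le_max_right (10 ^ 10) (3 * Q)).trans h2
  have h6 : exp (10 ^ 9) ≤ log p := by
    rw [← le_log_iff_exp_le (log_pos hp1)]
    linarith
  have h7 : log (log p) ≤ log p - 1 := log_le_sub_one_of_pos (log_pos hp1)
  have h8 : exp (log p) = p := exp_log hp
  have h9 := quadratic_le_exp_of_nonneg (log_pos hp1).le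
  rw [h8] at h9
  have h10 := add_one_le_exp (10 ^ 9 : ℝ)
  refine ⟨(le_log_iff_exp_le hp).1 h6, by linarith, by nlinarith⟩

lemma log_div_log_log_ge {n p : ℝ} (hn : exp (exp 10) ≤ n) (hp : n / 24 ≤ p) :
    log n / log (log n) - 1 ≤ log p / log (log p) := by
  obtain ⟨h1, h2⟩ := exp_le_log_of_exp_exp_le hn
  have hn0 : 0 < n := (exp_pos _).trans_le hn
  have h3 : log n - 4 ≤ log p := by
    have h4 := log_le_log (by positivity) hp
    have h5 : log 24 ≤ 4 := by
      rw [log_le_iff_le_exp (by norm_num)]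
      have := exp_one_gt_d9
      calc (24 : ℝ) ≤ 2.7 ^ 4 := by norm_num
        _ ≤ exp 1 ^ 4 := by gcongr; linarith
        _ = exp 4 := by rw [← exp_nat_mul]; norm_num
    rw [log_div hn0.ne' (by norm_num)] at h4
    linarith
  have h10 := quadratic_le_exp_of_nonneg (by norm_num : (0 : ℝ) ≤ 10)
  have he := exp_one_lt_d9
  have hy : exp 1 ≤ log n - 4 := by linarith
  have h6 := log_div_self_antitoneOn (Set.mem_ofPred.2 hy) (Set.mem_ofPred.2 (hy.trans h3)) h3
  have h7 : 0 < log (log n - 4) := log_pos (by linarith)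
  have h8 : 0 < log (log p) := log_pos (by linarith)
  have h9 : (log n - 4) / log (log n - 4) ≤ log p / log (log p) := by
    have := inv_anti₀ (div_pos h8 (by linarith)) h6
    rwa [inv_div, inv_div] at this
  refine le_trans ?_ h9
  rw [le_div_iff₀ h7]
  have h11 : log (log n - 4) ≤ log (log n) := log_le_log (by linarith) (by linarith)
  have h12 : log n / log (log n) * log (log n) = log n := div_mul_cancel₀ _ (by linarith)
  have h13 : log (log n) ≤ log n := (log_le_sub_one_of_pos (by linarith)).trans (by linarith)
  have h14 : 1 ≤ log n / log (log n) := by rwa [le_div_iff₀ (by linarith), one_mul]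
  have h15 : 4 ≤ log (log n - 4) := by
    rw [le_log_iff_exp_le (by linarith)]
    have : exp 4 + 4 ≤ exp 10 := by
      have h16 := add_one_le_exp (6 : ℝ)
      have h17 := add_one_le_exp (4 : ℝ)
      rw [show (10 : ℝ) = 6 + 4 by norm_num, exp_add]
      nlinarith
    linarith
  have h18 : log n / log (log n) * log (log n - 4) ≤ log n :=
    (mul_le_mul_of_nonneg_left h11 (by linarith)).trans_eq h12
  linarith

lemma exp_neg_log_div_le {l : ℝ} (hl : 10 ^ 10 ≤ log l) (hl0 : 0 < l) :
    exp (-(0.0002 * (l / log l))) ≤ 1 / (10 ^ 4 * l ^ 2) := by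
  set y := log l
  have h1 := pow_div_factorial_le_exp y (by linarith) 4
  rw [show exp y = l from exp_log hl0] at h1
  have h2 : y ^ 3 / 24 ≤ l / y := by
    rw [le_div_iff₀ (by linarith)]
    norm_num [Nat.factorial] at h1
    linarith
  have h3 : 10 + 2 * y ≤ 0.0002 * (l / y) := by
    have h4 : (10 ^ 10) ^ 2 * y ≤ y ^ 3 := by
      rw [pow_succ y]; gcongr
    norm_num at h4 ⊢
    linarith
  rw [exp_neg, one_div]
  refine inv_anti₀ (by positivity) ?_
  calc 10 ^ 4 * l ^ 2 ≤ exp 10 * l ^ 2 := by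
        gcongr
        have := exp_one_gt_d9
        calc (10 ^ 4 : ℝ) ≤ 2.7 ^ 10 := by norm_num
          _ ≤ exp 1 ^ 10 := by gcongr; linarith
          _ = exp 10 := by rw [← exp_nat_mul]; norm_num
    _ = exp (10 + 2 * y) := by
        rw [exp_add, two_mul, exp_add, show exp y = l from exp_log hl0]; ring
    _ ≤ _ := exp_le_exp.2 h3

/-- The contribution of the primes congruent to `1` modulo `n`. -/
lemma split_contribution_le {n : ℝ} (hn : exp (exp (10 ^ 10)) ≤ n) :
    24 * exp (0.0001 * log n / log (log n)) *
      (2 * (n * exp (0.0001 * log n / log (log n))) *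
        exp (-(0.0004 * (log n / log (log n) - 1))) *
        log (n * exp (0.0001 * log n / log (log n)))) ≤ 0.01 * (n / log n) := by
  obtain ⟨h1, h2⟩ := exp_le_log_of_exp_exp_le hn
  have hn0 : 0 < n := (exp_pos _).trans_le hn
  have hl0 : 0 < log n := (exp_pos _).trans_le h1
  have h3 := exp_neg_log_div_le h2 hl0
  rw [log_mul hn0.ne' (exp_pos _).ne', log_exp]
  set l := log n
  set y := log l
  have hE : 0.0001 * l / y = 0.0001 * (l / y) := by ring
  rw [hE]
  have hly : l / y ≤ l := div_le_self hl0.le (by linarith)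
  have h4 : exp (0.0001 * (l / y)) * exp (0.0001 * (l / y)) *
      exp (-(0.0004 * (l / y - 1))) = exp 0.0004 * exp (-(0.0002 * (l / y))) := by
    rw [← exp_add, ← exp_add, ← exp_add]; ring_nf
  have h5 : exp (0.0004 : ℝ) ≤ 1.001 := by
    have := exp_bound_div_one_sub_of_interval (x := 0.0004) (by norm_num) (by norm_num)
    refine this.trans (by norm_num)
  calc _ = 48 * n * (exp (0.0001 * (l / y)) * exp (0.0001 * (l / y)) *
      exp (-(0.0004 * (l / y - 1)))) * (l + 0.0001 * (l / y)) := by ring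
    _ = 48 * n * (exp 0.0004 * exp (-(0.0002 * (l / y)))) * (l + 0.0001 * (l / y)) := by rw [h4]
    _ ≤ 48 * n * (1.001 * (1 / (10 ^ 4 * l ^ 2))) * (l + 0.0001 * l) := by
      have : 0 ≤ l / y := div_nonneg hl0.le (by linarith)
      gcongr
    _ = (48 * 1.001 / 10 ^ 4 * 1.0001) * (n / l) := by field_simp; norm_num
    _ ≤ _ := by
      gcongr
      norm_num

/-- The contribution of the inert primes. -/
lemma inert_contribution_le {n τ Q : ℝ} (hn : exp (exp (10 ^ 10)) ≤ n)
    (hτ : τ ^ 3 ≤ 8 ^ 8 * n) (hQ : 2 ≤ Q) (hQ2 : 3 * Q ≤ log (log n)) :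
    τ * (log 4 + 3 * √(2 * n) * log Q) ≤ 0.1 * (n / log n) := by
  obtain ⟨h1, h2⟩ := exp_le_log_of_exp_exp_le hn
  have hn0 : 0 < n := (exp_pos _).trans_le hn
  have hl0 : 0 < log n := (exp_pos _).trans_le h1
  have h10 := quadratic_le_exp_of_nonneg (by norm_num : (0 : ℝ) ≤ 10 ^ 10)
  have hlbig : (10 : ℝ) ^ 15 ≤ log n := by
    have : (10 : ℝ) ^ 15 ≤ 1 + 10 ^ 10 + (10 ^ 10) ^ 2 / 2 := by norm_num
    exact this.trans (h10.trans h1)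
  have hQl : log Q ≤ log n := by
    have h3 := log_le_sub_one_of_pos (by linarith : 0 < Q)
    have h4 := log_le_sub_one_of_pos hl0
    linarith
  obtain ⟨u, hu⟩ : ∃ u, u = exp (log n / 6) := ⟨_, rfl⟩
  have hu0 : 0 < u := hu ▸ exp_pos _
  have hun : u ^ 6 = n := by
    rw [hu, ← exp_nat_mul]
    push_cast
    rw [mul_div_cancel₀ _ (by norm_num), exp_log hn0]
  have hubig : 16640 * log n ^ 2 ≤ u := by
    have h3 := pow_div_factorial_le_exp (log n / 6) (by positivity) 4
    rw [← hu] at h3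
    norm_num [Nat.factorial] at h3
    nlinarith [mul_le_mul hlbig hlbig (by positivity) hl0.le, sq_nonneg (log n)]
  have hτu : τ ≤ 256 * u ^ 2 := by
    refine le_of_pow_le_pow_left₀ (n := 3) (by norm_num) (by positivity) (hτ.trans ?_)
    rw [← hun]
    apply le_of_eq
    ring
  have hsq : √(2 * n) ≤ 1.5 * u ^ 3 := by
    apply sqrt_le_iff.2 ⟨by positivity, ?_⟩
    rw [← hun]
    nlinarith [pow_pos hu0 6]
  have h4 : log 4 ≤ 2 := by
    rw [show (4 : ℝ) = 2 ^ 2 by norm_num, log_pow]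
    norm_num
    linarith [log_two_lt_d9]
  have hQ0 : 0 ≤ log Q := log_nonneg (by linarith)
  have hu1 : 1 ≤ u := by nlinarith
  have hu3 : 1 ≤ u ^ 3 := one_le_pow₀ hu1
  calc τ * (log 4 + 3 * √(2 * n) * log Q)
      ≤ 256 * u ^ 2 * (2 + 3 * (1.5 * u ^ 3) * log n) := by
        have : 0 ≤ log 4 := log_nonneg (by norm_num)
        gcongr
    _ ≤ 256 * u ^ 2 * (6.5 * u ^ 3 * log n) := by
        gcongr
        nlinarith
    _ = 0.1 * (u ^ 5 * (16640 * log n ^ 2) / log n) := by field_simp; norm_num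
    _ ≤ 0.1 * (u ^ 5 * u / log n) := by gcongr
    _ = 0.1 * (n / log n) := by rw [← hun]; ring

/-- The lower bound for the totient. -/
lemma totient_log_ge {n φ Q : ℝ} (hn : exp (exp (10 ^ 10)) ≤ n)
    (hφ : n ≤ φ * (log n / log 2 + 1)) (hQ : 2 ≤ Q) :
    0.2 * (n / log n) + 2 * log n < φ * log Q - 32 := by
  obtain ⟨h1, h2⟩ := exp_le_log_of_exp_exp_le hn
  have hn0 : 0 < n := (exp_pos _).trans_le hn
  have hl0 : 0 < log n := (exp_pos _).trans_le h1
  have h10 := add_one_le_exp (10 ^ 10 : ℝ)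
  have hlbig : (10 : ℝ) ^ 10 ≤ log n := by linarith
  have hl2 := log_two_gt_d9
  have hl2' := log_two_lt_d9
  have h3 : 2 * log n + 32 ≤ 0.1 * (n / log n) := by
    have h4 := pow_div_factorial_le_exp (log n) hl0.le 4
    rw [exp_log hn0] at h4
    norm_num [Nat.factorial] at h4
    have h5 : 30 * log n ≤ n / log n := by
      rw [le_div_iff₀ hl0]
      nlinarith [mul_le_mul hlbig hlbig (by positivity) hl0.le, sq_nonneg (log n)]
    linarith
  have h6 : n * log 2 ≤ φ * (log n + log 2) := by
    calc n * log 2 ≤ φ * (log n / log 2 + 1) * log 2 := by gcongr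
      _ = _ := by field_simp
  have hφ0 : 0 ≤ φ := by
    by_contra! h
    have : φ * (log n + log 2) < 0 := mul_neg_of_neg_of_pos h (by linarith)
    nlinarith
  have h7 : 0.5 * (n / log n) ≤ φ := by
    rw [← mul_div_assoc, div_le_iff₀ hl0]
    have : φ * (log n + log 2) ≤ φ * (1.1 * log n) := by
      gcongr
      linarith
    nlinarith
  have h8 : φ * log 2 ≤ φ * log Q := by gcongr
  have h9 : φ * 0.69 ≤ φ * log 2 := by gcongr; linarith
  have : 0 < n / log n := div_pos hn0 hl0
  linarith

end AnalyticEstimates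

section PrimeClasses

open Finset QuadraticAlgebra

/-- The saving in the bound for the multiplicity of a prime with logarithm ratio `L`. -/
lemma card_mul_log_le {n p v : ℕ} (hn : Real.exp (Real.exp 10) ≤ (n : ℝ))
    (hp : n ≤ 24 * (p - 1)) (hp1 : 1 < p) {X : ℝ} (hpX : (p : ℝ) ≤ X)
    (hv : ∀ k, 2 * k + 1 ≤ v →
      (k + 1 : ℝ) ≤ p * Real.exp (-(0.0004 * Real.log p / Real.log (Real.log p)))) :
    v * Real.log p ≤ 2 * X * Real.exp (-(0.0004 * (Real.log n / Real.log (Real.log n) - 1))) *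
      Real.log X := by
  have hp0 : (1 : ℝ) < p := by exact_mod_cast hp1
  have hlp : 0 < Real.log p := Real.log_pos hp0
  have hX0 : 0 ≤ X := by linarith
  have hL := log_div_log_log_ge (n := n) (p := p) hn (by
    rw [div_le_iff₀ (by norm_num)]
    have : n ≤ p * 24 := by omega
    exact_mod_cast this)
  rcases Nat.eq_zero_or_pos v with rfl | hv0
  · have : 0 ≤ Real.log X := hlp.le.trans (Real.log_le_log (by linarith) hpX)
    rw [Nat.cast_zero, zero_mul]
    positivity
  have h1 := hv ((v - 1) / 2) (by omega)
  have h2 : (v : ℝ) ≤ 2 * (((v - 1) / 2 : ℕ) + 1 : ℝ) := by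
    have : v ≤ 2 * ((v - 1) / 2 + 1) := by omega
    exact_mod_cast this
  have h3 : (v : ℝ) ≤
      2 * X * Real.exp (-(0.0004 * (Real.log n / Real.log (Real.log n) - 1))) := by
    calc (v : ℝ) ≤ 2 * (p * Real.exp (-(0.0004 * Real.log p / Real.log (Real.log p)))) := by
          linarith
      _ ≤ 2 * (X * Real.exp (-(0.0004 * (Real.log n / Real.log (Real.log n) - 1)))) := by
          rw [mul_div_assoc]
          gcongr
      _ = _ := by ring
  gcongr

/-- A prime divisor of the index divides the cyclotomic value at most twice. -/
lemma factorization_le_two_of_dvd {q a : ℤ} {n p : ℕ} (hn : 240 < n) (hp : p.Prime) (hpn : p ∣ n)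
    (hN : norm (cyclotomicValue q a n) ≠ 0)
    (hdvd : p ∣ (norm (cyclotomicValue q a n)).natAbs) :
    (norm (cyclotomicValue q a n)).natAbs.factorization p ≤ 2 := by
  by_contra! hc
  have hN' : (norm (cyclotomicValue q a n)).natAbs ≠ 0 := Int.natAbs_ne_zero.2 hN
  have h3 : (p : ℤ) ^ 3 ∣ norm (cyclotomicValue q a n) := by
    have := (hp.pow_dvd_iff_le_factorization hN').2 hc
    exact_mod_cast Int.natCast_dvd.2 this
  obtain ⟨k, m, hm, rfl⟩ := Nat.exists_eq_pow_mul_and_not_dvd (n := n) (by omega) p hp.ne_one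
  have hm0 : 0 < m := Nat.pos_of_ne_zero fun h => hm (h ▸ dvd_zero p)
  have hk : 0 < k := Nat.pos_of_ne_zero fun h => hm (by simpa [h] using hpn)
  refine not_prime_pow_three_dvd hp hm hm0 hk ?_ h3
  by_contra! hor
  have hdiv := dvd_sq_sub_one hp ((Nat.coprime_comm.1 ((hp.coprime_iff_not_dvd).2 hm)))
    (Int.natCast_dvd.2 hdvd)
  have hp2 := hp.two_le
  have hmle : m ≤ p ^ 2 - 1 := Nat.le_of_dvd (by have : 2 ^ 2 ≤ p ^ 2 := by gcongr
                                                 omega) hdiv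
  have hp4 : p ^ 2 ≤ 16 := by
    have : p ≤ 4 := by omega
    calc p ^ 2 ≤ 4 ^ 2 := by gcongr
      _ = 16 := by norm_num
  have hk2 : p ^ k ≤ p ^ 2 := Nat.pow_le_pow_right (by omega) (by omega)
  have : p ^ k * m ≤ 16 * 15 := Nat.mul_le_mul (hk2.trans hp4) (by omega)
  omega

/-- The product of the conjugation defects of the small divisors. -/
noncomputable def defectProduct (q a : ℤ) (n : ℕ) : ℕ :=
  ∏ d ∈ n.divisors with d ^ 2 ≤ 2 * n, (norm (conjDefect q a d)).natAbs

lemma defectProduct_ne_zero {q a : ℤ} (hq : 2 ≤ q) (ha : a ^ 2 < 4 * q) {α : ℂ}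
    (hα : α ^ 2 - a * α + q = 0)
    (hdeg : (omega : QuadraticAlgebra ℤ (-q) a) ^ 24 ≠ (q : QuadraticAlgebra ℤ (-q) a) ^ 12)
    (n : ℕ) : defectProduct q a n ≠ 0 :=
  prod_ne_zero_iff.2 fun _ hd => Int.natAbs_ne_zero.2 <| norm_conjDefect_ne_zero hq ha hα hdeg <|
    Nat.pos_of_mem_divisors (mem_filter.1 hd).1

lemma log_defectProduct_le {q a : ℤ} (hq : 2 ≤ q) (ha : a ^ 2 < 4 * q) {α : ℂ}
    (hα : α ^ 2 - a * α + q = 0)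
    (hdeg : (omega : QuadraticAlgebra ℤ (-q) a) ^ 24 ≠ (q : QuadraticAlgebra ℤ (-q) a) ^ 12)
    (n : ℕ) :
    Real.log (defectProduct q a n) ≤
      #n.divisors * (Real.log 4 + 3 * √(2 * n) * Real.log q) := by
  have hq1 : (2 : ℝ) ≤ q := by exact_mod_cast hq
  have hlq : 0 ≤ Real.log q := Real.log_nonneg (by linarith)
  have hl4 : 0 ≤ Real.log 4 := Real.log_nonneg (by norm_num)
  have hne : ∀ d ∈ n.divisors.filter (fun d => d ^ 2 ≤ 2 * n),
      (norm (conjDefect q a d)).natAbs ≠ 0 := prod_ne_zero_iff.1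
    (defectProduct_ne_zero hq ha hα hdeg n)
  rw [defectProduct, Nat.cast_prod, Real.log_prod fun d hd => Nat.cast_ne_zero.2 (hne d hd)]
  calc _ ≤ ∑ _d ∈ n.divisors.filter (fun d => d ^ 2 ≤ 2 * n),
        (Real.log 4 + 3 * √(2 * n) * Real.log q) := by
        refine sum_le_sum fun d hd => ?_
        have h0 : ((norm (conjDefect q a d)).natAbs : ℝ) = ((norm (conjDefect q a d) : ℤ) : ℝ) := by
          have : 0 ≤ ((norm (conjDefect q a d) : ℤ) : ℝ) := by
            rw [norm_evalRoot_sq ha hα]; positivity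
          rw [Nat.cast_natAbs, Int.cast_abs, abs_of_nonneg this]
        have h1 := norm_conjDefect_le hq ha hα d
        rw [← h0] at h1
        have h2 := Real.log_le_log (by
          exact_mod_cast Nat.pos_of_ne_zero (hne d hd)) h1
        rw [Real.log_mul (by norm_num) (by positivity), Real.log_pow] at h2
        refine h2.trans ?_
        have h3 : (d : ℝ) ≤ √(2 * n) := Real.le_sqrt_of_sq_le (by
          exact_mod_cast (mem_filter.1 hd).2)
        push_cast
        gcongr
    _ ≤ _ := by
        rw [sum_const, nsmul_eq_mul]
        gcongr
        exact filter_subset _ _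

/-- The large primes dividing the cyclotomic value are split, with small multiplicity, or inert. -/
lemma prime_class_of_not_dvd {q a : ℤ} (hq : 2 ≤ q) (ha : a ^ 2 < 4 * q) {n p : ℕ}
    (hn : Real.exp (Real.exp (max (10 ^ 10) (3 * (q : ℝ)))) ≤ (n : ℝ)) (hp : p.Prime)
    (hpn : ¬ p ∣ n) (hN : norm (cyclotomicValue q a n) ≠ 0)
    (hdvd : p ∣ (norm (cyclotomicValue q a n)).natAbs) {X : ℝ} (hpX : (p : ℝ) ≤ X) :
    (n ∣ 24 * (p - 1) ∧ (norm (cyclotomicValue q a n)).natAbs.factorization p * Real.log p ≤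
      2 * X * Real.exp (-(0.0004 * (Real.log n / Real.log (Real.log n) - 1))) * Real.log X) ∨
    ((omega : QuadraticAlgebra ℤ (-q) a) ^ 24 ≠ (q : QuadraticAlgebra ℤ (-q) a) ^ 12 ∧
      p ^ (norm (cyclotomicValue q a n)).natAbs.factorization p ∣ defectProduct q a n) := by
  have : Fact p.Prime := ⟨hp⟩
  have hcop : n.Coprime p := Nat.coprime_comm.1 ((hp.coprime_iff_not_dvd).2 hpn)
  have hN' : (norm (cyclotomicValue q a n)).natAbs ≠ 0 := Int.natAbs_ne_zero.2 hN
  have hdvd' : (p : ℤ) ∣ norm (cyclotomicValue q a n) := Int.natCast_dvd.2 hdvd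
  have hpow : ∀ v, v ≤ (norm (cyclotomicValue q a n)).natAbs.factorization p →
      (p : ℤ) ^ v ∣ norm (cyclotomicValue q a n) := fun v hv => by
    exact_mod_cast Int.natCast_dvd.2 ((hp.pow_dvd_iff_le_factorization hN').2 hv)
  have hp2 := hp.two_le
  have hn0 : n ≠ 0 := by
    rintro rfl
    exact hpn (dvd_zero p)
  have hnp : n ≤ p ^ 2 := by
    have h1 := dvd_sq_sub_one (k := 0) (m := n) hp hcop (by simpa using hdvd')
    have h2 : 2 ^ 2 ≤ p ^ 2 := by gcongr
    have := Nat.le_of_dvd (by omega) h1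
    omega
  obtain ⟨hpbig, hB, hp4q⟩ := prime_size_of_sq_ge (p := (p : ℝ)) hn (by exact_mod_cast hp.pos)
    (by exact_mod_cast hnp)
  have hn10 : Real.exp (Real.exp 10) ≤ (n : ℝ) := by
    refine le_trans ?_ hn
    gcongr
    exact le_max_of_le_left (by norm_num)
  have hsmall : n ∣ 24 * (p - 1) → (∀ k : ℕ, (p : ℤ) ^ (2 * k + 1) ∣ norm (cyclotomicValue q a n) →
      (k + 1 : ℝ) ≤ p * Real.exp (-(0.0004 * Real.log p / Real.log (Real.log p)))) →
      (n ∣ 24 * (p - 1) ∧ (norm (cyclotomicValue q a n)).natAbs.factorization p * Real.log p ≤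
      2 * X * Real.exp (-(0.0004 * (Real.log n / Real.log (Real.log n) - 1))) * Real.log X) :=
    fun h1 h2 => ⟨h1, card_mul_log_le hn10 (Nat.le_of_dvd (by omega) h1) hp.one_lt hpX
      fun k hk => h2 k (hpow _ hk)⟩
  by_cases hdeg :
      (omega : QuadraticAlgebra ℤ (-q) a) ^ 24 = (q : QuadraticAlgebra ℤ (-q) a) ^ 12
  · exact .inl (hsmall (dvd_of_degenerate hp hcop hdvd' hdeg) fun k hk =>
      degenerate_bound hq hdeg hp hcop hk hpbig hB)
  rcases split_or_inert hcop hdvd' with ⟨⟨b, hb⟩, hnp1⟩ | ⟨hin, r, hr, hrp⟩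
  · refine .inl (hsmall (hnp1.mul_left 24) fun k hk => split_bound hq ha hp hcop ?_ hb hk hpbig hB)
    intro h
    have h1 : (p : ℤ) ∣ 4 * q - a ^ 2 := by
      rw [← neg_sub]
      exact h.neg_right
    have h2 := Int.le_of_dvd (by linarith) h1
    have h3 : 4 * q < p := by exact_mod_cast hp4q
    nlinarith [sq_nonneg a]
  · obtain ⟨d, hd, hd2, hd3⟩ := inert_bound hcop hin hr hrp (hpow _ le_rfl)
    refine .inr ⟨hdeg, ?_⟩
    refine dvd_trans ?_ (dvd_prod_of_mem _ (mem_filter.2 ⟨Nat.mem_divisors.2 ⟨hd, hn0⟩, hd2⟩))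
    rw [← Int.natCast_dvd]
    exact_mod_cast hd3

end PrimeClasses

theorem big_prime_factor_of_elliptic_order (q a : ℤ) (hq : 2 ≤ q) (ha : a ^ 2 < 4 * q)
    (α : ℂ) (hα : α ^ 2 - (a : ℂ) * α + (q : ℂ) = 0)
    (n : ℕ) (hn : Real.exp (Real.exp (max (10 ^ 10) (3 * (q : ℝ)))) ≤ (n : ℝ))
    (m : ℤ) (hm : (m : ℂ) = (α ^ n - 1) * ((starRingEnd ℂ) α ^ n - 1)) :
    ∃ p : ℕ, p.Prime ∧ (p : ℤ) ∣ m ∧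
      (n : ℝ) * Real.exp (0.0001 * Real.log n / Real.log (Real.log n)) ≤ (p : ℝ) := by
  by_contra! H
  obtain ⟨X, hX⟩ : ∃ X, X = (n : ℝ) * Real.exp (0.0001 * Real.log n / Real.log (Real.log n)) :=
    ⟨_, rfl⟩
  rw [← hX] at H
  have hn' : Real.exp (Real.exp (10 ^ 10)) ≤ (n : ℝ) := by
    refine le_trans ?_ hn
    gcongr
    exact le_max_left _ _
  have hnR : (0 : ℝ) < n := (Real.exp_pos _).trans_le hn'
  have hn0 : 0 < n := by exact_mod_cast hnR
  obtain ⟨hl1, hl2⟩ := exp_le_log_of_exp_exp_le hn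
  have hl3 := (le_max_left (10 ^ 10) (3 * (q : ℝ))).trans hl2
  have hl4 := (le_max_right (10 ^ 10) (3 * (q : ℝ))).trans hl2
  have hl : 0 < Real.log n := (Real.exp_pos _).trans_le hl1
  have hn240 : 240 < n := by
    have h1 := Real.log_le_sub_one_of_pos hnR
    have h2 := Real.log_le_sub_one_of_pos hl
    have : (240 : ℝ) < n := by linarith
    exact_mod_cast this
  have hX1 : 1 ≤ X := by
    rw [hX]
    have : (1 : ℝ) ≤ n := by exact_mod_cast hn0
    have : 0 ≤ 0.0001 * Real.log n / Real.log (Real.log n) :=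
      div_nonneg (by positivity) (by linarith)
    exact one_le_mul_of_one_le_of_one_le ‹_› (Real.one_le_exp this)
  have hq2 : (2 : ℝ) ≤ q := by exact_mod_cast hq
  have hlow := log_norm_cyclotomicValue_ge hq ha hα hn0
  have htot := totient_log_ge (φ := n.totient) hn' (by
    refine (Nat.cast_le.2 (le_totient_mul_log hn0.ne')).trans ?_
    push_cast
    gcongr
    rw [← Real.logb]
    exact Real.natLog_le_logb n 2) hq2
  set M := QuadraticAlgebra.norm (cyclotomicValue q a n) with hM
  have hM0 : M ≠ 0 := by
    intro h0
    rw [h0, Int.cast_zero, Real.log_zero] at hlow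
    have : 0 < (n : ℝ) / Real.log n := div_pos hnR hl
    linarith
  have hMabs : ((M : ℤ) : ℝ) = (M.natAbs : ℝ) := by
    have : 0 ≤ ((M : ℤ) : ℝ) := by
      rw [hM, norm_evalRoot_sq ha hα]; positivity
    rw [Nat.cast_natAbs, Int.cast_abs, abs_of_nonneg this]
  set K := 2 * X * Real.exp (-(0.0004 * (Real.log n / Real.log (Real.log n) - 1))) * Real.log X
    with hK
  have hK0 : 0 ≤ K := by
    have := Real.log_nonneg hX1
    positivity
  obtain ⟨P, hP0, hPdvd, hPlog⟩ : ∃ P : ℕ, P ≠ 0 ∧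
      ((QuadraticAlgebra.omega : QuadraticAlgebra ℤ (-q) a) ^ 24 ≠
        (q : QuadraticAlgebra ℤ (-q) a) ^ 12 → defectProduct q a n ∣ P) ∧
      Real.log P ≤ (n.divisors.card : ℝ) * (Real.log 4 + 3 * √(2 * n) * Real.log q) := by
    by_cases hdeg :
        (QuadraticAlgebra.omega : QuadraticAlgebra ℤ (-q) a) ^ 24 =
          (q : QuadraticAlgebra ℤ (-q) a) ^ 12
    · refine ⟨1, one_ne_zero, fun h => absurd hdeg h, ?_⟩
      have h1 : 0 ≤ Real.log q := Real.log_nonneg (by linarith)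
      have h2 : 0 ≤ Real.log 4 := Real.log_nonneg (by norm_num)
      rw [Nat.cast_one, Real.log_one]
      positivity
    · exact ⟨_, defectProduct_ne_zero hq ha hα hdeg n, fun _ => dvd_rfl,
        log_defectProduct_le hq ha hα hdeg n⟩
  have hup := log_le_of_prime_classes (N := M.natAbs) hn0.ne' hP0
    ((Finset.range (⌊X⌋₊ + 1)).filter fun p => 2 ≤ p ∧ n ∣ 24 * (p - 1)) hK0 fun p hp hpM => by
      by_cases hpn : p ∣ n
      · exact .inl ⟨hpn, factorization_le_two_of_dvd hn240 hp hpn hM0 hpM⟩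
      have hpX := (H p hp ((Int.natCast_dvd.2 hpM).trans
        (norm_cyclotomicValue_dvd ha hα hm))).le
      rcases prime_class_of_not_dvd hq ha hn hp hpn hM0 hpM hpX with ⟨h1, h2⟩ | ⟨h1, h2⟩
      · refine .inr (.inl ⟨Finset.mem_filter.2 ⟨?_, hp.two_le, h1⟩, h2⟩)
        exact Finset.mem_range_succ_iff.2 (Nat.le_floor hpX)
      · exact .inr (.inr (h2.trans (hPdvd h1)))
  have hB := card_filter_dvd_le hn0 (zero_le_one.trans hX1)
  have hsplit := split_contribution_le hn'
  rw [← hX, ← hK] at hsplit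
  have hinert := inert_contribution_le (τ := n.divisors.card) hn'
    (by exact_mod_cast card_divisors_cube_le hn0.ne') hq2 hl4
  have hBK := mul_le_mul_of_nonneg_right hB hK0
  have hXn : 24 * X / n = 24 * Real.exp (0.0001 * Real.log n / Real.log (Real.log n)) := by
    rw [hX]; field_simp
  rw [hXn] at hBK
  rw [hMabs] at hlow
  have : 0 < (n : ℝ) / Real.log n := div_pos hnR hl
  linarith
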